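/- arXiv:1603.01371 — 4 statements merged into one kernel-verified Lean document; each statement's English description precedes it below -/
import Mathlib

section
/- Let ε > 0 and let G be a finite (1+ε)-tough 5-chordal graph. If G contains an edge-dominating cycle, then G is prism-Hamiltonian, i.e., the Cartesian product G × K₂ has a Hamiltonian cycle. -/
open SimpleGraph Finset

variable {V : Type*}

/-- `G` is `β`-tough: whenever removing a vertex set `S` leaves at least two connected
components, we have `β * (number of components) ≤ |S|`. -/
def IsTough [Fintype V] (β : ℝ) (G : SimpleGraph V) : Prop :=
  ∀ S : Finset V,
    2 ≤ Nat.card (G.induce ((S : Set V)ᶜ)).ConnectedComponent →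
    β * Nat.card (G.induce ((S : Set V)ᶜ)).ConnectedComponent ≤ S.card

/-- A chord of a closed walk `c` in `G`: an edge of `G` between two vertices of `c`
which is not an edge of `c` (hence joins non-consecutive vertices of a cycle). -/
def HasChord (G : SimpleGraph V) {u : V} (c : G.Walk u u) : Prop :=
  ∃ x y : V, x ∈ c.support ∧ y ∈ c.support ∧ G.Adj x y ∧ s(x, y) ∉ c.edges

/-- `G` is 5-chordal: every cycle of length at least 5 has a chord. -/
def FiveChordal (G : SimpleGraph V) : Prop :=
  ∀ (u : V) (c : G.Walk u u), c.IsCycle → 5 ≤ c.length → HasChord G c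

/-- A cycle `c` is edge-dominating in `G` if the induced subgraph on the vertices
outside of `c` contains no edge. -/
def IsEdgeDominating (G : SimpleGraph V) {u : V} (c : G.Walk u u) : Prop :=
  ∀ x y : V, x ∉ c.support → y ∉ c.support → ¬ G.Adj x y

/-- `G` is prism-Hamiltonian if the Cartesian (box) product of `G` with `K₂`
has a Hamiltonian cycle. -/
def PrismHamiltonian [Fintype V] [DecidableEq V] (G : SimpleGraph V) : Prop :=
  (G □ (⊤ : SimpleGraph (Fin 2))).IsHamiltonian

/-- `G` is `k`-connected: `G` has more than `k` vertices and removing any set of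
fewer than `k` vertices leaves a connected graph. -/
def KConnected [Fintype V] (k : ℕ) (G : SimpleGraph V) : Prop :=
  k < Fintype.card V ∧
    ∀ S : Finset V, S.card < k → (G.induce ((S : Set V)ᶜ)).Connected

/-- The degree `d(e)` of an edge `e = uv`: the number of vertices other than `u, v`
adjacent to `u` or `v`. -/
noncomputable def edgeDeg (G : SimpleGraph V) (u v : V) : ℕ :=
  ((G.neighborSet u ∪ G.neighborSet v) \ {u, v}).ncard

/-- Two edges (given by their endpoints) are remote: they are vertex-disjoint and
no edge of `G` joins an endpoint of one to an endpoint of the other. -/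
def Remote (G : SimpleGraph V) (e₁ e₂ : V × V) : Prop :=
  e₁.1 ≠ e₂.1 ∧ e₁.1 ≠ e₂.2 ∧ e₁.2 ≠ e₂.1 ∧ e₁.2 ≠ e₂.2 ∧
  ¬ G.Adj e₁.1 e₂.1 ∧ ¬ G.Adj e₁.1 e₂.2 ∧ ¬ G.Adj e₁.2 e₂.1 ∧ ¬ G.Adj e₁.2 e₂.2

/-- `Link G p q M`: some walk from `p` to `q` in the prism over `G` visits, after its starting
vertex, exactly the vertices of `M` and finally `q`. -/
def Link (G : SimpleGraph V) (p q : V × Fin 2) (M : Multiset (V × Fin 2)) : Prop :=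
  ∃ w : (G □ (⊤ : SimpleGraph (Fin 2))).Walk p q,
    (w.support.tail : Multiset (V × Fin 2)) = M + {q}

namespace Link

variable {G : SimpleGraph V} {p q r : V × Fin 2} {M N : Multiset (V × Fin 2)}

lemma trans (h : Link G p q M) (h' : Link G q r N) : Link G p r (M + {q} + N) := by
  obtain ⟨w, hw⟩ := h
  obtain ⟨w', hw'⟩ := h'
  refine ⟨w.append w', ?_⟩
  rw [Walk.tail_support_append, ← Multiset.coe_add, hw, hw']
  abel

lemma of_adj (h : (G □ (⊤ : SimpleGraph (Fin 2))).Adj p q) : Link G p q 0 :=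
  ⟨h.toWalk, by simp⟩

lemma symm (h : Link G p q M) : Link G q p M := by
  obtain ⟨w, hw⟩ := h
  refine ⟨w.reverse, ?_⟩
  have h1 : (w.support : Multiset _) = {p} + (M + {q}) := by
    rw [← hw, ← Walk.cons_tail_support w]; rfl
  have h2 : (w.reverse.support : Multiset _) = {p} + (M + {q}) := by
    rw [← h1, Walk.support_reverse]; simp
  rw [← Walk.cons_tail_support w.reverse, ← Multiset.cons_coe, ← Multiset.singleton_add] at h2
  apply add_left_cancel (a := ({q} : Multiset _))
  rw [h2]; abel

lemma prismHamiltonian [Fintype V] [DecidableEq V] (h : Link G p p M)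
    (hM : M + {p} = (univ : Finset (V × Fin 2)).val) (h3 : 3 ≤ Fintype.card (V × Fin 2)) :
    PrismHamiltonian G := by
  obtain ⟨w, hw⟩ := h
  rw [hM] at hw
  intro _
  refine ⟨p, w, ?_⟩
  have hnd : w.support.tail.Nodup := by
    rw [← Multiset.coe_nodup, hw]; exact univ.nodup
  have hlen : w.support.tail.length = Fintype.card (V × Fin 2) := by
    rw [← Multiset.coe_card, hw]; rfl
  rw [Walk.isHamiltonianCycle_iff_isCycle_and_support_count_tail_eq_one]
  refine ⟨?_, fun a => ?_⟩
  · cases w with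
    | nil => simp at hlen; simp at h3; omega
    | cons h q =>
      rename_i v
      rw [Walk.support_cons, List.tail_cons] at hnd hlen
      rw [Walk.cons_isCycle_iff]
      have hq : q.IsPath := (Walk.isPath_def _).2 hnd
      refine ⟨hq, fun he => ?_⟩
      have h1 : q.length = 1 := hq.length_eq_one_of_mem_edges (by rwa [Sym2.eq_swap])
      rw [Walk.length_support] at hlen; omega
  · rw [← Multiset.coe_count, hw]
    exact Multiset.count_eq_one_of_mem univ.nodup (mem_univ_val a)

end Link

/-- The two copies of `v` in the prism. -/
def vertexPair (v : V) : Multiset (V × Fin 2) := {(v, 0)} + {(v, 1)}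

lemma vertexPair_eq (v : V) (l : Fin 2) :
    vertexPair v = {(v, l)} + {(v, l + 1)} := by
  fin_cases l
  · rfl
  · exact add_comm _ _

/-- `Twist G k u w M`: from either copy of `u` one can reach the copy of `w` lying `k` levels
further by a walk in the prism with interior `M`. -/
def Twist (G : SimpleGraph V) (k : Fin 2) (u w : V) (M : Multiset (V × Fin 2)) : Prop :=
  ∀ l : Fin 2, Link G (u, l) (w, l + k) M

namespace Twist

variable {G : SimpleGraph V} {u v w x : V} {k k' : Fin 2} {M N Mv : Multiset (V × Fin 2)}

lemma zero_zero (h : Twist G 0 u w M) : Link G (u, 0) (w, 0) M := h 0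
lemma one_one (h : Twist G 0 u w M) : Link G (u, 1) (w, 1) M := h 1
lemma zero_one (h : Twist G 1 u w M) : Link G (u, 0) (w, 1) M := h 0
lemma one_zero (h : Twist G 1 u w M) : Link G (u, 1) (w, 0) M := h 1

lemma symm (h : Twist G k u w M) : Twist G k w u M := fun l => by
  have h2 : ∀ l k : Fin 2, l + k + k = l := by decide
  simpa [h2] using (h (l + k)).symm

lemma of_adj (h : G.Adj u w) : Twist G 0 u w 0 := fun l =>
  Link.of_adj (by simpa [boxProd_adj] using h)

lemma vertical (v : V) : Twist G 1 v v 0 := fun l =>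
  Link.of_adj (by fin_cases l <;> simp [boxProd_adj])

/-- Passing through both copies of an intermediate vertex. -/
lemma trans (h : Twist G k u v M) (hv : Twist G 1 v v Mv) (h' : Twist G k' v w N) :
    Twist G (k + 1 + k') u w (M + (vertexPair v + Mv) + N) := fun l => by
  have := ((h l).trans (hv (l + k))).trans (h' (l + k + 1))
  rw [vertexPair_eq v (l + k)]
  convert this using 1
  · simp [add_assoc]
  · abel

lemma through (hu : G.Adj x u) (hw : G.Adj x w) : Twist G 1 u w (vertexPair x) := by
  simpa using (of_adj hu.symm).trans (vertical x) (of_adj hw)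

end Twist

lemma sum_vertexPair [Fintype V] [DecidableEq V] :
    ∑ v : V, vertexPair v = (univ : Finset (V × Fin 2)).val := by
  ext ⟨u, l⟩
  rw [Multiset.count_eq_one_of_mem univ.nodup (mem_univ_val _), Multiset.count_sum',
    Finset.sum_eq_single u]
  · rw [vertexPair_eq u l]; fin_cases l <;> simp
  · intro v _ hv
    simp [vertexPair, hv.symm]
  · simp

/-- Vertices outside `C` are attached to vertices of `C` as detours along vertical edges. -/
lemma exists_detours [Fintype V] [DecidableEq V] (G : SimpleGraph V) (C J X W : Finset V)
    (hJC : Disjoint C J) (hX : Disjoint (C ∪ J) X) (hU : C ∪ J ∪ X = univ)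
    (m : V → V) (hm : Set.InjOn m J) (hmG : ∀ x ∈ J, G.Adj x (m x)) (hmC : ∀ x ∈ J, m x ∈ C)
    (hmW : ∀ x ∈ J, m x ∉ W) :
    ∃ D : V → Multiset (V × Fin 2), (∀ v ∈ W, D v = 0) ∧ (∀ v, Twist G 1 v v (D v)) ∧
      ∑ v ∈ C, (vertexPair v + D v) + ∑ x ∈ X, vertexPair x =
        (univ : Finset (V × Fin 2)).val := by
  refine ⟨fun v => ∑ x ∈ J with m x = v, vertexPair x, fun v hv => ?_, fun v => ?_, ?_⟩
  · beta_reduce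
    rw [Finset.filter_eq_empty_iff.2, Finset.sum_empty]
    rintro x hx rfl
    exact hmW x hx hv
  · by_cases h : ∃ x ∈ J, m x = v
    · obtain ⟨x, hx, rfl⟩ := h
      have : J.filter (fun y => m y = m x) = {x} := by
        ext y
        simp only [mem_filter, mem_singleton]
        exact ⟨fun h => hm h.1 hx h.2, by rintro rfl; exact ⟨hx, rfl⟩⟩
      simp only [this, sum_singleton]
      exact Twist.through (hmG x hx) (hmG x hx)
    · push Not at h
      simp only [Finset.filter_eq_empty_iff.2 (fun x hx => h x hx), sum_empty]
      exact Twist.vertical v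
  · rw [sum_add_distrib, sum_fiberwise_of_maps_to hmC, ← sum_union hJC, ← sum_union hX, hU,
      sum_vertexPair]

/-- `c : ℤ → V` is an `n`-periodic parametrization of a cycle of `G` with vertex set `C`. -/
structure IsCycleParam (G : SimpleGraph V) (n : ℤ) (C : Finset V) (c : ℤ → V) : Prop where
  three_le : 3 ≤ n
  periodic : ∀ i, c (i + n) = c i
  adj : ∀ i, G.Adj (c i) (c (i + 1))
  dvd : ∀ i j, c i = c j → n ∣ j - i
  mem : ∀ v, v ∈ C ↔ ∃ i, c i = v

namespace IsCycleParam

variable {G : SimpleGraph V} {n : ℤ} {C : Finset V} {c : ℤ → V}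

lemma apply_mem (h : IsCycleParam G n C c) (i : ℤ) : c i ∈ C := (h.mem _).2 ⟨i, rfl⟩

lemma shift (h : IsCycleParam G n C c) (k : ℤ) : IsCycleParam G n C (fun i => c (i + k)) where
  three_le := h.three_le
  periodic i := by rw [← h.periodic (i + k)]; ring_nf
  adj i := by convert h.adj (i + k) using 2; ring
  dvd i j hij := by convert h.dvd _ _ hij using 1; ring
  mem v := by
    rw [h.mem]
    exact ⟨fun ⟨i, hi⟩ => ⟨i - k, by simpa using hi⟩, fun ⟨i, hi⟩ => ⟨_, hi⟩⟩

lemma reflect (h : IsCycleParam G n C c) (k : ℤ) : IsCycleParam G n C (fun i => c (k - i)) where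
  three_le := h.three_le
  periodic i := by rw [← h.periodic (k - (i + n))]; ring_nf
  adj i := by convert (h.adj (k - (i + 1))).symm using 2; ring
  dvd i j hij := by
    obtain ⟨m, hm⟩ := h.dvd (k - i) (k - j) hij
    exact ⟨-m, by linarith⟩
  mem v := by
    rw [h.mem]
    exact ⟨fun ⟨i, hi⟩ => ⟨k - i, by simpa using hi⟩, fun ⟨i, hi⟩ => ⟨_, hi⟩⟩

lemma sub_period (h : IsCycleParam G n C c) (i : ℤ) : c (i - n) = c i := by
  simpa using (h.periodic (i - n)).symm

lemma apply_period (h : IsCycleParam G n C c) : c n = c 0 := by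
  simpa using h.periodic 0

lemma apply_emod (h : IsCycleParam G n C c) (i : ℤ) : c (i % n) = c i := by
  have key : ∀ k : ℕ, ∀ i, c (i + n * k) = c i := by
    intro k
    induction k with
    | zero => simp
    | succ k ih =>
      intro i
      rw [← ih i, ← h.periodic (i + n * k)]; push_cast; ring_nf
  rw [Int.emod_def]
  obtain ⟨k, hk | hk⟩ := Int.eq_nat_or_neg (i / n)
  · rw [hk, ← key k (i - n * k)]; ring_nf
  · rw [hk, ← key k i]; ring_nf

lemma exists_pos (h : IsCycleParam G n C c) {v : V} (hv : v ∈ C) (a : ℤ) :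
    ∃ i, a ≤ i ∧ i < a + n ∧ c i = v := by
  obtain ⟨i, rfl⟩ := (h.mem v).1 hv
  have := h.three_le
  refine ⟨a + (i - a) % n, by have := Int.emod_nonneg (i - a) (by omega : n ≠ 0); omega, by
    have := Int.emod_lt_of_pos (i - a) (by omega : 0 < n); omega, ?_⟩
  have := (h.shift a).apply_emod (i - a)
  simp only [sub_add_cancel] at this
  rwa [add_comm]

lemma injOn (h : IsCycleParam G n C c) {i j : ℤ} (hij : c i = c j) (h1 : j - i < n)
    (h2 : i - j < n) : i = j := by
  by_contra hne
  have h3 := h.dvd _ _ hij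
  rcases lt_or_gt_of_ne hne with h4 | h4
  · have := Int.le_of_dvd (by omega) h3; omega
  · have := Int.le_of_dvd (by omega) ((dvd_neg.2 h3).trans (dvd_of_eq (by ring : -(j-i) = i - j)))
    omega

lemma sum_eq {A : Type*} [AddCommMonoid A] (h : IsCycleParam G n C c) (f : V → A) :
    ∑ v ∈ C, f v = ∑ t ∈ Ico 0 n, f (c t) := by
  symm
  refine sum_bij (fun t _ => c t) (fun t _ => h.apply_mem t) ?_ ?_ (fun _ _ => rfl)
  · intro a ha b hb hab
    rw [Finset.mem_Ico] at ha hb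
    exact h.injOn hab (by omega) (by omega)
  · intro v hv
    obtain ⟨i, h1, h2, rfl⟩ := h.exists_pos hv 0
    exact ⟨i, by rw [Finset.mem_Ico]; omega, rfl⟩

end IsCycleParam

lemma sum_Ico_split {A : Type*} [AddCommMonoid A] (f : ℤ → A) {i j k : ℤ} (hij : i < j)
    (hjk : j ≤ k) : ∑ t ∈ Ico i k, f t = f i + ∑ t ∈ Ioo i j, f t + ∑ t ∈ Ico j k, f t := by
  have h1 : Ico i k = insert i (Ioo i j ∪ Ico j k) := by
    ext; simp only [Finset.mem_Ico, mem_insert, Finset.mem_union, Finset.mem_Ioo]; omega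
  have h2 : Disjoint (Ioo i j) (Ico j k) := by
    rw [Finset.disjoint_left]; intro a; simp only [Finset.mem_Ico, Finset.mem_Ioo]; omega
  rw [h1, sum_insert (by simp; omega), sum_union h2, add_assoc]

namespace IsCycleParam

variable {G : SimpleGraph V} {n : ℤ} {C : Finset V} {c : ℤ → V} {D : V → Multiset (V × Fin 2)}

/-- The vertices of the prism met strictly between positions `i` and `j`. -/
noncomputable def segment (c : ℤ → V) (D : V → Multiset (V × Fin 2)) (i j : ℤ) : Multiset
  (V × Fin 2) :=
  ∑ t ∈ Ioo i j, (vertexPair (c t) + D (c t))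

lemma twist_aux (h : IsCycleParam G n C c) (hD : ∀ v, Twist G 1 v v (D v)) (i : ℤ) (k : ℕ) :
    Twist G (if Even k then 0 else 1) (c i) (c (i + 1 + k)) (segment c D i (i + 1 + k)) := by
  induction k with
  | zero =>
    have : Ioo i (i + 1) = ∅ := by
      ext; simp only [Finset.mem_Ioo, notMem_empty, iff_false]; omega
    simpa [segment, this] using Twist.of_adj (h.adj i)
  | succ k ih =>
    have h1 : Ioo i (i + 1 + (k + 1)) = insert (i + 1 + k : ℤ) (Ioo i (i + 1 + k)) := by
      ext; simp only [Finset.mem_Ioo, mem_insert]; omega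
    have := ih.trans (hD _) (Twist.of_adj (h.adj (i + 1 + k)))
    push_cast
    convert this using 1
    · by_cases hk : Even k <;> simp [Nat.even_add_one, hk]
    · ring_nf
    · ring_nf at *
      rw [segment, h1, sum_insert (by simp), segment]; abel

lemma twist_zero (h : IsCycleParam G n C c) (hD : ∀ v, Twist G 1 v v (D v)) {i j : ℤ}
    (hij : i < j) (hp : Odd (j - i)) : Twist G 0 (c i) (c j) (segment c D i j) := by
  obtain ⟨k, hk⟩ := Int.eq_ofNat_of_zero_le (by omega : 0 ≤ j - i - 1)
  obtain rfl : j = i + 1 + k := by omega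
  have : Even k := by
    rw [← Int.even_coe_nat]; rw [Int.odd_iff] at hp; rw [Int.even_iff]; omega
  simpa [this] using h.twist_aux hD i k

lemma twist_one (h : IsCycleParam G n C c) (hD : ∀ v, Twist G 1 v v (D v)) {i j : ℤ}
    (hij : i < j) (hp : Even (j - i)) : Twist G 1 (c i) (c j) (segment c D i j) := by
  obtain ⟨k, hk⟩ := Int.eq_ofNat_of_zero_le (by omega : 0 ≤ j - i - 1)
  obtain rfl : j = i + 1 + k := by omega
  have : ¬ Even k := by
    rw [← Int.even_coe_nat]; rw [Int.even_iff] at hp; rw [Int.even_iff]; omega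
  simpa [this] using h.twist_aux hD i k

lemma sum_eq_two (h : IsCycleParam G n C c) (D : V → Multiset (V × Fin 2)) {i : ℤ} (h0 : 0 < i)
    (hi : i < n) : ∑ v ∈ C, (vertexPair v + D v) =
      (vertexPair (c 0) + D (c 0)) + segment c D 0 i +
      ((vertexPair (c i) + D (c i)) + segment c D i n) := by
  rw [h.sum_eq, sum_Ico_split _ h0 hi.le, sum_Ico_split _ hi le_rfl]
  simp [segment]

lemma sum_eq_three (h : IsCycleParam G n C c) (D : V → Multiset (V × Fin 2)) {i j : ℤ} (h0 : 0 < i)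
    (hi : i < j) (hj : j < n) : ∑ v ∈ C, (vertexPair v + D v) =
      (vertexPair (c 0) + D (c 0)) + segment c D 0 i +
      (((vertexPair (c i) + D (c i)) + segment c D i j) +
      ((vertexPair (c j) + D (c j)) + segment c D j n)) := by
  rw [h.sum_eq, sum_Ico_split _ h0 (by omega), sum_Ico_split _ hi hj.le, sum_Ico_split _ hj le_rfl]
  simp [segment]

lemma sum_eq_four (h : IsCycleParam G n C c) (D : V → Multiset (V × Fin 2)) {i j k : ℤ}
    (h0 : 0 < i) (hi : i < j) (hj : j < k) (hk : k < n) : ∑ v ∈ C, (vertexPair v + D v) =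
      (vertexPair (c 0) + D (c 0)) + segment c D 0 i +
      (((vertexPair (c i) + D (c i)) + segment c D i j) +
      (((vertexPair (c j) + D (c j)) + segment c D j k) +
      ((vertexPair (c k) + D (c k)) + segment c D k n))) := by
  rw [h.sum_eq, sum_Ico_split _ h0 (by omega), sum_Ico_split _ hi (by omega),
    sum_Ico_split _ hj hk.le, sum_Ico_split _ hk le_rfl]
  simp [segment]

lemma sum_eq_five (h : IsCycleParam G n C c) (D : V → Multiset (V × Fin 2)) {i j k m : ℤ}
    (h0 : 0 < i) (hi : i < j) (hj : j < k) (hk : k < m) (hm : m < n) :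
    ∑ v ∈ C, (vertexPair v + D v) =
      (vertexPair (c 0) + D (c 0)) + segment c D 0 i +
      (((vertexPair (c i) + D (c i)) + segment c D i j) +
      (((vertexPair (c j) + D (c j)) + segment c D j k) +
      (((vertexPair (c k) + D (c k)) + segment c D k m) +
      ((vertexPair (c m) + D (c m)) + segment c D m n)))) := by
  rw [h.sum_eq, sum_Ico_split _ h0 (by omega), sum_Ico_split _ hi (by omega),
    sum_Ico_split _ hj (by omega), sum_Ico_split _ hk hm.le, sum_Ico_split _ hm le_rfl]
  simp [segment]

end IsCycleParam

/-- A system `D` of detours through vertices outside the cycle `C`, none at a vertex of `W`,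
covering together with the vertices of `X` the whole prism. -/
structure IsDetour [Fintype V] [DecidableEq V] (G : SimpleGraph V) (C W X : Finset V)
    (D : V → Multiset (V × Fin 2)) : Prop where
  eq_zero : ∀ v ∈ W, D v = 0
  twist : ∀ v, Twist G 1 v v (D v)
  sum_eq : ∑ v ∈ C, (vertexPair v + D v) + ∑ x ∈ X, vertexPair x =
    (univ : Finset (V × Fin 2)).val

namespace IsCycleParam

variable [Fintype V] [DecidableEq V] {G : SimpleGraph V} {n : ℤ} {C : Finset V} {c : ℤ → V}
  {D : V → Multiset (V × Fin 2)} {W X : Finset V}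

lemma prismHamiltonian (h : IsCycleParam G n C c) (hD : IsDetour G C W X D) {p : V × Fin 2}
    {M : Multiset (V × Fin 2)} (hl : Link G p p M)
    (hM : M + {p} = ∑ v ∈ C, (vertexPair v + D v) + ∑ x ∈ X, vertexPair x) :
    PrismHamiltonian G := by
  refine hl.prismHamiltonian (hM.trans hD.sum_eq) ?_
  have h1 : (#C : ℤ) = n := by
    have := h.sum_eq (fun _ => (1 : ℤ))
    have h3 := h.three_le
    simp at this
    omega
  have h2 := Finset.card_le_univ C
  have h3 := h.three_le
  rw [Fintype.card_prod, Fintype.card_fin]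
  omega

lemma prismHamiltonian_of_even (h : IsCycleParam G n C c) (hD : IsDetour G C ∅ ∅ D)
    (hn : Even n) : PrismHamiltonian G := by
  have s0 := h.twist_one hD.twist (by have := h.three_le; omega : 0 < n) (by simpa using hn)
  rw [h.apply_period] at s0
  refine h.prismHamiltonian hD (s0.zero_one.trans (hD.twist (c 0)).one_zero) ?_
  rw [h.sum_eq, sum_Ico_split _ (by have := h.three_le; omega : 0 < n) le_rfl]
  simp only [segment, vertexPair, Finset.Ico_self, sum_empty]
  abel

/-- Two adjacent triangles over a cycle edge. -/
lemma prismHamiltonian_of_adj_succ (h : IsCycleParam G n C c) (hn : Odd n) {i : ℤ} (hi0 : 0 < i)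
    (hi : Odd i) (hin : i + 1 < n) (h1 : G.Adj (c 0) (c i)) (h2 : G.Adj (c 0) (c (i + 1)))
    (hD : IsDetour G C {c 0} ∅ D) : PrismHamiltonian G := by
  have s0 := h.twist_zero hD.twist hi0 (by simpa using hi)
  have s1 := h.twist_zero hD.twist hin (by grind)
  have s2 := Twist.of_adj (h.adj i)
  have e1 := Twist.of_adj h1
  have e2 := Twist.of_adj h2
  have v1 := hD.twist (c i)
  have v2 := hD.twist (c (i + 1))
  rw [h.apply_period] at s1
  refine h.prismHamiltonian hD (s0.zero_zero.trans (v1.zero_one.trans (e1.symm.one_one.trans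
    (s1.symm.one_one.trans (v2.one_zero.trans e2.symm.zero_zero))))) ?_
  have : Ioo i (i + 1) = ∅ := by
    ext; simp only [Finset.mem_Ioo, notMem_empty, iff_false]; omega
  rw [h.sum_eq_three D hi0 (lt_add_one i) hin, hD.eq_zero (c 0) (by simp),
    segment.eq_1 c D i (i + 1), this]
  simp only [vertexPair, sum_empty]
  abel

/-- A vertex outside the cycle attached to two adjacent vertices of the cycle. -/
lemma prismHamiltonian_of_adj_of_detour (h : IsCycleParam G n C c) (hn : Odd n) {k : ℤ}
    (h0 : 0 < k) (hk : k < n) {x : V} (hx0 : G.Adj x (c 0)) (hxk : G.Adj x (c k))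
    (huw : G.Adj (c 0) (c k)) (hD : IsDetour G C {c 0, c k} {x} D) : PrismHamiltonian G := by
  have e := Twist.of_adj huw
  have t := Twist.through hx0 hxk
  rcases Int.even_or_odd k with hp | hp
  · have s0 := h.twist_one hD.twist h0 (by simpa using hp)
    have s1 := h.twist_zero hD.twist hk (by grind)
    rw [h.apply_period] at s1
    refine h.prismHamiltonian hD (s1.zero_zero.trans (s0.zero_one.trans (e.symm.one_one.trans
      (t.one_zero)))) ?_
    rw [h.sum_eq_two D h0 hk, hD.eq_zero (c 0) (by simp), hD.eq_zero (c k) (by simp)]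
    simp only [vertexPair, sum_singleton]
    abel
  · have s0 := h.twist_zero hD.twist h0 (by simpa using hp)
    have s1 := h.twist_one hD.twist hk (by grind)
    rw [h.apply_period] at s1
    refine h.prismHamiltonian hD (s0.zero_zero.trans (s1.zero_one.trans (e.one_one.trans
      (t.symm.one_zero)))) ?_
    rw [h.sum_eq_two D h0 hk, hD.eq_zero (c 0) (by simp), hD.eq_zero (c k) (by simp)]
    simp only [vertexPair, sum_singleton]
    abel

/-- A triangle cutting the cycle into pieces of odd, even and even length. -/
lemma prismHamiltonian_of_triangle (h : IsCycleParam G n C c) (hn : Odd n) {j k : ℤ} (h0 : 0 < j)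
    (hjk : j < k) (hkn : k < n) (hj : Odd j) (hk : Odd k) (hab : G.Adj (c 0) (c j))
    (hbc : G.Adj (c j) (c k)) (hca : G.Adj (c k) (c 0))
    (hD : IsDetour G C {c 0, c j, c k} ∅ D) : PrismHamiltonian G := by
  have s0 := h.twist_zero hD.twist h0 (by simpa using hj)
  have s1 := h.twist_one hD.twist hjk (by grind)
  have s2 := h.twist_one hD.twist hkn (by grind)
  rw [h.apply_period] at s2
  have ab := Twist.of_adj hab
  have bc := Twist.of_adj hbc
  have ca := Twist.of_adj hca
  refine h.prismHamiltonian hD (s0.zero_zero.trans (s1.zero_one.trans (bc.symm.one_one.trans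
    (ab.symm.one_one.trans (s2.symm.one_zero.trans (ca.zero_zero)))))) ?_
  rw [h.sum_eq_three D h0 hjk hkn, hD.eq_zero (c 0) (by simp), hD.eq_zero (c j) (by simp),
    hD.eq_zero (c k) (by simp)]
  simp only [vertexPair, sum_empty]
  abel

/-- A triangle cutting the cycle into pieces of odd length, together with a vertex outside the
cycle attached to one corner of the triangle and to a neighbour of another corner. -/
lemma prismHamiltonian_of_triangle_of_detour (h : IsCycleParam G n C c) (hn : Odd n) {i j k : ℤ}
    (h0 : 0 < i) (hij : i < j) (hjn : j < n) (hi : Odd i) (hj : Even j) (hk0 : 0 < k) (hkn : k < n)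
    (hki : k ≠ i) (hkj : k ≠ j) (hab : G.Adj (c j) (c 0)) (hca : G.Adj (c i) (c j))
    (hvc : G.Adj (c k) (c i)) {x : V} (hxb : G.Adj x (c 0)) (hxv : G.Adj x (c k))
    (hD : IsDetour G C {c 0, c i, c j, c k} {x} D) : PrismHamiltonian G := by
  have ab := Twist.of_adj hab
  have ca := Twist.of_adj hca
  have vc := Twist.of_adj hvc
  have t := Twist.through hxb hxv
  rcases lt_or_gt_of_ne hki with h1 | h1
  · rcases Int.even_or_odd k with hp | hp
    · have s0 := h.twist_one hD.twist (by omega : (0 : ℤ) < k) (by grind)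
      have s1 := h.twist_zero hD.twist (by omega : (k : ℤ) < i) (by grind)
      have s2 := h.twist_zero hD.twist (by omega : (i : ℤ) < j) (by grind)
      have s3 := h.twist_zero hD.twist (by omega : (j : ℤ) < n) (by grind)
      rw [h.apply_period] at s3
      refine h.prismHamiltonian hD (s3.zero_zero.trans (s0.zero_one.trans (s1.one_one.trans
        (s2.one_one.trans (
        ab.one_one.trans (t.one_zero.trans (vc.zero_zero.trans (ca.zero_zero)))))))) ?_
      rw [h.sum_eq_four D (by omega : 0 < k) (by omega : k < i) (by omega : i < j)
        (by omega : j < n), hD.eq_zero (c 0) (by simp), hD.eq_zero (c k) (by simp),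
        hD.eq_zero (c i) (by simp), hD.eq_zero (c j) (by simp)]
      simp only [vertexPair, sum_singleton]
      abel
    · have s0 := h.twist_zero hD.twist (by omega : (0 : ℤ) < k) (by grind)
      have s1 := h.twist_one hD.twist (by omega : (k : ℤ) < i) (by grind)
      have s2 := h.twist_zero hD.twist (by omega : (i : ℤ) < j) (by grind)
      have s3 := h.twist_zero hD.twist (by omega : (j : ℤ) < n) (by grind)
      rw [h.apply_period] at s3
      refine h.prismHamiltonian hD (s3.zero_zero.trans (s0.zero_zero.trans (t.symm.zero_one.trans
        (ab.symm.one_one.trans (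
        s2.symm.one_one.trans (vc.symm.one_one.trans (s1.one_zero.trans (ca.zero_zero)))))))) ?_
      rw [h.sum_eq_four D (by omega : 0 < k) (by omega : k < i) (by omega : i < j)
        (by omega : j < n), hD.eq_zero (c 0) (by simp), hD.eq_zero (c k) (by simp),
        hD.eq_zero (c i) (by simp), hD.eq_zero (c j) (by simp)]
      simp only [vertexPair, sum_singleton]
      abel
  rcases lt_or_gt_of_ne hkj with h2 | h2
  · rcases Int.even_or_odd k with hp | hp
    · have s0 := h.twist_zero hD.twist (by omega : (0 : ℤ) < i) (by grind)
      have s1 := h.twist_zero hD.twist (by omega : (i : ℤ) < k) (by grind)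
      have s2 := h.twist_one hD.twist (by omega : (k : ℤ) < j) (by grind)
      have s3 := h.twist_zero hD.twist (by omega : (j : ℤ) < n) (by grind)
      rw [h.apply_period] at s3
      refine h.prismHamiltonian hD (s3.zero_zero.trans (s0.zero_zero.trans (s1.zero_zero.trans
        (t.symm.zero_one.trans (
        ab.symm.one_one.trans (ca.symm.one_one.trans (vc.symm.one_one.trans (s2.one_zero)))))))) ?_
      rw [h.sum_eq_four D (by omega : 0 < i) (by omega : i < k) (by omega : k < j)
        (by omega : j < n), hD.eq_zero (c 0) (by simp), hD.eq_zero (c i) (by simp),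
        hD.eq_zero (c k) (by simp), hD.eq_zero (c j) (by simp)]
      simp only [vertexPair, sum_singleton]
      abel
    · have s0 := h.twist_zero hD.twist (by omega : (0 : ℤ) < i) (by grind)
      have s1 := h.twist_one hD.twist (by omega : (i : ℤ) < k) (by grind)
      have s2 := h.twist_zero hD.twist (by omega : (k : ℤ) < j) (by grind)
      have s3 := h.twist_zero hD.twist (by omega : (j : ℤ) < n) (by grind)
      rw [h.apply_period] at s3
      refine h.prismHamiltonian hD (s3.zero_zero.trans (s0.zero_zero.trans (s1.zero_one.trans
        (vc.one_one.trans (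
        ca.one_one.trans (ab.one_one.trans (t.one_zero.trans (s2.zero_zero)))))))) ?_
      rw [h.sum_eq_four D (by omega : 0 < i) (by omega : i < k) (by omega : k < j)
        (by omega : j < n), hD.eq_zero (c 0) (by simp), hD.eq_zero (c i) (by simp),
        hD.eq_zero (c k) (by simp), hD.eq_zero (c j) (by simp)]
      simp only [vertexPair, sum_singleton]
      abel
  · rcases Int.even_or_odd k with hp | hp
    · have s0 := h.twist_zero hD.twist (by omega : (0 : ℤ) < i) (by grind)
      have s1 := h.twist_zero hD.twist (by omega : (i : ℤ) < j) (by grind)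
      have s2 := h.twist_one hD.twist (by omega : (j : ℤ) < k) (by grind)
      have s3 := h.twist_zero hD.twist (by omega : (k : ℤ) < n) (by grind)
      rw [h.apply_period] at s3
      refine h.prismHamiltonian hD (s2.zero_one.trans (vc.one_one.trans (s1.one_one.trans
        (ab.one_one.trans (
        t.one_zero.trans (s3.zero_zero.trans (s0.zero_zero.trans (ca.zero_zero)))))))) ?_
      rw [h.sum_eq_four D (by omega : 0 < i) (by omega : i < j) (by omega : j < k)
        (by omega : k < n), hD.eq_zero (c 0) (by simp), hD.eq_zero (c i) (by simp),
        hD.eq_zero (c j) (by simp), hD.eq_zero (c k) (by simp)]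
      simp only [vertexPair, sum_singleton]
      abel
    · have s0 := h.twist_zero hD.twist (by omega : (0 : ℤ) < i) (by grind)
      have s1 := h.twist_zero hD.twist (by omega : (i : ℤ) < j) (by grind)
      have s2 := h.twist_zero hD.twist (by omega : (j : ℤ) < k) (by grind)
      have s3 := h.twist_one hD.twist (by omega : (k : ℤ) < n) (by grind)
      rw [h.apply_period] at s3
      refine h.prismHamiltonian hD (s2.zero_zero.trans (s3.zero_one.trans (ab.symm.one_one.trans
        (s1.symm.one_one.trans (
        vc.symm.one_one.trans (t.symm.one_zero.trans (s0.zero_zero.trans (ca.zero_zero)))))))) ?_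
      rw [h.sum_eq_four D (by omega : 0 < i) (by omega : i < j) (by omega : j < k)
        (by omega : k < n), hD.eq_zero (c 0) (by simp), hD.eq_zero (c i) (by simp),
        hD.eq_zero (c j) (by simp), hD.eq_zero (c k) (by simp)]
      simp only [vertexPair, sum_singleton]
      abel

/-- A triangle cutting the cycle into pieces of odd length, together with a path of length three
joining two of its corners. -/
lemma prismHamiltonian_of_triangle_of_path (h : IsCycleParam G n C c) (hn : Odd n) {q l t m : ℤ}
    (h0 : 0 < q) (hql : q < l) (hlt : l < t) (htn : t < n) (hlm : l < m) (hmn : m < n)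
    (hmt : m ≠ t) (hq : Even q) (hl : Odd l) (ht : Even t) (hab : G.Adj (c t) (c 0))
    (hca : G.Adj (c l) (c t)) (hbr : G.Adj (c 0) (c m)) (hpr : G.Adj (c q) (c m))
    (hpc : G.Adj (c q) (c l))
    (hD : IsDetour G C {c 0, c q, c l, c t, c m} ∅ D) : PrismHamiltonian G := by
  have ab := Twist.of_adj hab
  have ca := Twist.of_adj hca
  have br := Twist.of_adj hbr
  have pr := Twist.of_adj hpr
  have pc := Twist.of_adj hpc
  rcases lt_or_gt_of_ne hmt with h1 | h1
  · rcases Int.even_or_odd m with hp | hp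
    · have s0 := h.twist_one hD.twist (by omega : (0 : ℤ) < q) (by grind)
      have s1 := h.twist_zero hD.twist (by omega : (q : ℤ) < l) (by grind)
      have s2 := h.twist_zero hD.twist (by omega : (l : ℤ) < m) (by grind)
      have s3 := h.twist_one hD.twist (by omega : (m : ℤ) < t) (by grind)
      have s4 := h.twist_zero hD.twist (by omega : (t : ℤ) < n) (by grind)
      rw [h.apply_period] at s4
      refine h.prismHamiltonian hD (s0.zero_one.trans (s1.one_one.trans (s2.one_one.trans
        (br.symm.one_one.trans (s4.symm.one_one.trans (
        s3.symm.one_zero.trans (pr.symm.zero_zero.trans (pc.zero_zero.trans (ca.zero_zero.trans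
        (ab.zero_zero)))))))))) ?_
      rw [h.sum_eq_five D (by omega : 0 < q) (by omega : q < l) (by omega : l < m) (by omega :
        m < t)
        (by omega : t < n), hD.eq_zero (c 0) (by simp), hD.eq_zero (c q) (by simp),
        hD.eq_zero (c l) (by simp), hD.eq_zero (c m) (by simp), hD.eq_zero (c t) (by simp)]
      simp only [vertexPair, sum_empty]
      abel
    · have s0 := h.twist_one hD.twist (by omega : (0 : ℤ) < q) (by grind)
      have s1 := h.twist_zero hD.twist (by omega : (q : ℤ) < l) (by grind)
      have s2 := h.twist_one hD.twist (by omega : (l : ℤ) < m) (by grind)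
      have s3 := h.twist_zero hD.twist (by omega : (m : ℤ) < t) (by grind)
      have s4 := h.twist_zero hD.twist (by omega : (t : ℤ) < n) (by grind)
      rw [h.apply_period] at s4
      refine h.prismHamiltonian hD (s0.zero_one.trans (s1.one_one.trans (ca.one_one.trans
        (s4.one_one.trans (br.one_one.trans (
        s2.symm.one_zero.trans (pc.symm.zero_zero.trans (pr.zero_zero.trans (s3.zero_zero.trans
        (ab.zero_zero)))))))))) ?_
      rw [h.sum_eq_five D (by omega : 0 < q) (by omega : q < l) (by omega : l < m) (by omega :
        m < t)
        (by omega : t < n), hD.eq_zero (c 0) (by simp), hD.eq_zero (c q) (by simp),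
        hD.eq_zero (c l) (by simp), hD.eq_zero (c m) (by simp), hD.eq_zero (c t) (by simp)]
      simp only [vertexPair, sum_empty]
      abel
  · rcases Int.even_or_odd m with hp | hp
    · have s0 := h.twist_one hD.twist (by omega : (0 : ℤ) < q) (by grind)
      have s1 := h.twist_zero hD.twist (by omega : (q : ℤ) < l) (by grind)
      have s2 := h.twist_zero hD.twist (by omega : (l : ℤ) < t) (by grind)
      have s3 := h.twist_one hD.twist (by omega : (t : ℤ) < m) (by grind)
      have s4 := h.twist_zero hD.twist (by omega : (m : ℤ) < n) (by grind)
      rw [h.apply_period] at s4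
      refine h.prismHamiltonian hD (s0.zero_one.trans (s1.one_one.trans (s2.one_one.trans
        (ab.one_one.trans (s4.symm.one_one.trans (
        s3.symm.one_zero.trans (ca.symm.zero_zero.trans (pc.symm.zero_zero.trans
        (pr.zero_zero.trans (br.symm.zero_zero)))))))))) ?_
      rw [h.sum_eq_five D (by omega : 0 < q) (by omega : q < l) (by omega : l < t) (by omega :
        t < m)
        (by omega : m < n), hD.eq_zero (c 0) (by simp), hD.eq_zero (c q) (by simp),
        hD.eq_zero (c l) (by simp), hD.eq_zero (c t) (by simp), hD.eq_zero (c m) (by simp)]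
      simp only [vertexPair, sum_empty]
      abel
    · have s0 := h.twist_one hD.twist (by omega : (0 : ℤ) < q) (by grind)
      have s1 := h.twist_zero hD.twist (by omega : (q : ℤ) < l) (by grind)
      have s2 := h.twist_zero hD.twist (by omega : (l : ℤ) < t) (by grind)
      have s3 := h.twist_zero hD.twist (by omega : (t : ℤ) < m) (by grind)
      have s4 := h.twist_one hD.twist (by omega : (m : ℤ) < n) (by grind)
      rw [h.apply_period] at s4
      refine h.prismHamiltonian hD (s0.zero_one.trans (s1.one_one.trans (s2.one_one.trans
        (s3.one_one.trans (br.symm.one_one.trans (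
        s4.symm.one_zero.trans (pr.symm.zero_zero.trans (pc.zero_zero.trans (ca.zero_zero.trans
        (ab.zero_zero)))))))))) ?_
      rw [h.sum_eq_five D (by omega : 0 < q) (by omega : q < l) (by omega : l < t) (by omega :
        t < m)
        (by omega : m < n), hD.eq_zero (c 0) (by simp), hD.eq_zero (c q) (by simp),
        hD.eq_zero (c l) (by simp), hD.eq_zero (c t) (by simp), hD.eq_zero (c m) (by simp)]
      simp only [vertexPair, sum_empty]
      abel

end IsCycleParam

/-- The graph whose edges are the pairs `f x` with `x ∈ Y`. -/
def pairGraph (f : V → Sym2 V) (Y : Set V) : SimpleGraph V := fromEdgeSet (f '' Y)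

/-- `f` assigns to every `x ∈ I` a pair of neighbours, and these pairs form a forest. -/
def IsPairForest (G : SimpleGraph V) (I : Set V) (f : V → Sym2 V) : Prop :=
  ∀ x ∈ I, ∃ p q, f x = s(p, q) ∧ G.Adj x p ∧ G.Adj x q ∧
    ¬ (pairGraph f (I \ {x})).Reachable p q

lemma pairGraph_adj {f : V → Sym2 V} {Y : Set V} {p q : V} :
    (pairGraph f Y).Adj p q ↔ (∃ x ∈ Y, f x = s(p, q)) ∧ p ≠ q := by
  simp [pairGraph]

lemma pairGraph_mono {f : V → Sym2 V} {Y Z : Set V} (h : Y ⊆ Z) :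
    pairGraph f Y ≤ pairGraph f Z := fun p q => by
  rw [pairGraph_adj, pairGraph_adj]
  rintro ⟨⟨x, hx, h1⟩, h2⟩
  exact ⟨⟨x, h hx, h1⟩, h2⟩

lemma pairGraph_reachable {f : V → Sym2 V} {Y : Set V} {x p q : V} (hx : x ∈ Y)
    (h : f x = s(p, q)) : (pairGraph f Y).Reachable p q := by
  by_cases hpq : p = q
  · rw [hpq]
  · exact (pairGraph_adj.2 ⟨⟨x, hx, h⟩, hpq⟩).reachable

lemma pairGraph_congr {f g : V → Sym2 V} {Y : Set V} (h : ∀ x ∈ Y, f x = g x) :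
    pairGraph f Y = pairGraph g Y := by
  rw [pairGraph, pairGraph, Set.image_congr h]

/-- Reachability after adding one edge. -/
lemma reachable_of_adj_or {H K : SimpleGraph V} {z w : V}
    (h : ∀ u v, K.Adj u v → H.Reachable u v ∨ s(u, v) = s(z, w)) {a b : V}
    (hab : K.Reachable a b) : H.Reachable a b ∨ (H.Reachable a z ∧ H.Reachable w b) ∨
      (H.Reachable a w ∧ H.Reachable z b) := by
  obtain ⟨p⟩ := hab
  induction p with
  | nil => exact Or.inl (Reachable.refl _)
  | cons huv p ih =>
    rcases h _ _ huv with h1 | h1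
    · rcases ih with h2 | ⟨h2, h3⟩ | ⟨h2, h3⟩
      · exact Or.inl (h1.trans h2)
      · exact Or.inr (Or.inl ⟨h1.trans h2, h3⟩)
      · exact Or.inr (Or.inr ⟨h1.trans h2, h3⟩)
    · rcases Sym2.eq_iff.1 h1 with ⟨rfl, rfl⟩ | ⟨rfl, rfl⟩
      · rcases ih with h2 | ⟨-, h3⟩ | ⟨-, h3⟩
        · exact Or.inr (Or.inl ⟨.refl _, h2⟩)
        · exact Or.inr (Or.inl ⟨.refl _, h3⟩)
        · exact Or.inl h3
      · rcases ih with h2 | ⟨-, h3⟩ | ⟨-, h3⟩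
        · exact Or.inr (Or.inr ⟨.refl _, h2⟩)
        · exact Or.inl h3
        · exact Or.inr (Or.inr ⟨.refl _, h3⟩)

section Existence

variable [DecidableEq V]

lemma exists_subset_of_reachable {N : V → Finset V} {f : V → Sym2 V} {Y : Finset V}
    (hf : ∀ y ∈ Y, ∀ p q, f y = s(p, q) → N y = {p, q}) {p q : V}
    (h : (pairGraph f Y).Reachable p q) :
    ∃ S ⊆ Y, q ∈ insert p (S.biUnion N) ∧ #(insert p (S.biUnion N)) ≤ #S + 1 := by
  rw [reachable_iff_reflTransGen] at h
  induction h with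
  | refl => exact ⟨∅, by simp, by simp, by simp⟩
  | @tail q q' _ hqq ih =>
    obtain ⟨S, hS, hq, hc⟩ := ih
    obtain ⟨⟨y, hy, hfy⟩, -⟩ := pairGraph_adj.1 hqq
    by_cases hq' : q' ∈ insert p (S.biUnion N)
    · exact ⟨S, hS, hq', hc⟩
    have hN := hf y hy _ _ hfy
    have hyS : y ∉ S := fun h => hq' (mem_insert_of_mem (mem_biUnion.2 ⟨y, h, by simp [hN]⟩))
    have h1 : insert p ((insert y S).biUnion N) = insert q' (insert p (S.biUnion N)) := by
      rw [biUnion_insert, hN]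
      ext a
      simp only [mem_insert, mem_union, mem_singleton] at hq ⊢
      constructor
      · rintro (h | (h | h) | h)
        · simp [h]
        · subst h; exact Or.inr hq
        · simp [h]
        · simp [h]
      · tauto
    refine ⟨insert y S, insert_subset hy hS, ?_, ?_⟩
    · rw [h1]; simp
    · rw [h1, card_insert_of_notMem hq', card_insert_of_notMem hyS]; omega

/-- A family of sets satisfying Hall's condition with surplus one contains a forest of pairs. -/
lemma exists_isPairForest_of_hall (G : SimpleGraph V) (I : Finset V) (N : V → Finset V)
    (hG : ∀ x ∈ I, ∀ y ∈ N x, G.Adj x y)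
    (hN : ∀ T ⊆ I, T.Nonempty → #T + 1 ≤ #(T.biUnion N)) :
    ∃ f : V → Sym2 V, IsPairForest G I f := by
  induction hs : ∑ x ∈ I, #(N x) using Nat.strong_induction_on generalizing N with
  | _ s ih =>
    have h2 : ∀ x ∈ I, 2 ≤ #(N x) := fun x hx => by
      simpa using hN {x} (by simpa using hx) (by simp)
    by_cases h3 : ∃ x ∈ I, 3 ≤ #(N x)
    · obtain ⟨x, hx, hx3⟩ := h3
      have key : ∀ z ∈ N x, (∃ f : V → Sym2 V, IsPairForest G I f) ∨
          ∃ T ⊆ I, x ∉ T ∧ #(T.biUnion N ∪ (N x).erase z) ≤ #T + 1 := by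
        intro z hz
        by_cases hT : ∀ T ⊆ I, T.Nonempty →
            #T + 1 ≤ #(T.biUnion (Function.update N x ((N x).erase z)))
        · refine Or.inl (ih _ ?_ _ ?_ hT rfl)
          · rw [← hs]
            refine sum_lt_sum (fun y _ => ?_) ⟨x, hx, ?_⟩
            · by_cases hy : y = x
              · subst hy; simpa using card_le_card (erase_subset z (N y))
              · simp [hy]
            · simpa using card_erase_lt_of_mem hz
          · intro y hy w hw
            by_cases hyx : y = x
            · subst hyx
              exact hG y hy w (mem_of_mem_erase (by simpa using hw))
            · exact hG y hy w (by simpa [hyx] using hw)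
        · push Not at hT
          obtain ⟨T, hT, hne, hlt⟩ := hT
          have hx' : x ∈ T := by
            by_contra hxT
            have : T.biUnion (Function.update N x ((N x).erase z)) = T.biUnion N :=
              biUnion_congr rfl fun y hy => by
                rw [Function.update_of_ne (ne_of_mem_of_not_mem hy hxT)]
            rw [this] at hlt
            exact absurd (hN T hT hne) (by omega)
          refine Or.inr ⟨T.erase x, (erase_subset _ _).trans hT, by simp, ?_⟩
          have : T.biUnion (Function.update N x ((N x).erase z)) =
              (T.erase x).biUnion N ∪ (N x).erase z := by
            conv_lhs => rw [← insert_erase hx', biUnion_insert, Function.update_self]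
            rw [union_comm]
            congr 1
            exact biUnion_congr rfl fun y hy => by rw [Function.update_of_ne (ne_of_mem_erase hy)]
          rw [← this, card_erase_of_mem hx']
          omega
      obtain ⟨z₁, hz₁, z₂, hz₂, hz⟩ := one_lt_card.1 (by omega : 1 < #(N x))
      rcases key z₁ hz₁ with h | ⟨T₁, hT₁, hxT₁, hc₁⟩
      · exact h
      rcases key z₂ hz₂ with h | ⟨T₂, hT₂, hxT₂, hc₂⟩
      · exact h
      exfalso
      set M₁ := T₁.biUnion N ∪ (N x).erase z₁
      set M₂ := T₂.biUnion N ∪ (N x).erase z₂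
      have hu : #(T₁ ∪ T₂) + 2 ≤ #(M₁ ∪ M₂) := by
        have h1 := hN (insert x (T₁ ∪ T₂)) (insert_subset hx (union_subset hT₁ hT₂)) (by simp)
        rw [card_insert_of_notMem (by simp [hxT₁, hxT₂])] at h1
        refine h1.trans (card_le_card ?_)
        rw [biUnion_insert, union_biUnion]
        intro a ha
        simp only [mem_union, M₁, M₂, mem_erase] at ha ⊢
        have : a ≠ z₁ ∨ a ≠ z₂ := by
          by_contra! h; exact hz (h.1.symm.trans h.2)
        tauto
      have hi : #(T₁ ∩ T₂) + 1 ≤ #(M₁ ∩ M₂) := by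
        rcases (T₁ ∩ T₂).eq_empty_or_nonempty with h0 | h0
        · rw [h0, card_empty]
          have h1 : ((N x).erase z₁).erase z₂ ⊆ M₁ ∩ M₂ := by
            intro a ha
            simp only [mem_inter, mem_union, M₁, M₂, mem_erase] at ha ⊢
            tauto
          have h4 := card_le_card h1
          rw [card_erase_of_mem (by simp [hz.symm, hz₂]), card_erase_of_mem hz₁] at h4
          omega
        · refine (hN _ (inter_subset_left.trans hT₁) h0).trans (card_le_card ?_)
          intro a ha
          obtain ⟨y, hy, hay⟩ := mem_biUnion.1 ha
          rw [mem_inter] at hy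
          simp only [mem_inter, mem_union, M₁, M₂, mem_biUnion]
          exact ⟨Or.inl ⟨y, hy.1, hay⟩, Or.inl ⟨y, hy.2, hay⟩⟩
      have e1 := card_union_add_card_inter M₁ M₂
      have e2 := card_union_add_card_inter T₁ T₂
      omega
    · push Not at h3
      have : ∀ x, ∃ e : Sym2 V, x ∈ I → ∀ p q, e = s(p, q) → N x = {p, q} := by
        intro x
        by_cases hx : x ∈ I
        · obtain ⟨p, q, -, hpq⟩ := card_eq_two.1 (by have := h2 x hx; have := h3 x hx; omega :
            #(N x) = 2)
          refine ⟨s(p, q), fun _ p' q' h => ?_⟩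
          rcases Sym2.eq_iff.1 h with ⟨rfl, rfl⟩ | ⟨rfl, rfl⟩
          · exact hpq
          · rw [hpq, pair_comm]
        · exact ⟨s(x, x), fun h => absurd h hx⟩
      choose f hf using this
      refine ⟨f, fun x hx => ?_⟩
      obtain ⟨p, q, hpq⟩ : ∃ p q, f x = s(p, q) := by
        induction f x with | _ p q => exact ⟨p, q, rfl⟩
      have hNx := hf x hx p q hpq
      refine ⟨p, q, hpq, hG x hx p (by simp [hNx]), hG x hx q (by simp [hNx]), fun hr => ?_⟩
      have hr' : (pairGraph f (I.erase x : Finset V)).Reachable p q := by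
        rwa [coe_erase]
      obtain ⟨S, hS, hq, hc⟩ := exists_subset_of_reachable (N := N)
        (fun y hy => hf y (mem_of_mem_erase hy)) hr'
      have hxS : x ∉ S := fun h => by simpa using hS h
      have := hN (insert x S) (insert_subset hx (hS.trans (erase_subset _ _))) (by simp)
      rw [card_insert_of_notMem hxS, biUnion_insert, hNx] at this
      have h4 : {p, q} ∪ S.biUnion N ⊆ insert p (S.biUnion N) := by
        intro a ha
        simp only [mem_union, mem_insert, mem_singleton] at ha hq ⊢
        rcases ha with (h | h) | h
        · simp [h]
        · subst h; exact hq
        · simp [h]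
      have := card_le_card h4
      omega

end Existence

namespace IsPairForest

variable {G : SimpleGraph V} {I : Set V} {f : V → Sym2 V}

lemma not_reachable (hf : IsPairForest G I f) {x p q : V} (hx : x ∈ I) (h : f x = s(p, q)) :
    ¬ (pairGraph f (I \ {x})).Reachable p q := by
  obtain ⟨p', q', h1, -, -, h2⟩ := hf x hx
  rcases Sym2.eq_iff.1 (h.symm.trans h1) with ⟨rfl, rfl⟩ | ⟨rfl, rfl⟩
  · exact h2
  · exact fun h3 => h2 h3.symm

lemma adj (hf : IsPairForest G I f) {x p : V} (hx : x ∈ I) (h : p ∈ f x) : G.Adj x p := by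
  obtain ⟨p', q', h1, h2, h3, -⟩ := hf x hx
  rw [h1, Sym2.mem_iff] at h
  rcases h with rfl | rfl <;> assumption

lemma ne (hf : IsPairForest G I f) {x p q : V} (hx : x ∈ I) (h : f x = s(p, q)) : p ≠ q := by
  rintro rfl
  exact hf.not_reachable hx h (.refl _)

/-- Exchanging the pair of `x`. -/
lemma update [DecidableEq V] (hf : IsPairForest G I f) {x z w : V} (hx : x ∈ I)
    (hz : G.Adj x z) (hw : G.Adj x w) (hzw : ¬ (pairGraph f (I \ {x})).Reachable z w) :
    IsPairForest G I (Function.update f x s(z, w)) := by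
  intro y hy
  by_cases hyx : y = x
  · subst hyx
    refine ⟨z, w, by simp, hz, hw, ?_⟩
    rwa [pairGraph_congr (g := f) fun v hv => by
      rw [Function.update_of_ne (by simpa using hv.2)]]
  · obtain ⟨p, q, h1, h2, h3, h4⟩ := hf y hy
    refine ⟨p, q, by rw [Function.update_of_ne hyx, h1], h2, h3, fun hr => ?_⟩
    have hle : ∀ {a b}, (pairGraph f (I \ {x, y})).Reachable a b →
        (pairGraph f (I \ {x})).Reachable a b := fun h =>
      h.mono (pairGraph_mono (Set.sdiff_subset_sdiff_right (by simp)))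
    have hpq : (pairGraph f (I \ {x})).Reachable p q := pairGraph_reachable ⟨hy, by simpa⟩ h1
    rcases reachable_of_adj_or (H := pairGraph f (I \ {x, y})) (z := z) (w := w) (fun a b hab => by
      obtain ⟨⟨v, hv, hfv⟩, hne⟩ := pairGraph_adj.1 hab
      by_cases hvx : v = x
      · subst hvx; right; simpa using hfv.symm
      · left
        rw [Function.update_of_ne hvx] at hfv
        exact pairGraph_reachable ⟨hv.1, by simpa [hvx] using hv.2⟩ hfv) hr with h | h | h
    · exact h4 (h.mono (pairGraph_mono (Set.sdiff_subset_sdiff_right (by simp))))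
    · exact hzw ((hle h.1).symm.trans (hpq.trans (hle h.2).symm))
    · exact hzw ((hle h.2).trans (hpq.symm.trans (hle h.1)))

/-- A forest has a system of distinct representatives avoiding any set that meets each of its
components at most once. -/
lemma exists_injOn [DecidableEq V] (hf : IsPairForest G I f) (J : Finset V) (hJ : (J : Set V) ⊆ I)
    (W : Finset V)
    (hW : ∀ a ∈ W, ∀ b ∈ W, a ≠ b → ¬ (pairGraph f J).Reachable a b) :
    ∃ m : V → V, Set.InjOn m J ∧ (∀ x ∈ J, m x ∈ f x) ∧ ∀ x ∈ J, m x ∉ W := by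
  induction J using Finset.induction_on generalizing W with
  | empty => exact ⟨id, by simp, by simp, by simp⟩
  | insert x J hxJ ih =>
    have hx : x ∈ I := hJ (by simp)
    have hJI : (J : Set V) ⊆ I := fun y hy => hJ (by simp [mem_coe.1 hy])
    have hle : pairGraph f J ≤ pairGraph f (insert x J : Finset V) :=
      pairGraph_mono (by simp)
    have key : ∀ p q, f x = s(p, q) → (∀ a ∈ W, ¬ (pairGraph f J).Reachable p a) →
        ∃ m : V → V, Set.InjOn m (insert x J : Finset V) ∧ (∀ y ∈ insert x J, m y ∈ f y) ∧
          ∀ y ∈ insert x J, m y ∉ W := by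
      intro p q hpq hp
      obtain ⟨m, hm1, hm2, hm3⟩ := ih hJI (insert p W) (by
        intro a ha b hb hab hr
        rcases mem_insert.1 ha with rfl | ha' <;> rcases mem_insert.1 hb with rfl | hb'
        · exact hab rfl
        · exact hp b hb' hr
        · exact hp a ha' hr.symm
        · exact hW a ha' b hb' hab (hr.mono hle))
      have hne : ∀ y ∈ J, y ≠ x := fun y hy h => hxJ (h ▸ hy)
      refine ⟨Function.update m x p, ?_, ?_, ?_⟩
      · intro a ha b hb hab
        rcases mem_insert.1 (mem_coe.1 ha) with rfl | ha' <;>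
          rcases mem_insert.1 (mem_coe.1 hb) with rfl | hb'
        · rfl
        · rw [Function.update_self, Function.update_of_ne (hne b hb')] at hab
          exact absurd (hab ▸ mem_insert_self _ _) (hm3 b hb')
        · rw [Function.update_self, Function.update_of_ne (hne a ha')] at hab
          exact absurd (hab ▸ mem_insert_self _ _) (hm3 a ha')
        · rw [Function.update_of_ne (hne a ha'), Function.update_of_ne (hne b hb')] at hab
          exact hm1 ha' hb' hab
      · intro y hy
        rcases mem_insert.1 hy with rfl | hy
        · simp [hpq]
        · rw [Function.update_of_ne (hne y hy)]; exact hm2 y hy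
      · intro y hy
        rcases mem_insert.1 hy with rfl | hy
        · rw [Function.update_self]; exact fun h => hp p h (.refl _)
        · rw [Function.update_of_ne (hne y hy)]
          exact fun h => hm3 y hy (mem_insert_of_mem h)
    obtain ⟨p, q, hpq, -, -, hnr⟩ := hf x hx
    by_cases hp : ∀ a ∈ W, ¬ (pairGraph f J).Reachable p a
    · exact key p q hpq hp
    by_cases hq : ∀ a ∈ W, ¬ (pairGraph f J).Reachable q a
    · exact key q p (hpq.trans Sym2.eq_swap) hq
    exfalso
    push Not at hp hq
    obtain ⟨a, ha, hpa⟩ := hp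
    obtain ⟨b, hb, hqb⟩ := hq
    by_cases hab : a = b
    · subst hab
      refine hnr ((hpa.trans hqb.symm).mono (pairGraph_mono fun y hy => ⟨hJI hy, ?_⟩))
      rintro rfl
      exact hxJ hy
    · exact hW a ha b hb hab ((hpa.mono hle).symm.trans
        ((pairGraph_reachable (by simp) hpq).trans (hqb.mono hle)))

end IsPairForest

/-- A walk can be replaced by an induced path inside its support. -/
lemma exists_isPath_chordless {G : SimpleGraph V} {u v : V} (p : G.Walk u v) :
    ∃ q : G.Walk u v, q.IsPath ∧ (∀ x ∈ q.support, x ∈ p.support) ∧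
      ∀ x ∈ q.support, ∀ y ∈ q.support, G.Adj x y → s(x, y) ∈ q.edges := by
  classical
  induction hn : p.length using Nat.strong_induction_on generalizing p with
  | _ n ih =>
    have shorten : ∀ q : G.Walk u v, q.length < n → (∀ x ∈ q.support, x ∈ p.support) →
        ∃ q : G.Walk u v, q.IsPath ∧ (∀ x ∈ q.support, x ∈ p.support) ∧
          ∀ x ∈ q.support, ∀ y ∈ q.support, G.Adj x y → s(x, y) ∈ q.edges := by
      intro q hq hs
      obtain ⟨q', h1, h2, h3⟩ := ih _ hq q rfl
      exact ⟨q', h1, fun x hx => hs x (h2 x hx), h3⟩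
    by_cases hp : p.IsPath
    · by_cases hc : ∀ x ∈ p.support, ∀ y ∈ p.support, G.Adj x y → s(x, y) ∈ p.edges
      · exact ⟨p, hp, fun _ h => h, hc⟩
      push Not at hc
      obtain ⟨x, hx, y, hy, hxy, hne⟩ := hc
      have key : ∀ x y, G.Adj x y → s(x, y) ∉ p.edges → ∀ (q₁ : G.Walk u x) (q₂ : G.Walk x y)
          (q₃ : G.Walk y v), p = q₁.append (q₂.append q₃) →
          ∃ q : G.Walk u v, q.IsPath ∧ (∀ x ∈ q.support, x ∈ p.support) ∧
            ∀ x ∈ q.support, ∀ y ∈ q.support, G.Adj x y → s(x, y) ∈ q.edges := by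
        intro x y hxy hne q₁ q₂ q₃ hq
        have h2 : 2 ≤ q₂.length := by
          rcases q₂ with _ | ⟨h, _ | ⟨h', q⟩⟩
          · exact absurd hxy (G.irrefl)
          · simp [hq] at hne
          · simp
        refine shorten (q₁.append (Walk.cons hxy q₃)) ?_ ?_
        · rw [hq] at hn
          simp only [Walk.length_append, Walk.length_cons] at hn ⊢
          omega
        · intro z hz
          rw [hq]
          simp only [Walk.mem_support_append_iff, Walk.support_cons, List.mem_cons] at hz ⊢
          rcases hz with hz | rfl | hz
          · exact Or.inl hz
          · exact Or.inl (Walk.end_mem_support _)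
          · exact Or.inr (Or.inr hz)
      have hspec := p.take_spec hx
      by_cases hy' : y ∈ (p.dropUntil x hx).support
      · refine key x y hxy hne (p.takeUntil x hx) ((p.dropUntil x hx).takeUntil y hy')
          ((p.dropUntil x hx).dropUntil y hy') ?_
        rw [Walk.take_spec, Walk.take_spec]
      · have hy2 : y ∈ (p.takeUntil x hx).support := by
          rw [← hspec, Walk.mem_support_append_iff] at hy
          tauto
        refine key y x hxy.symm (by rwa [Sym2.eq_swap]) ((p.takeUntil x hx).takeUntil y hy2)
          ((p.takeUntil x hx).dropUntil y hy2) (p.dropUntil x hx) ?_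
        rw [Walk.append_assoc, Walk.take_spec, Walk.take_spec]
    · refine shorten p.bypass ?_ (fun x hx => p.support_bypass_subset_support hx)
      have h1 := p.length_bypass_le_length
      rcases h1.lt_or_eq with h | h
      · omega
      · exact absurd (p.bypass_eq_self_of_length_le_length_bypass h.ge ▸ p.bypass_isPath) hp

/-- In a 5-chordal graph, two nonadjacent vertices joined through two separated sets have a common
neighbour in each of them. -/
lemma FiveChordal.exists_adj {G : SimpleGraph V} (h : FiveChordal G) {u v : V} (huv : u ≠ v)
    (hna : ¬ G.Adj u v) {D₁ D₂ : Set V} (hu₁ : u ∉ D₁) (hv₁ : v ∉ D₁) (hu₂ : u ∉ D₂) (hv₂ : v ∉ D₂)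
    (hD : ∀ x ∈ D₁, ∀ y ∈ D₂, x ≠ y ∧ ¬ G.Adj x y)
    (p₁ : G.Walk u v) (hp₁ : ∀ x ∈ p₁.support, x ∈ D₁ ∨ x = u ∨ x = v)
    (p₂ : G.Walk u v) (hp₂ : ∀ x ∈ p₂.support, x ∈ D₂ ∨ x = u ∨ x = v) :
    (∃ w ∈ D₁, G.Adj w u ∧ G.Adj w v) ∧ ∃ w ∈ D₂, G.Adj w u ∧ G.Adj w v := by
  obtain ⟨q₁, hq₁, hs₁, hc₁⟩ := exists_isPath_chordless p₁
  obtain ⟨q₂, hq₂, hs₂, hc₂⟩ := exists_isPath_chordless p₂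
  replace hs₁ := fun x hx => hp₁ x (hs₁ x hx)
  replace hs₂ := fun x hx => hp₂ x (hs₂ x hx)
  have two : ∀ q : G.Walk u v, 2 ≤ q.length := by
    intro q
    rcases q with _ | ⟨h, _ | ⟨h', q⟩⟩
    · exact absurd rfl huv
    · exact absurd h hna
    · simp
  have mid : ∀ q : G.Walk u v, q.length = 2 → ∀ D : Set V,
      (∀ x ∈ q.support, x ∈ D ∨ x = u ∨ x = v) → ∃ w ∈ D, G.Adj w u ∧ G.Adj w v := by
    intro q hq D hD
    rcases q with _ | ⟨h, _ | ⟨h', _ | ⟨h'', q⟩⟩⟩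
    · simp at hq
    · simp at hq
    · rename_i w
      refine ⟨w, ?_, h.symm, h'⟩
      rcases hD w (by simp) with h1 | rfl | rfl
      · exact h1
      · exact absurd h (G.irrefl)
      · exact absurd h' (G.irrefl)
    · simp at hq
  have l₁ := two q₁
  have l₂ := two q₂
  by_cases hl : q₁.length + q₂.length ≤ 4
  · exact ⟨mid q₁ (by omega) _ hs₁, mid q₂ (by omega) _ hs₂⟩
  exfalso
  have hcyc : (q₁.append q₂.reverse).IsCycle := by
    refine hq₁.isCycle_append hq₂.reverse ?_ (Or.inl l₁)
    intro z hz hz'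
    have e1 := hq₁.support_nodup
    have e2 := hq₂.reverse.support_nodup
    rw [← Walk.cons_tail_support, List.nodup_cons] at e1 e2
    have hu : z ≠ u := fun h => e1.1 (h ▸ hz)
    have hv : z ≠ v := fun h => e2.1 (h ▸ hz')
    have m1 := hs₁ z (List.mem_of_mem_tail hz)
    have m2 := hs₂ z (by simpa using List.mem_of_mem_tail hz')
    simp only [hu, hv, or_false] at m1 m2
    exact (hD z m1 z m2).1 rfl
  obtain ⟨x, y, hx, hy, hxy, hne⟩ := h u _ hcyc (by
    rw [Walk.length_append, Walk.length_reverse]; omega)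
  rw [Walk.mem_support_append_iff, Walk.support_reverse, List.mem_reverse] at hx hy
  rw [Walk.edges_append, List.mem_append, Walk.edges_reverse, List.mem_reverse, not_or] at hne
  have ends : ∀ z, z ∈ q₁.support → z ∈ D₁ ∨ z ∈ q₂.support := fun z hz => by
    rcases hs₁ z hz with h | rfl | rfl
    · exact Or.inl h
    · exact Or.inr (Walk.start_mem_support _)
    · exact Or.inr (Walk.end_mem_support _)
  have ends' : ∀ z, z ∈ q₂.support → z ∈ D₂ ∨ z ∈ q₁.support := fun z hz => by
    rcases hs₂ z hz with h | rfl | rfl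
    · exact Or.inl h
    · exact Or.inr (Walk.start_mem_support _)
    · exact Or.inr (Walk.end_mem_support _)
  have c₁ : ¬ (x ∈ q₁.support ∧ y ∈ q₁.support) := fun h => hne.1 (hc₁ x h.1 y h.2 hxy)
  have c₂ : ¬ (x ∈ q₂.support ∧ y ∈ q₂.support) := fun h => hne.2 (hc₂ x h.1 y h.2 hxy)
  have d₁ : ¬ (x ∈ D₁ ∧ y ∈ D₂) := fun h => (hD x h.1 y h.2).2 hxy
  have d₂ : ¬ (y ∈ D₁ ∧ x ∈ D₂) := fun h => (hD y h.1 x h.2).2 hxy.symm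
  rcases hx with hx | hx <;> rcases hy with hy | hy
  · exact c₁ ⟨hx, hy⟩
  · rcases ends x hx with h1 | h1
    · rcases ends' y hy with h2 | h2
      · exact d₁ ⟨h1, h2⟩
      · exact c₁ ⟨hx, h2⟩
    · exact c₂ ⟨h1, hy⟩
  · rcases ends y hy with h1 | h1
    · rcases ends' x hx with h2 | h2
      · exact d₂ ⟨h1, h2⟩
      · exact c₁ ⟨h2, hy⟩
    · exact c₂ ⟨hx, h1⟩
  · exact c₂ ⟨hx, hy⟩

lemma card_le_card_connectedComponent {W : Type*} [Finite W] (H : SimpleGraph W) (T : Finset W)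
    (hT : ∀ x ∈ T, ∀ y ∈ T, x ≠ y → ¬ H.Reachable x y) : #T ≤ Nat.card H.ConnectedComponent := by
  have := Fintype.ofFinite H.ConnectedComponent
  rw [Nat.card_eq_fintype_card, ← card_univ]
  refine card_le_card_of_injOn H.connectedComponentMk (fun _ _ => mem_univ _) ?_
  intro x hx y hy hxy
  by_contra hne
  exact hT x hx y hy hne (ConnectedComponent.eq.1 hxy)

lemma SimpleGraph.Walk.exists_of_induce {G : SimpleGraph V} {s : Set V} {x y : s}
    (p : (G.induce s).Walk x y) : ∃ q : G.Walk x y, ∀ z ∈ q.support, z ∈ s := by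
  induction p with
  | nil => rename_i x; exact ⟨.nil, by simp⟩
  | cons h p ih =>
    obtain ⟨q, hq⟩ := ih
    rename_i x _ _
    refine ⟨.cons h q, fun z hz => ?_⟩
    rcases List.mem_cons.1 hz with rfl | hz
    · exact x.2
    · exact hq z hz

namespace IsTough

variable [Fintype V] {G : SimpleGraph V} {ε : ℝ}

/-- If removing `S` separates the vertices of `T` from each other, then `S` is larger than `T`. -/
lemma card_lt (h : IsTough (1 + ε) G) (hε : 0 < ε) (S T : Finset V) (hT : 2 ≤ #T)
    (hST : ∀ x ∈ T, x ∉ S)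
    (hsep : ∀ x ∈ T, ∀ y ∈ T, x ≠ y → ∀ p : G.Walk x y, ∃ z ∈ p.support, z ∈ S) : #T < #S := by
  classical
  have h1 : #T ≤ Nat.card (G.induce ((S : Set V)ᶜ)).ConnectedComponent := by
    have := card_le_card_connectedComponent (G.induce ((S : Set V)ᶜ))
      (T.subtype (fun x => x ∈ (S : Set V)ᶜ)) (by
        intro x hx y hy hxy ⟨p⟩
        obtain ⟨z, hz, hzS⟩ := hsep x (by simpa using hx) y (by simpa using hy)
          (fun h => hxy (Subtype.ext h)) (p.exists_of_induce).choose
        exact p.exists_of_induce.choose_spec z hz hzS)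
    rw [card_subtype, filter_true_of_mem (by simpa using hST)] at this
    exact this
  have h2 := h S (hT.trans h1)
  have h3 : (#T : ℝ) ≤ Nat.card (G.induce ((S : Set V)ᶜ)).ConnectedComponent := by
    exact_mod_cast h1
  have h4 : (2 : ℝ) ≤ #T := by exact_mod_cast hT
  have h5 : (#T : ℝ) < #S := by nlinarith
  exact_mod_cast h5

/-- Vertices different from `a` and `b` are joined by a walk avoiding both. -/
lemma exists_walk_avoiding (h : IsTough (1 + ε) G) (hε : 0 < ε) {a b x y : V} (hxa : x ≠ a)
    (hxb : x ≠ b) (hya : y ≠ a) (hyb : y ≠ b) :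
    ∃ p : G.Walk x y, a ∉ p.support ∧ b ∉ p.support := by
  classical
  by_contra! hcon
  have hne : x ≠ y := by
    rintro rfl
    exact hxb.symm (by simpa using hcon .nil (by simpa using hxa.symm))
  have := h.card_lt hε {a, b} {x, y} (by rw [card_pair hne]) (by simp [*]) (by
    intro u hu v hv huv p
    have key : ∀ p : G.Walk x y, ∃ z ∈ p.support, z ∈ ({a, b} : Finset V) := by
      intro p
      by_cases ha : a ∈ p.support
      · exact ⟨a, ha, by simp⟩
      · exact ⟨b, hcon p ha, by simp⟩
    simp only [mem_insert, mem_singleton] at hu hv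
    rcases hu with rfl | rfl <;> rcases hv with rfl | rfl
    · exact absurd rfl huv
    · exact key p
    · obtain ⟨z, hz, hz'⟩ := key p.reverse
      exact ⟨z, by simpa using hz, hz'⟩
    · exact absurd rfl huv)
  rw [card_pair hne] at this
  have := card_le_two (a := a) (b := b)
  omega

/-- Hall's condition with surplus one for an independent set with at least two vertices outside. -/
lemma card_succ_le (h : IsTough (1 + ε) G) (hε : 0 < ε) [DecidableEq V] [DecidableRel G.Adj]
    {C T : Finset V} (hC : 3 ≤ #C) (hT : T.Nonempty) (hdis : Disjoint C T)
    (hN : ∀ x ∈ T, G.neighborFinset x ⊆ C) :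
    #T + 1 ≤ #(T.biUnion fun x => G.neighborFinset x) := by
  set S := T.biUnion fun x => G.neighborFinset x
  have hSC : S ⊆ C := biUnion_subset.2 hN
  have hTS : ∀ x ∈ T, x ∉ S := fun x hx hxS => disjoint_left.1 hdis (hSC hxS) hx
  have leave : ∀ x ∈ T, ∀ y, x ≠ y → ∀ p : G.Walk x y, ∃ z ∈ p.support, z ∈ S := by
    intro x hx y hxy p
    rcases p with _ | ⟨h, q⟩
    · exact absurd rfl hxy
    · rename_i w
      exact ⟨w, by simp, mem_biUnion.2 ⟨x, hx, by simpa using h⟩⟩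
  rcases (by have := hT.card_pos; omega : 2 ≤ #T ∨ #T = 1) with h2 | h1
  · exact h.card_lt hε S T h2 hTS fun x hx y _ => leave x hx y
  · obtain ⟨x, rfl⟩ := card_eq_one.1 h1
    by_contra! hlt
    have hS : #S < #C := by simp at hlt ⊢; omega
    obtain ⟨y, hy, hyS⟩ := exists_mem_notMem_of_card_lt_card hS
    have hxy : x ≠ y := by
      rintro rfl
      exact disjoint_left.1 hdis hy (by simp)
    have := h.card_lt hε S {x, y} (by rw [card_pair hxy]) (by
      intro z hz
      rcases mem_insert.1 hz with rfl | hz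
      · exact hTS z (by simp)
      · rwa [mem_singleton.1 hz]) (by
      intro u hu v hv huv p
      simp only [mem_insert, mem_singleton] at hu hv
      rcases hu with rfl | rfl
      · exact leave u (by simp) v huv p
      · rcases hv with rfl | rfl
        · obtain ⟨z, hz, hz'⟩ := leave v (by simp) u huv.symm p.reverse
          exact ⟨z, by simpa using hz, hz'⟩
        · exact absurd rfl huv)
    rw [card_pair hxy] at this
    rw [card_singleton] at hlt
    omega

end IsTough

/-- The vertices of a cycle, indexed periodically. -/
lemma SimpleGraph.Walk.IsCycle.exists_isCycleParam [DecidableEq V] {G : SimpleGraph V} {u : V}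
    {p : G.Walk u u} (hp : p.IsCycle) :
    ∃ c, IsCycleParam G p.length p.support.toFinset c := by
  have h3 := hp.three_le_length
  have hpos : (0 : ℤ) < p.length := by omega
  refine ⟨fun i => p.getVert (i % p.length).toNat, by omega, fun i => by simp, ?_, ?_, ?_⟩
  · intro i
    have a0 := Int.emod_nonneg i hpos.ne'
    have a1 := Int.emod_lt_of_pos i hpos
    have key : p.getVert ((i + 1) % p.length).toNat = p.getVert ((i % p.length).toNat + 1) := by
      rw [Int.add_emod, Int.emod_eq_of_lt (a := 1) (by omega) (by omega)]
      rcases (by omega : i % (p.length : ℤ) + 1 < p.length ∨ i % (p.length : ℤ) + 1 = p.length)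
        with h | h
      · rw [Int.emod_eq_of_lt (by omega) h]
        congr 1
        omega
      · rw [h, Int.emod_self, (by omega : (i % (p.length : ℤ)).toNat + 1 = p.length)]
        simp
    rw [key]
    exact p.adj_getVert_succ (by omega)
  · intro i j hij
    have a0 := Int.emod_nonneg i hpos.ne'
    have a1 := Int.emod_lt_of_pos i hpos
    have b0 := Int.emod_nonneg j hpos.ne'
    have b1 := Int.emod_lt_of_pos j hpos
    have := hp.getVert_injOn' (by simp only [Set.mem_ofPred_eq]; omega)
      (by simp only [Set.mem_ofPred_eq]; omega) hij
    exact Int.ModEq.dvd (show i % p.length = j % p.length by omega)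
  · intro v
    rw [List.mem_toFinset, Walk.mem_support_iff_exists_getVert]
    constructor
    · rintro ⟨m, rfl, hm⟩
      rcases hm.lt_or_eq with h | h
      · refine ⟨m, ?_⟩
        rw [Int.emod_eq_of_lt (by omega) (by omega)]
        simp
      · refine ⟨0, ?_⟩
        simp [h]
    · rintro ⟨i, rfl⟩
      have a1 := Int.emod_lt_of_pos i hpos
      exact ⟨_, rfl, by omega⟩

/-- A pair forest provides detours avoiding every set that meets each component at most once. -/
lemma IsPairForest.exists_isDetour [Fintype V] [DecidableEq V] {G : SimpleGraph V} {C : Finset V}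
    {f : V → Sym2 V} (hf : IsPairForest G (C : Set V)ᶜ f) (hI : ∀ x ∉ C, ∀ y ∉ C, ¬ G.Adj x y)
    (W X : Finset V) (hX : Disjoint C X)
    (hW : ∀ a ∈ W, ∀ b ∈ W, a ≠ b → ¬ (pairGraph f ((C : Set V)ᶜ \ X)).Reachable a b) :
    ∃ D, IsDetour G C W X D := by
  obtain ⟨m, h1, h2, h3⟩ := hf.exists_injOn (C ∪ X)ᶜ (by simp) W (by
    have : ((((C ∪ X)ᶜ : Finset V)) : Set V) = (C : Set V)ᶜ \ X := by
      ext; simp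
    rwa [this])
  have hC : ∀ x ∈ (C ∪ X)ᶜ, x ∉ C := fun x hx h => by simp [h] at hx
  have hadj : ∀ x ∈ (C ∪ X)ᶜ, G.Adj x (m x) := fun x hx => hf.adj (by simpa using hC x hx) (h2 x hx)
  obtain ⟨D, e1, e2, e3⟩ := exists_detours G C (C ∪ X)ᶜ X W
    (by rw [disjoint_right]; exact hC)
    (by
      rw [disjoint_union_left]
      exact ⟨hX, by rw [Finset.disjoint_left]; intro x hx; simp at hx; exact hx.2⟩)
    (by ext x; simp; tauto) m h1 hadj
    (fun x hx => by
      by_contra h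
      exact hI x (hC x hx) _ h (hadj x hx)) h3
  exact ⟨D, e1, e2, e3⟩

lemma exists_append_cons_of_mem_edges {H : SimpleGraph V} {u v : V} (p : H.Walk u v) {e : Sym2 V}
    (he : e ∈ p.edges) :
    ∃ (s t : V) (p₁ : H.Walk u s) (h : H.Adj s t) (p₂ : H.Walk t v),
      p = p₁.append (.cons h p₂) ∧ e = s(s, t) := by
  induction p with
  | nil => simp at he
  | cons h p ih =>
    rw [Walk.edges_cons, List.mem_cons] at he
    rcases he with rfl | he
    · exact ⟨_, _, .nil, h, p, rfl, rfl⟩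
    · obtain ⟨s, t, p₁, h', p₂, rfl, rfl⟩ := ih he
      exact ⟨s, t, .cons h p₁, h', p₂, rfl, rfl⟩

section pairGraph

variable {f g : V → Sym2 V} {Y Z : Set V}

lemma exists_eq_of_mem_edges_pairGraph {u v : V} (q : (pairGraph f Y).Walk u v) {e : Sym2 V}
    (he : e ∈ q.edges) : ∃ y ∈ Y, f y = e ∧ ¬ e.IsDiag := by
  have := q.edges_subset_edgeSet he
  simp only [pairGraph, edgeSet_fromEdgeSet] at this
  obtain ⟨⟨y, hy, rfl⟩, h⟩ := this
  exact ⟨y, hy, rfl, h⟩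

lemma exists_pairGraph_walk {u v : V} (q : (pairGraph f Y).Walk u v)
    (h : ∀ y ∈ Y, f y ∈ q.edges → y ∈ Z ∧ g y = f y) :
    ∃ q' : (pairGraph g Z).Walk u v, q'.length = q.length := by
  refine ⟨q.transfer _ ?_, q.length_transfer _⟩
  intro e he
  obtain ⟨y, hy, rfl, hd⟩ := exists_eq_of_mem_edges_pairGraph q he
  obtain ⟨h1, h2⟩ := h y hy he
  simp only [pairGraph, edgeSet_fromEdgeSet]
  exact ⟨⟨y, h1, h2⟩, hd⟩

lemma mem_of_mem_support_pairGraph {u v z : V} (q : (pairGraph f Y).Walk u v) (hz : z ∈ q.support)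
    (hzu : z ≠ u) : ∃ y ∈ Y, z ∈ f y := by
  classical
  rcases h : (q.takeUntil z hz).reverse with _ | ⟨h', q'⟩
  · exact absurd rfl hzu
  · obtain ⟨y, hy, h1, -⟩ := exists_eq_of_mem_edges_pairGraph (.cons h' q') (e := s(z, _))
      (by rw [Walk.edges_cons]; exact List.mem_cons_self)
    exact ⟨y, hy, h1 ▸ Sym2.mem_mk_left _ _⟩

/-- A walk along pairs lifts to a walk through the vertices labelling these pairs. -/
lemma IsPairForest.exists_walk {G : SimpleGraph V} (hf : IsPairForest G Y f) {u v : V}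
    (q : (pairGraph f Y).Walk u v) :
    ∃ p : G.Walk u v, ∀ z ∈ p.support, z ∈ q.support ∨ z ∈ Y ∧ f z ∈ q.edges := by
  induction q with
  | nil => exact ⟨.nil, by simp⟩
  | cons h q ih =>
    obtain ⟨p, hp⟩ := ih
    obtain ⟨y, hy, h1, -⟩ := exists_eq_of_mem_edges_pairGraph (.cons h q) (e := s(_, _))
      (by rw [Walk.edges_cons]; exact List.mem_cons_self)
    refine ⟨.cons (hf.adj hy (h1 ▸ Sym2.mem_mk_left _ _)).symm
      (.cons (hf.adj hy (h1 ▸ Sym2.mem_mk_right _ _)) p), fun z hz => ?_⟩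
    simp only [Walk.support_cons, List.mem_cons, Walk.edges_cons] at hz ⊢
    rcases hz with rfl | rfl | hz
    · exact Or.inl (Or.inl rfl)
    · exact Or.inr ⟨hy, Or.inl h1⟩
    · rcases hp z hz with h | h
      · exact Or.inl (Or.inr h)
      · exact Or.inr ⟨h.1, Or.inr h.2⟩

end pairGraph

/-- Either the forest path `u, v, …, w` can be shortened by an exchange, or the edge from `u` to `v`
completes to a triangle. -/
lemma IsPairForest.exists_shorter_or {G : SimpleGraph V} {I : Set V} {f : V → Sym2 V}
    (hG : FiveChordal G) (hI : ∀ x ∈ I, ∀ y ∈ I, ¬ G.Adj x y) (hf : IsPairForest G I f)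
    {x u v w : V} (hx : x ∈ I) (hxu : f x = s(u, v)) (q : (pairGraph f I).Walk v w)
    (hq : q.IsPath) (huq : u ∉ q.support) (hlen : v ≠ w) (hna : ¬ G.Adj u v) (E : Set V)
    (hE : ∀ e ∈ E, x ≠ e ∧ ¬ G.Adj x e) (huE : u ∉ E) (hvE : v ∉ E) (r : G.Walk w u)
    (hr : ∀ z ∈ r.support, z ∈ E ∨ z = w ∨ z = u) :
    (∃ f', IsPairForest G I f' ∧ ∃ q' : (pairGraph f' I).Walk u w, q'.length ≤ q.length) ∨
      (∃ z ∈ q.support, G.Adj v z ∧ G.Adj u z) ∨ ∃ e ∈ E, G.Adj e v ∧ G.Adj e u := by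
  classical
  have hadju := hf.adj hx (hxu ▸ Sym2.mem_mk_left u v)
  have hadjv := hf.adj hx (hxu ▸ Sym2.mem_mk_right u v)
  have hxq : f x ∉ q.edges := fun h => huq (q.fst_mem_support_of_mem_edges (hxu ▸ h))
  have hnr := hf.not_reachable hx hxu
  by_cases hexch : ∃ z ∈ q.support, z ≠ v ∧ G.Adj x z
  · obtain ⟨z, hz, hzv, hxz⟩ := hexch
    refine Or.inl ⟨_, hf.update hx hadju hxz ?_, ?_⟩
    · intro h
      obtain ⟨q₁, -⟩ := exists_pairGraph_walk (g := f) (Z := I \ {x}) (q.takeUntil z hz)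
        (fun y hy hyq => ⟨⟨hy, by
          rintro rfl
          exact hxq (q.edges_takeUntil_subset_edges hz hyq)⟩, rfl⟩)
      exact hnr (h.trans q₁.reachable.symm)
    · obtain ⟨q₂, hq₂⟩ := exists_pairGraph_walk (g := Function.update f x s(u, z)) (Z := I)
        (q.dropUntil z hz) (fun y hy h => ⟨hy, Function.update_of_ne
          (by rintro rfl; exact hxq (q.edges_dropUntil_subset_edges hz h)) _ _⟩)
      have huz : u ≠ z := by rintro rfl; exact huq hz
      refine ⟨.cons (pairGraph_adj.2 ⟨⟨x, hx, by simp⟩, huz⟩) q₂, ?_⟩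
      have h1 := congrArg Walk.length (q.take_spec hz)
      have h2 : (q.takeUntil z hz).length ≠ 0 := fun h => hzv (Walk.eq_of_length_eq_zero h).symm
      rw [Walk.length_append] at h1
      rw [Walk.length_cons, hq₂]
      omega
  push Not at hexch
  have hvx : ∀ z ∈ q.support, z ≠ x := by
    rintro z hz rfl
    obtain ⟨y, hy, h⟩ := mem_of_mem_support_pairGraph q hz hadjv.ne
    exact hI y hy _ hx (hf.adj hy h)
  obtain ⟨p, hp⟩ := hf.exists_walk q
  have huv := hf.ne hx hxu
  obtain ⟨-, z, hz, hzu, hzv⟩ := hG.exists_adj (u := u) (v := v) huv hna (D₁ := {x})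
    (D₂ := {z | z ∈ q.support ∧ z ≠ v ∨ z ∈ I ∧ f z ∈ q.edges ∨ z ∈ E}) hadju.ne' hadjv.ne'
    (by
      rintro (⟨h, -⟩ | ⟨h, -⟩ | h)
      · exact huq h
      · exact hI x hx _ h hadju
      · exact huE h)
    (by
      rintro (⟨-, h⟩ | ⟨h, -⟩ | h)
      · exact h rfl
      · exact hI x hx _ h hadjv
      · exact hvE h)
    (by
      rintro _ rfl z (⟨h, h'⟩ | ⟨h, h'⟩ | h)
      · exact ⟨(hvx z h).symm, hexch z h h'⟩
      · exact ⟨by rintro rfl; exact hxq h', hI _ hx _ h⟩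
      · exact hE z h)
    (.cons hadju.symm (.cons hadjv .nil)) (by
      intro z hz
      simp only [Walk.support_cons, Walk.support_nil, List.mem_cons, List.not_mem_nil] at hz
      simp only [Set.mem_singleton_iff]
      tauto)
    (p.append r).reverse (by
      intro z hz
      rw [Walk.support_reverse, List.mem_reverse, Walk.mem_support_append_iff] at hz
      by_cases hzv : z = v
      · exact Or.inr (Or.inr hzv)
      rcases hz with hz | hz
      · rcases hp z hz with h | h
        · exact Or.inl (Or.inl ⟨h, hzv⟩)
        · exact Or.inl (Or.inr (Or.inl h))
      · rcases hr z hz with h | rfl | rfl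
        · exact Or.inl (Or.inr (Or.inr h))
        · exact Or.inl (Or.inl ⟨q.end_mem_support, hzv⟩)
        · exact Or.inr (Or.inl rfl))
  rcases hz with ⟨hz, hne⟩ | ⟨hzI, hz⟩ | hz
  · exact Or.inr (Or.inl ⟨z, hz, hzv.symm, hzu.symm⟩)
  · left
    obtain ⟨s, t, q₁, h, q₂, hq', hst⟩ := exists_append_cons_of_mem_edges q hz
    have hxz : x ≠ z := by rintro rfl; exact hxq hz
    have hnd := hq.isTrail.edges_nodup
    rw [hq', Walk.edges_append, Walk.edges_cons, ← hst, List.nodup_append, List.nodup_cons] at hnd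
    have h₁ : f z ∉ q₁.edges := fun h => hnd.2.2 _ h _ List.mem_cons_self rfl
    have h₂ : f z ∉ q₂.edges := hnd.2.1.1
    refine ⟨_, hf.update hzI hzu (hf.adj hzI (hst ▸ Sym2.mem_mk_right s t)) ?_, ?_⟩
    · intro hut
      obtain ⟨q₁', -⟩ := exists_pairGraph_walk (g := f) (Z := I \ {z}) q₁
        (fun y hy h => ⟨⟨hy, by rintro rfl; exact h₁ h⟩, rfl⟩)
      exact hf.not_reachable hzI hst (q₁'.reachable.symm.trans
        ((pairGraph_reachable (Y := I \ {z}) ⟨hx, hxz⟩ hxu).symm.trans hut))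
    · obtain ⟨q₂', hl⟩ := exists_pairGraph_walk (g := Function.update f z s(u, t)) (Z := I)
        q₂ (fun y hy h => ⟨hy, Function.update_of_ne (by rintro rfl; exact h₂ h) _ _⟩)
      have hut : u ≠ t := by
        rintro rfl
        exact huq (by rw [hq']; simp)
      refine ⟨.cons (pairGraph_adj.2 ⟨⟨z, hzI, by simp⟩, hut⟩) q₂', ?_⟩
      rw [hq', Walk.length_append, Walk.length_cons, Walk.length_cons, hl]
      omega
  · exact Or.inr (Or.inr ⟨z, hz, hzv, hzu⟩)

namespace IsPairForest

variable {G : SimpleGraph V} {I : Set V} {f : V → Sym2 V}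

/-- If no pair of a forest is an edge of `G`, then no edge of `G` joins two vertices of a component
of a forest. -/
lemma not_reachable_of_adj (hG : FiveChordal G) (hI : ∀ x ∈ I, ∀ y ∈ I, ¬ G.Adj x y)
    (h₁ : ∀ f, IsPairForest G I f → ∀ x ∈ I, ∀ u w, f x = s(u, w) → ¬ G.Adj u w)
    (hf : IsPairForest G I f) {u w : V} (huw : G.Adj u w) : ¬ (pairGraph f I).Reachable u w := by
  classical
  rintro ⟨p⟩
  induction hn : p.length using Nat.strong_induction_on generalizing f u w p with
  | _ n ih =>
    have hp := p.bypass_isPath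
    have hl := p.length_bypass_le_length
    rcases hb : p.bypass with _ | ⟨h, q⟩
    · exact huw.ne rfl
    rename_i v
    rw [hb] at hp hl
    rw [Walk.cons_isPath_iff] at hp
    rw [Walk.length_cons] at hl
    obtain ⟨⟨x, hx, hxu⟩, -⟩ := pairGraph_adj.1 h
    have hna := h₁ f hf x hx u v hxu
    have hvw : v ≠ w := by rintro rfl; exact hna huw
    rcases hf.exists_shorter_or hG hI hx hxu q hp.1 hp.2 hvw hna ∅ (by simp) (by simp) (by simp)
      (.cons huw.symm .nil) (by simp) with ⟨f', hf', q', hq'⟩ | ⟨z, hz, hvz, -⟩ | ⟨e, he, -⟩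
    · exact ih _ (by omega) hf' huw q' rfl
    · refine ih _ ?_ hf hvz (q.takeUntil z hz) rfl
      have := q.length_takeUntil_le_length hz
      omega
    · exact he

lemma not_adj_of_adj (hG : FiveChordal G) (hI : ∀ x ∈ I, ∀ y ∈ I, ¬ G.Adj x y)
    (h₁ : ∀ f, IsPairForest G I f → ∀ x ∈ I, ∀ u w, f x = s(u, w) → ¬ G.Adj u w)
    (hf : IsPairForest G I f) {x u w : V} (hx : x ∈ I) (hu : G.Adj x u) (hw : G.Adj x w) :
    ¬ G.Adj u w := by
  classical
  intro huw
  by_cases h : (pairGraph f (I \ {x})).Reachable u w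
  · exact hf.not_reachable_of_adj hG hI h₁ huw (h.mono (pairGraph_mono Set.sdiff_subset))
  · exact h₁ _ (hf.update hx hu hw h) x hx u w (by simp) huw

/-- Let `c` be a neighbour of `b`. If the pairs at `b` in all forests avoid the neighbours of `c`,
then so do the components of `b`. -/
lemma not_reachable_of_adj_adj (hG : FiveChordal G) (hI : ∀ x ∈ I, ∀ y ∈ I, ¬ G.Adj x y)
    (h₁ : ∀ f, IsPairForest G I f → ∀ x ∈ I, ∀ u w, f x = s(u, w) → ¬ G.Adj u w)
    {b c : V} (hbc : G.Adj b c) (hc : c ∉ I)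
    (h₃ : ∀ f, IsPairForest G I f → ∀ x ∈ I, ∀ v, f x = s(b, v) → ¬ G.Adj v c)
    (hf : IsPairForest G I f) {w : V} (hwc : G.Adj w c) (hwb : w ≠ b) :
    ¬ (pairGraph f I).Reachable b w := by
  classical
  rintro ⟨p⟩
  induction hn : p.length using Nat.strong_induction_on generalizing f p with
  | _ n ih =>
    have hp := p.bypass_isPath
    have hl := p.length_bypass_le_length
    rcases hb : p.bypass with _ | ⟨h, q⟩
    · exact hwb rfl
    rename_i v
    rw [hb] at hp hl
    rw [Walk.cons_isPath_iff] at hp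
    rw [Walk.length_cons] at hl
    obtain ⟨⟨x, hx, hxb⟩, -⟩ := pairGraph_adj.1 h
    have hna := h₁ f hf x hx b v hxb
    have hvw : v ≠ w := by rintro rfl; exact h₃ f hf x hx v hxb hwc
    have hxb' := hf.adj hx (hxb ▸ Sym2.mem_mk_left b v)
    rcases hf.exists_shorter_or hG hI hx hxb q hp.1 hp.2 hvw hna {c}
      (by
        rintro _ rfl
        exact ⟨fun h => hc (h ▸ hx), fun h => hf.not_adj_of_adj hG hI h₁ hx hxb' h hbc⟩)
      hbc.ne (fun h => hna (by rwa [Set.mem_singleton_iff.1 h]))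
      (.cons hwc (.cons hbc.symm .nil)) (by simp)
      with ⟨f', hf', q', hq'⟩ | ⟨z, hz, hvz, -⟩ | ⟨_, rfl, he, -⟩
    · exact ih _ (by omega) hf' q' rfl
    · exact hf.not_reachable_of_adj hG hI h₁ hvz ⟨q.takeUntil z hz⟩
    · exact h₃ f hf x hx v hxb he.symm

end IsPairForest

/-- A 5-chordal graph without Hamiltonian prism, together with the vertex set `C` of an
edge-dominating cycle of odd length `n`. -/
structure IsObstruction [Fintype V] [DecidableEq V] (G : SimpleGraph V) (n : ℤ) (C : Finset V) :
    Prop where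
  fiveChordal : FiveChordal G
  not_prismHamiltonian : ¬ PrismHamiltonian G
  odd : Odd n
  not_adj : ∀ x ∉ C, ∀ y ∉ C, ¬ G.Adj x y

namespace IsObstruction

variable [Fintype V] [DecidableEq V] {G : SimpleGraph V} {n : ℤ} {C : Finset V} {c : ℤ → V}
  {f : V → Sym2 V}

lemma mem_of_adj (ho : IsObstruction G n C) {x y : V} (hx : x ∉ C) (h : G.Adj x y) : y ∈ C := by
  by_contra hy
  exact ho.not_adj x hx y hy h

lemma not_adj_of_pair (ho : IsObstruction G n C) (h : IsCycleParam G n C c)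
    (hf : IsPairForest G (C : Set V)ᶜ f) {x : V} (hx : x ∉ C) {u w : V} (hfx : f x = s(u, w)) :
    ¬ G.Adj u w := by
  intro huw
  have hu := hf.adj hx (hfx ▸ Sym2.mem_mk_left u w)
  have hw := hf.adj hx (hfx ▸ Sym2.mem_mk_right u w)
  obtain ⟨i, rfl⟩ := (h.mem _).1 (ho.mem_of_adj hx hu)
  obtain ⟨k, h1, h2, rfl⟩ := h.exists_pos (ho.mem_of_adj hx hw) i
  have hik : i ≠ k := by rintro rfl; exact huw.ne rfl
  have hnr := hf.not_reachable hx hfx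
  obtain ⟨D, hD⟩ := hf.exists_isDetour ho.not_adj {c i, c k} {x} (by simpa) (by
    intro a ha b hb hab
    rw [coe_singleton]
    simp only [mem_insert, mem_singleton] at ha hb
    rcases ha with rfl | rfl <;> rcases hb with rfl | rfl
    · exact absurd rfl hab
    · exact hnr
    · exact fun h => hnr h.symm
    · exact absurd rfl hab)
  refine ho.not_prismHamiltonian ((h.shift i).prismHamiltonian_of_adj_of_detour ho.odd (k := k - i)
    (by omega) (by omega) (x := x) ?_ ?_ ?_ (D := D) ?_) <;> simpa

/-- Adjacent vertices lie in different components. -/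
lemma not_reachable_of_adj (ho : IsObstruction G n C) (h : IsCycleParam G n C c)
    (hf : IsPairForest G (C : Set V)ᶜ f) {u w : V} (huw : G.Adj u w) :
    ¬ (pairGraph f (C : Set V)ᶜ).Reachable u w :=
  hf.not_reachable_of_adj ho.fiveChordal ho.not_adj
    (fun _ hf _ hx _ _ => ho.not_adj_of_pair h hf hx) huw

/-- Vertices outside of the cycle lie in no triangle. -/
lemma not_adj_of_adj (ho : IsObstruction G n C) (h : IsCycleParam G n C c)
    (hf : IsPairForest G (C : Set V)ᶜ f) {x u w : V} (hx : x ∉ C) (hu : G.Adj x u)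
    (hw : G.Adj x w) : ¬ G.Adj u w :=
  hf.not_adj_of_adj ho.fiveChordal ho.not_adj
    (fun _ hf _ hx _ _ => ho.not_adj_of_pair h hf hx) hx hu hw

lemma not_adj_of_pair_of_triangle (ho : IsObstruction G n C) (h : IsCycleParam G n C c)
    (hf : IsPairForest G (C : Set V)ᶜ f) {i j : ℤ} (h0 : 0 < i) (hij : i < j) (hjn : j < n)
    (hi : Odd i) (hj : Even j) (hab : G.Adj (c j) (c 0)) (hbc : G.Adj (c 0) (c i))
    (hca : G.Adj (c i) (c j)) {x v : V} (hx : x ∉ C) (hfx : f x = s(c 0, v)) :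
    ¬ G.Adj v (c i) := by
  intro hvc
  have hxb := hf.adj hx (hfx ▸ Sym2.mem_mk_left _ _)
  have hxv := hf.adj hx (hfx ▸ Sym2.mem_mk_right _ _)
  have hbv := hf.ne hx hfx
  obtain ⟨k, h1, h2, rfl⟩ := h.exists_pos (ho.mem_of_adj hx hxv) 0
  have hk0 : k ≠ 0 := by rintro rfl; exact hbv rfl
  have hki : k ≠ i := by rintro rfl; exact hvc.ne rfl
  have hkj : k ≠ j := by rintro rfl; exact ho.not_adj_of_pair h hf hx hfx hab.symm
  have hle := pairGraph_mono (f := f) (Set.sdiff_subset (s := (C : Set V)ᶜ) (t := {x}))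
  have hbk := hf.not_reachable hx hfx
  have hR := pairGraph_reachable (f := f) (Y := (C : Set V)ᶜ) hx hfx
  have adj : ∀ {u w}, G.Adj u w → ¬ (pairGraph f ((C : Set V)ᶜ \ {x})).Reachable u w :=
    fun ha hr => ho.not_reachable_of_adj h hf ha (hr.mono hle)
  have adj_ab := adj hab
  have adj_bc := adj hbc
  have adj_ca := adj hca
  have adj_vc := adj hvc
  have hka : ¬ (pairGraph f ((C : Set V)ᶜ \ {x})).Reachable (c k) (c j) := fun hr =>
    ho.not_reachable_of_adj h hf hab.symm (hR.trans (hr.mono hle))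
  obtain ⟨D, hD⟩ := hf.exists_isDetour ho.not_adj {c 0, c i, c j, c k} {x} (by simpa) (by
    intro a ha b hb hne
    rw [coe_singleton]
    simp only [mem_insert, mem_singleton] at ha hb
    rcases ha with rfl | rfl | rfl | rfl <;> rcases hb with rfl | rfl | rfl | rfl <;>
      first
      | exact absurd rfl hne
      | assumption
      | exact fun hr => absurd hr.symm (by assumption))
  exact ho.not_prismHamiltonian (h.prismHamiltonian_of_triangle_of_detour ho.odd h0 hij hjn hi hj
    (by omega) (by omega) hki hkj hab hca hvc hxb hxv hD)

/-- In a triangle cutting the cycle into odd segments, the component of a corner contains no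
neighbour of the next corner. -/
lemma not_reachable_of_triangle (ho : IsObstruction G n C) (h : IsCycleParam G n C c)
    (hf : IsPairForest G (C : Set V)ᶜ f) {i j : ℤ} (h0 : 0 < i) (hij : i < j) (hjn : j < n)
    (hi : Odd i) (hj : Even j) (hab : G.Adj (c j) (c 0)) (hbc : G.Adj (c 0) (c i))
    (hca : G.Adj (c i) (c j)) {w : V} (hw : G.Adj w (c i)) (hwb : w ≠ c 0) :
    ¬ (pairGraph f (C : Set V)ᶜ).Reachable (c 0) w :=
  hf.not_reachable_of_adj_adj ho.fiveChordal ho.not_adj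
    (fun _ hf _ hx _ _ => ho.not_adj_of_pair h hf hx) hbc (fun hx => hx (h.apply_mem i))
    (fun _ hf _ hx _ hv => ho.not_adj_of_pair_of_triangle h hf h0 hij hjn hi hj hab hbc hca hx hv)
    hw hwb

end IsObstruction

namespace IsCycleParam

variable {G : SimpleGraph V} {n : ℤ} {C : Finset V} {c : ℤ → V}

lemma exists_walk (h : IsCycleParam G n C c) {i j : ℤ} (hij : i ≤ j) :
    ∃ p : G.Walk (c i) (c j), ∀ z ∈ p.support, ∃ t, i ≤ t ∧ t ≤ j ∧ c t = z := by
  induction j, hij using Int.leInduction with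
  | base => exact ⟨.nil, by simpa using ⟨i, le_rfl, le_rfl, rfl⟩⟩
  | succ j hij ih =>
    obtain ⟨p, hp⟩ := ih
    refine ⟨p.concat (h.adj j), fun z hz => ?_⟩
    rw [Walk.support_concat, List.mem_append, List.mem_singleton] at hz
    rcases hz with hz | rfl
    · obtain ⟨t, h1, h2, h3⟩ := hp z hz
      exact ⟨t, h1, by omega, h3⟩
    · exact ⟨j + 1, by omega, le_rfl, rfl⟩

lemma ne (h : IsCycleParam G n C c) {i j : ℤ} (hij : i < j) (hj : j - i < n) : c i ≠ c j := by
  intro he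
  have := h.three_le
  have := h.injOn he hj (by omega)
  omega

/-- A chord spanning an even segment of the cycle yields a triangle with odd segments. -/
lemma exists_triangle (h : IsCycleParam G n C c) (hG : FiveChordal G) {i j : ℤ} (hij : i < j)
    (hjn : j - i < n) (he : Even (j - i)) (hadj : G.Adj (c i) (c j)) :
    ∃ i' k j', i ≤ i' ∧ i' < k ∧ k < j' ∧ j' ≤ j ∧ Odd (k - i') ∧ Odd (j' - k) ∧
      G.Adj (c i') (c k) ∧ G.Adj (c k) (c j') ∧ G.Adj (c i') (c j') := by
  induction hm : (j - i).toNat using Nat.strong_induction_on generalizing i j with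
  | _ m ih =>
    by_cases hsub : ∃ i₁ j₁, i ≤ i₁ ∧ i₁ < j₁ ∧ j₁ ≤ j ∧ j₁ - i₁ < j - i ∧ Even (j₁ - i₁) ∧
        G.Adj (c i₁) (c j₁)
    · obtain ⟨i₁, j₁, h1, h2, h3, h4, h5, h6⟩ := hsub
      obtain ⟨i', k, j', e1, e2, e3, e4, e5⟩ := ih _ (by omega) h2 (by omega) h5 h6 rfl
      exact ⟨i', k, j', by omega, e2, e3, by omega, e5⟩
    push Not at hsub
    have hsub' : ∀ i₁ j₁, i ≤ i₁ → i₁ < j₁ → j₁ ≤ j → j₁ - i₁ < j - i → G.Adj (c i₁) (c j₁) →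
        Odd (j₁ - i₁) := fun i₁ j₁ h1 h2 h3 h4 h5 => by
      rw [← Int.not_even_iff_odd]
      exact fun h6 => hsub i₁ j₁ h1 h2 h3 h4 h6 h5
    have h2 : i + 1 < j := by
      rcases he with ⟨r, hr⟩
      omega
    obtain ⟨k, ⟨hik, hkj, hck⟩, hmax⟩ := Int.exists_greatest_of_bdd
      (P := fun k => i < k ∧ k < j ∧ G.Adj (c i) (c k)) ⟨j, fun k hk => hk.2.1.le⟩
      ⟨i + 1, by omega, h2, h.adj i⟩
    have hk := hsub' i k le_rfl hik hkj.le (by omega) hck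
    have hjk : Odd (j - k) := by
      have := he.sub_odd hk
      rwa [sub_sub_sub_cancel_right] at this
    by_cases hkj' : G.Adj (c k) (c j)
    · exact ⟨i, k, j, le_rfl, hik, hkj, le_rfl, hk, hjk, hck, hkj', hadj⟩
    exfalso
    obtain ⟨p, hp⟩ := h.exists_walk hkj.le
    obtain ⟨-, -, ⟨t, h1, h2, rfl⟩, h3, h4⟩ := hG.exists_adj (h.ne hkj (by omega)) hkj'
      (D₁ := {c i}) (D₂ := {z | ∃ t, k < t ∧ t < j ∧ c t = z})
      (fun he => h.ne hik (by omega) he.symm) (fun he => h.ne hij (by omega) he.symm)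
      (by rintro ⟨t, h1, h2, h3⟩; exact h.ne h1 (by omega) h3.symm)
      (by rintro ⟨t, h1, h2, h3⟩; exact h.ne h2 (by omega) h3)
      (by
        rintro _ rfl _ ⟨t, h1, h2, rfl⟩
        refine ⟨h.ne (by omega) (by omega), fun ha => ?_⟩
        have := hmax t ⟨by omega, h2, ha⟩
        omega)
      (.cons hck.symm (.cons hadj .nil)) (by simp) p (by
        intro z hz
        obtain ⟨t, h1, h2, rfl⟩ := hp z hz
        rcases h1.lt_or_eq with h1 | rfl
        · rcases h2.lt_or_eq with h2 | rfl
          · exact Or.inl ⟨t, h1, h2, rfl⟩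
          · exact Or.inr (Or.inr rfl)
        · exact Or.inr (Or.inl rfl))
    have e1 := hsub' k t hik.le h1 h2.le (by omega) h3.symm
    have e2 := hsub' t j (by omega) h2 le_rfl (by omega) h4
    have := e2.add_odd e1
    rw [sub_add_sub_cancel, ← Int.not_odd_iff_even] at this
    exact this hjk

end IsCycleParam

/-- A triangle on the vertices of an odd cycle that cuts it into three odd segments, the first of
which has length `l`. -/
structure IsOddTriangle (G : SimpleGraph V) (n : ℤ) (C : Finset V) (c : ℤ → V) (l t : ℤ) :
    Prop where
  isCycleParam : IsCycleParam G n C c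
  pos : 0 < l
  lt : l < t
  lt_length : t < n
  odd : Odd l
  even : Even t
  adj_zero_left : G.Adj (c 0) (c l)
  adj_left_right : G.Adj (c l) (c t)
  adj_right_zero : G.Adj (c t) (c 0)

/-- The vertices off the segment from `0` to `l` without neighbours in its interior. -/
def segmentExterior (G : SimpleGraph V) (c : ℤ → V) (l : ℤ) : Set V :=
  {z | (∀ m, 0 ≤ m → m ≤ l → c m ≠ z) ∧ ∀ m, 0 < m → m < l → ¬ G.Adj z (c m)}

lemma segmentExterior_reflect {G : SimpleGraph V} {c : ℤ → V} {l : ℤ} :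
    segmentExterior G (fun i => c (l - i)) l = segmentExterior G c l := by
  ext z
  constructor
  · rintro ⟨h1, h2⟩
    exact ⟨fun m a b => by simpa using h1 (l - m) (by omega) (by omega),
      fun m a b => by simpa using h2 (l - m) (by omega) (by omega)⟩
  · rintro ⟨h1, h2⟩
    exact ⟨fun m a b => h1 (l - m) (by omega) (by omega),
      fun m a b => h2 (l - m) (by omega) (by omega)⟩

lemma SimpleGraph.Walk.exists_first_exit {G : SimpleGraph V} {a y : V} (p : G.Walk a y) {K : Set V}
    (ha : a ∈ K) (hy : y ∉ K) :
    ∃ r ∈ p.support, r ∉ K ∧ ∃ d ∈ K, G.Adj r d ∧ ∃ q : G.Walk d a, ∀ z ∈ q.support, z ∈ K := by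
  induction p with
  | nil => exact absurd ha hy
  | cons h p ih =>
    rename_i u v w
    by_cases hv : v ∈ K
    · obtain ⟨r, h1, h2, d, h3, h4, q, h5⟩ := ih hv hy
      refine ⟨r, by simp [h1], h2, d, h3, h4, q.concat h.symm, fun z hz => ?_⟩
      rw [Walk.support_concat, List.mem_append, List.mem_singleton] at hz
      rcases hz with hz | rfl
      · exact h5 z hz
      · exact ha
    · exact ⟨v, by simp, hv, u, ha, h.symm, .nil, by simpa⟩

namespace IsOddTriangle

lemma reflect {G : SimpleGraph V} {n : ℤ} {C : Finset V} {c : ℤ → V} {l t : ℤ}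
    (hT : IsOddTriangle G n C c l t) (hn : Odd n) :
    IsOddTriangle G n C (fun i => c (l - i)) l (l - t + n) where
  isCycleParam := hT.isCycleParam.reflect l
  pos := hT.pos
  lt := by have := hT.lt_length; omega
  lt_length := by have := hT.lt; omega
  odd := hT.odd
  even := (hT.odd.sub_even hT.even).add_odd hn
  adj_zero_left := by simpa using hT.adj_zero_left.symm
  adj_left_right := by
    have := hT.isCycleParam.sub_period t
    rw [sub_self, (by ring : l - (l - t + n) = t - n), this]
    exact hT.adj_right_zero.symm
  adj_right_zero := by
    have := hT.isCycleParam.sub_period t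
    rw [sub_zero, (by ring : l - (l - t + n) = t - n), this]
    exact hT.adj_left_right.symm

variable [Fintype V] [DecidableEq V] {G : SimpleGraph V} {n : ℤ} {C : Finset V} {c : ℤ → V}
  {f : V → Sym2 V} {l t : ℤ}

lemma not_adj_of_even (ho : IsObstruction G n C) (hT : IsOddTriangle G n C c l t)
    (hmin : ∀ c' l' t', IsOddTriangle G n C c' l' t' → l ≤ l') {i j : ℤ} (hi : 0 ≤ i)
    (hij : i < j) (hj : j ≤ l) (he : Even (j - i)) : ¬ G.Adj (c i) (c j) := by
  intro ha
  have h1 := hT.lt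
  have h2 := hT.lt_length
  obtain ⟨i', k, j', e1, e2, e3, e4, e5, e6, e7, e8, e9⟩ :=
    hT.isCycleParam.exists_triangle ho.fiveChordal hij (by omega) he ha
  have := hmin _ (k - i') (j' - i') ⟨hT.isCycleParam.shift i', by omega, by omega, by omega, e5,
    by simpa using e6.add_odd e5, by simpa, by simpa, by simpa using e9.symm⟩
  omega

/-- In a triangle with minimal first segment, a vertex off this segment has no two neighbours
on it at odd distance, except possibly the two ends. -/
lemma not_adj_of_odd (ho : IsObstruction G n C) (hf : IsPairForest G (C : Set V)ᶜ f)
    (hT : IsOddTriangle G n C c l t)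
    (hmin : ∀ c' l' t', IsOddTriangle G n C c' l' t' → l ≤ l') {r : V}
    (hr : ∀ m, 0 ≤ m → m ≤ l → c m ≠ r) {i j : ℤ} (hi : 0 ≤ i) (hij : i < j) (hj : j ≤ l)
    (hlt : j - i < l) (hodd : Odd (j - i)) (hri : G.Adj r (c i)) : ¬ G.Adj r (c j) := by
  induction hm : (j - i).toNat using Nat.strong_induction_on generalizing i j with
  | _ m ih =>
    intro hrj
    have h1 := hT.lt
    have h2 := hT.lt_length
    have h := hT.isCycleParam
    by_cases hk : ∃ k, i < k ∧ k < j ∧ G.Adj r (c k)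
    · obtain ⟨k, hik, hkj, hrk⟩ := hk
      by_cases hp : Odd (k - i)
      · exact ih _ (by omega) hi hik (by omega) (by omega) hp hri rfl hrk
      · rw [Int.not_odd_iff_even] at hp
        have := hodd.sub_even hp
        rw [sub_sub_sub_cancel_right] at this
        exact ih _ (by omega) (by omega) hkj hj (by omega) this hrk rfl hrj
    push Not at hk
    by_cases hij' : G.Adj (c i) (c j)
    · by_cases hrC : r ∈ C
      · obtain ⟨ρ, e1, e2, rfl⟩ := h.exists_pos hrC 0
        have hlρ : l < ρ := by
          by_contra! hle
          exact hr ρ e1 hle rfl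
        by_cases hp : Even (ρ - i)
        · have := hmin _ (j - i) (ρ - i) ⟨h.shift i, by omega, by omega, by omega, hodd, hp,
            by simpa, by simpa using hrj.symm, by simpa⟩
          omega
        · rw [Int.not_even_iff_odd] at hp
          obtain ⟨D, hD⟩ := hf.exists_isDetour ho.not_adj {c i, c j, c ρ} ∅ (by simp) (by
            intro a ha b hb hab
            rw [coe_empty, Set.sdiff_empty]
            have adj_ij := ho.not_reachable_of_adj h hf hij'
            have adj_ri := ho.not_reachable_of_adj h hf hri
            have adj_rj := ho.not_reachable_of_adj h hf hrj
            simp only [mem_insert, mem_singleton] at ha hb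
            rcases ha with rfl | rfl | rfl <;> rcases hb with rfl | rfl | rfl <;>
              first
              | exact absurd rfl hab
              | assumption
              | exact fun hr => absurd hr.symm (by assumption))
          refine ho.not_prismHamiltonian ((h.shift i).prismHamiltonian_of_triangle ho.odd
            (j := j - i) (k := ρ - i) (by omega) (by omega) (by omega) hodd hp ?_ ?_ ?_ (D := D) ?_)
          · simpa
          · simpa using hrj.symm
          · simpa
          · simpa
      · exact ho.not_adj_of_adj h hf hrC hri hrj hij'
    · obtain ⟨p, hp⟩ := h.exists_walk hij.le
      obtain ⟨-, -, ⟨k, h1, h2, rfl⟩, h3, h4⟩ := ho.fiveChordal.exists_adj (h.ne hij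
        (by omega)) hij'
        (D₁ := {r}) (D₂ := {z | ∃ t, i < t ∧ t < j ∧ c t = z})
        (hr i hi (by omega)) (hr j (by omega) hj)
        (by rintro ⟨t, h1, h2, h3⟩; exact h.ne h1 (by omega) h3.symm)
        (by rintro ⟨t, h1, h2, h3⟩; exact h.ne h2 (by omega) h3)
        (by
          rintro _ rfl _ ⟨t, h1, h2, rfl⟩
          exact ⟨(hr t (by omega) (by omega)).symm, hk t h1 h2⟩)
        (.cons hri.symm (.cons hrj .nil)) (by simp) p (by
          intro z hz
          obtain ⟨t, h1, h2, rfl⟩ := hp z hz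
          rcases h1.lt_or_eq with h1 | rfl
          · rcases h2.lt_or_eq with h2 | rfl
            · exact Or.inl ⟨t, h1, h2, rfl⟩
            · exact Or.inr (Or.inr rfl)
          · exact Or.inr (Or.inl rfl))
      by_cases hp : Even (k - i)
      · exact hT.not_adj_of_even ho hmin hi h1 (by omega) hp h3.symm
      · rw [Int.not_even_iff_odd] at hp
        have := hodd.sub_odd hp
        rw [sub_sub_sub_cancel_right] at this
        exact hT.not_adj_of_even ho hmin (by omega) h2 hj this h4

lemma three_le (ho : IsObstruction G n C) (hf : IsPairForest G (C : Set V)ᶜ f)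
    (hT : IsOddTriangle G n C c l t) : 3 ≤ l := by
  by_contra! hl
  have h := hT.isCycleParam
  have h1 := hT.lt
  have h2 := hT.lt_length
  obtain rfl : l = 1 := by
    obtain ⟨k, hk⟩ := hT.odd
    have := hT.pos
    omega
  obtain ⟨D, hD⟩ := hf.exists_isDetour ho.not_adj {c t} ∅ (by simp) (by
    intro a ha b hb hab
    rw [mem_singleton] at ha hb
    exact absurd (ha.trans hb.symm) hab)
  have e0 := h.apply_period
  have e1 : c (1 + n) = c 1 := h.periodic 1
  refine ho.not_prismHamiltonian ((h.shift t).prismHamiltonian_of_adj_succ ho.odd (i := n - t)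
    (by omega) (ho.odd.sub_even hT.even) (by omega) ?_ ?_ (D := D) ?_)
  · simpa [e0] using hT.adj_right_zero
  · simpa [(by ring : n - t + 1 + t = 1 + n), e1] using hT.adj_left_right.symm
  · simpa

lemma not_adj_apex (ho : IsObstruction G n C) (hf : IsPairForest G (C : Set V)ᶜ f)
    (hT : IsOddTriangle G n C c l t)
    (hmin : ∀ c' l' t', IsOddTriangle G n C c' l' t' → l ≤ l') {m : ℤ} (h0 : 0 < m) (hm : m < l) :
    ¬ G.Adj (c t) (c m) := by
  have h1 := hT.lt
  have h2 := hT.lt_length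
  have hr : ∀ m, 0 ≤ m → m ≤ l → c m ≠ c t := fun m a b =>
    hT.isCycleParam.ne (by omega) (by omega)
  intro ha
  by_cases hp : Odd m
  · exact hT.not_adj_of_odd ho hf hmin hr le_rfl h0 hm.le (by omega) (by simpa) hT.adj_right_zero ha
  · rw [Int.not_odd_iff_even] at hp
    exact hT.not_adj_of_odd ho hf hmin hr h0.le hm le_rfl (by omega) (hT.odd.sub_even hp) ha
      hT.adj_left_right.symm

/-- A vertex bounding the exterior component of the apex and not adjacent to the end `c l` of the
first segment has a common neighbour with it inside this segment. -/
lemma exists_common_neighbor (ho : IsObstruction G n C)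
    (hT : IsOddTriangle G n C c l t)
    (hmin : ∀ c' l' t', IsOddTriangle G n C c' l' t' → l ≤ l') {r d : V}
    (hr : ∀ m, 0 ≤ m → m ≤ l → c m ≠ r) {m : ℤ} (h0 : 0 < m) (hm : m < l) (hrm : G.Adj r (c m))
    (hrd : G.Adj r d) (p : G.Walk d (c t)) (hp : ∀ z ∈ p.support, z ∈ segmentExterior G c l)
    (hrl : ¬ G.Adj r (c l)) : ∃ q, 0 < q ∧ q < l ∧ G.Adj (c q) r ∧ G.Adj (c q) (c l) := by
  have h := hT.isCycleParam
  have h1 := hT.lt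
  have h2 := hT.lt_length
  obtain ⟨w, hw⟩ := h.exists_walk hm.le
  obtain ⟨⟨_, ⟨q, e1, e2, rfl⟩, e3⟩, -⟩ := ho.fiveChordal.exists_adj
    (hr l (by omega) le_rfl).symm hrl (D₁ := {z | ∃ q, 0 < q ∧ q < l ∧ c q = z})
    (D₂ := segmentExterior G c l)
    (by rintro ⟨q, e1, e2, e3⟩; exact hr q e1.le e2.le e3)
    (by rintro ⟨q, e1, e2, e3⟩; exact h.ne e2 (by omega) e3)
    (fun hK => hK.2 m h0 hm hrm)
    (fun hK => hK.1 l (by omega) le_rfl rfl)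
    (by
      rintro _ ⟨q, e1, e2, rfl⟩ z hz
      exact ⟨hz.1 q e1.le e2.le, fun ha => hz.2 q e1 e2 ha.symm⟩)
    (.cons hrm w) (by
      intro z hz
      rcases List.mem_cons.1 hz with rfl | hz
      · exact Or.inr (Or.inl rfl)
      · obtain ⟨q, e1, e2, rfl⟩ := hw z hz
        rcases e2.lt_or_eq with e2 | rfl
        · exact Or.inl ⟨q, by omega, e2, rfl⟩
        · exact Or.inr (Or.inr rfl))
    (.cons hrd (p.concat hT.adj_left_right.symm)) (by
      intro z hz
      rcases List.mem_cons.1 hz with rfl | hz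
      · exact Or.inr (Or.inl rfl)
      · rw [Walk.support_concat, List.mem_append, List.mem_singleton] at hz
        rcases hz with hz | rfl
        · exact Or.inl (hp z hz)
        · exact Or.inr (Or.inr rfl))
  exact ⟨q, e1, e2, e3⟩

/-- The final configuration: a path `c 0, r, c q, c l` with `r` off the first segment and `c q`
inside it. -/
lemma not_adj_of_common_neighbor (ho : IsObstruction G n C) (hf : IsPairForest G (C : Set V)ᶜ f)
    (hT : IsOddTriangle G n C c l t)
    (hmin : ∀ c' l' t', IsOddTriangle G n C c' l' t' → l ≤ l') {r : V}
    (hr : ∀ m, 0 ≤ m → m ≤ l → c m ≠ r) {q : ℤ} (h0 : 0 < q) (hq : q < l)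
    (hqr : G.Adj (c q) r) (hql : G.Adj (c q) (c l)) : ¬ G.Adj r (c 0) := by
  intro hr0
  have h := hT.isCycleParam
  have h1 := hT.lt
  have h2 := hT.lt_length
  have hlq : Odd (l - q) := by
    rw [← Int.not_even_iff_odd]
    exact fun he => hT.not_adj_of_even ho hmin h0.le hq le_rfl he hql
  have hqe : Even q := by simpa using hT.odd.sub_odd hlq
  have hq0 : c q ≠ c 0 := (h.ne h0 (by omega)).symm
  have eperiod := h.apply_period
  have bq : ∀ {f}, IsPairForest G (C : Set V)ᶜ f →
      ¬ (pairGraph f (C : Set V)ᶜ).Reachable (c 0) (c q) := fun hf =>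
    ho.not_reachable_of_triangle h hf hT.pos hT.lt hT.lt_length hT.odd hT.even hT.adj_right_zero
      hT.adj_zero_left hT.adj_left_right hql hq0
  by_cases hrC : r ∈ C
  swap
  · have hb : ¬ (pairGraph f ((C : Set V)ᶜ \ {r})).Reachable (c 0) (c q) := fun hR =>
      bq hf (hR.mono (pairGraph_mono Set.sdiff_subset))
    exact bq (hf.update hrC hr0 hqr.symm hb) (pairGraph_reachable (x := r) hrC (by simp))
  obtain ⟨m, e1, e2, rfl⟩ := h.exists_pos hrC 0
  have hlm : l < m := by
    by_contra! hle
    exact hr m e1 hle rfl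
  have hmt : m ≠ t := by
    rintro rfl
    exact hT.not_adj_apex ho hf hmin h0 hq hqr.symm
  have adj : ∀ {u w}, G.Adj u w → ¬ (pairGraph f (C : Set V)ᶜ).Reachable u w :=
    fun ha => ho.not_reachable_of_adj h hf ha
  have adj_ab := adj hT.adj_right_zero
  have adj_bc := adj hT.adj_zero_left
  have adj_ca := adj hT.adj_left_right
  have adj_rb := adj hr0
  have adj_qr := adj hqr
  have adj_qc := adj hql
  have hbq := bq hf
  have hT' := hT.reflect ho.odd
  have hcr : ¬ (pairGraph f (C : Set V)ᶜ).Reachable (c l) (c m) := by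
    have := ho.not_reachable_of_triangle (w := c m) hT'.isCycleParam hf hT'.pos hT'.lt
      hT'.lt_length hT'.odd hT'.even hT'.adj_right_zero hT'.adj_zero_left hT'.adj_left_right
      (by simpa) (by simpa using (h.ne hlm (by omega)).symm)
    simpa using this
  have haq : ¬ (pairGraph f (C : Set V)ᶜ).Reachable (c t) (c q) := by
    have := ho.not_reachable_of_triangle (w := c q) (i := t - l) (j := t) (h.reflect t) hf
      (by omega) (by have := hT.pos; omega) h2 (hT.even.sub_odd hT.odd) hT.even
      (by simpa using hT.adj_right_zero.symm) (by simpa using hT.adj_left_right.symm)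
      (by simpa using hT.adj_zero_left.symm) (by simpa)
      (by simpa using h.ne (by omega) (by omega))
    simpa using this
  have har : ¬ (pairGraph f (C : Set V)ᶜ).Reachable (c t) (c m) := by
    have e3 : l + n - t + t = l + n := by ring
    have e4 := h.periodic l
    have := ho.not_reachable_of_triangle (w := c m) (i := n - t) (j := l + n - t) (h.shift t) hf
      (by omega) (by have := hT.pos; omega) (by omega) (ho.odd.sub_even hT.even)
      ((hT.odd.add_odd ho.odd).sub hT.even)
      (by simpa [e3, e4] using hT.adj_left_right) (by simpa [eperiod] using hT.adj_right_zero)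
      (by simpa [e3, e4, eperiod] using hT.adj_zero_left) (by simpa [eperiod])
      (by
        simp only [zero_add]
        rcases hmt.lt_or_gt with hlt | hlt
        · exact h.ne hlt (by omega)
        · exact (h.ne hlt (by omega)).symm)
    simpa using this
  obtain ⟨D, hD⟩ := hf.exists_isDetour ho.not_adj {c 0, c q, c l, c t, c m} ∅ (by simp) (by
    intro a ha b hb hne
    rw [coe_empty, Set.sdiff_empty]
    simp only [mem_insert, mem_singleton] at ha hb
    rcases ha with rfl | rfl | rfl | rfl | rfl <;> rcases hb with rfl | rfl | rfl | rfl | rfl <;>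
      first
      | exact absurd rfl hne
      | assumption
      | exact fun hr => absurd hr.symm (by assumption))
  exact ho.not_prismHamiltonian (h.prismHamiltonian_of_triangle_of_path ho.odd h0 hq hT.lt
    hT.lt_length hlm (by omega) hmt hqe hT.odd hT.even hT.adj_right_zero hT.adj_left_right hr0.symm
    hqr hql hD)

end IsOddTriangle

/-- A tough 5-chordal graph with an edge-dominating odd cycle is no obstruction. -/
lemma IsTough.not_isObstruction [Fintype V] [DecidableEq V] {G : SimpleGraph V} {ε : ℝ}
    (htough : IsTough (1 + ε) G) (hε : 0 < ε) {n : ℤ} {C : Finset V} {c : ℤ → V}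
    (h : IsCycleParam G n C c) {f : V → Sym2 V} (hf : IsPairForest G (C : Set V)ᶜ f) :
    ¬ IsObstruction G n C := by
  classical
  intro ho
  have hn3 := h.three_le
  obtain ⟨l, ⟨c, t, hT⟩, hmin⟩ : ∃ l, (∃ c t, IsOddTriangle G n C c l t) ∧
      ∀ l', (∃ c t, IsOddTriangle G n C c l' t) → l ≤ l' := by
    refine Int.exists_least_of_bdd ⟨0, fun l ⟨c, t, hT⟩ => hT.pos.le⟩ ?_
    have hadj : G.Adj (c 0) (c (n - 1)) := by
      have := h.adj (n - 1)
      rw [sub_add_cancel, h.apply_period] at this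
      exact this.symm
    obtain ⟨i, k, j, e1, e2, e3, e4, e5, e6, e7, e8, e9⟩ := h.exists_triangle ho.fiveChordal
      (by omega) (by omega) (by simpa using ho.odd.sub_odd odd_one) hadj
    exact ⟨k - i, _, j - i, h.shift i, by omega, by omega, by omega, e5,
      by simpa using e6.add_odd e5, by simpa, by simpa, by simpa using e9.symm⟩
  replace hmin : ∀ c' l' t', IsOddTriangle G n C c' l' t' → l ≤ l' :=
    fun c' l' t' hT' => hmin l' ⟨c', t', hT'⟩
  clear h
  have h := hT.isCycleParam
  have h1 := hT.lt
  have h2 := hT.lt_length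
  have hl := hT.three_le ho hf
  have hT' := hT.reflect ho.odd
  obtain ⟨p, hp0, hpl⟩ := htough.exists_walk_avoiding hε (a := c 0) (b := c l) (x := c t) (y := c 1)
    (h.ne (by omega) (by omega)).symm (h.ne h1 (by omega)).symm (h.ne (by omega) (by omega)).symm
    (h.ne (by omega) (by omega))
  obtain ⟨r, hrp, hrK, d, hdK, hrd, w, hw⟩ := p.exists_first_exit (K := segmentExterior G c l)
    ⟨fun m e1 e2 => h.ne (by omega) (by omega), fun m e1 e2 => hT.not_adj_apex ho hf hmin e1 e2⟩
    (fun hK => hK.1 1 (by omega) (by omega) rfl)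
  have hr : ∀ m, 0 ≤ m → m ≤ l → c m ≠ r := by
    rintro m e1 e2 rfl
    rcases e1.lt_or_eq with e1 | rfl
    · rcases e2.lt_or_eq with e2 | rfl
      · exact hdK.2 m e1 e2 hrd.symm
      · exact hpl hrp
    · exact hp0 hrp
  obtain ⟨m, hm0, hml, hrm⟩ : ∃ m, 0 < m ∧ m < l ∧ G.Adj r (c m) := by
    by_contra! hcon
    exact hrK ⟨hr, hcon⟩
  have hr' : ∀ m, 0 ≤ m → m ≤ l → c (l - m) ≠ r := fun m _ _ => hr _ (by omega) (by omega)
  have parity : ∀ i j, 0 ≤ i → i < j → j ≤ l → j - i < l → Odd (j - i) →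
      G.Adj r (c i) → ¬ G.Adj r (c j) :=
    fun i j a b c d e => hT.not_adj_of_odd ho hf hmin hr a b c d e
  have left : ¬ G.Adj r (c l) → ∃ q, 0 < q ∧ q < l ∧ G.Adj (c q) r ∧ G.Adj (c q) (c l) := fun hrl =>
    hT.exists_common_neighbor ho hmin hr hm0 hml hrm hrd w hw hrl
  have right : ¬ G.Adj r (c 0) → ∃ q, 0 < q ∧ q < l ∧ G.Adj (c (l - q)) r ∧
      G.Adj (c (l - q)) (c 0) := fun hr0 => by
    have e : l - (l - t + n) = t - n := by ring
    have := hT'.exists_common_neighbor ho hmin hr' (m := l - m) (by omega) (by omega)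
      (by simpa) hrd (w.copy rfl (by rw [e, h.sub_period]))
      (by rw [segmentExterior_reflect]; simpa using hw) (by simpa)
    simpa using this
  by_cases hr0 : G.Adj r (c 0)
  · by_cases hrl : G.Adj r (c l)
    · by_cases hp : Odd m
      · exact parity 0 m le_rfl hm0 hml.le (by omega) (by simpa) hr0 hrm
      · rw [Int.not_odd_iff_even] at hp
        exact parity m l hm0.le hml le_rfl (by omega) (hT.odd.sub_even hp) hrm hrl
    · obtain ⟨q, e1, e2, e3, e4⟩ := left hrl
      exact hT.not_adj_of_common_neighbor ho hf hmin hr e1 e2 e3 e4 hr0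
  · obtain ⟨q', d1, d2, d3, d4⟩ := right hr0
    by_cases hrl : G.Adj r (c l)
    · exact hT'.not_adj_of_common_neighbor ho hf hmin hr' d1 d2 d3 (by simpa) (by simpa)
    · obtain ⟨q, e1, e2, e3, e4⟩ := left hrl
      have o1 : Odd (l - q) := by
        rw [← Int.not_even_iff_odd]
        exact fun he => hT.not_adj_of_even ho hmin e1.le e2 le_rfl he e4
      have o2 : Odd (l - q') := by
        rw [← Int.not_even_iff_odd]
        exact fun he => hT.not_adj_of_even ho hmin le_rfl (j := l - q') (by omega) (by omega)
          (by simpa) d4.symm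
      have o3 : Even q := by simpa using hT.odd.sub_odd o1
      have hne : q ≠ l - q' := by
        rintro rfl
        exact (Int.not_even_iff_odd.2 o2) o3
      rcases hne.lt_or_gt with hlt | hlt
      · exact parity q (l - q') e1.le hlt (by omega) (by omega) (o2.sub_even o3) e3.symm d3.symm
      · exact parity (l - q') q (by omega) hlt e2.le (by omega) (o3.sub_odd o2) d3.symm e3.symm

/-- Every `(1+ε)`-tough 5-chordal graph containing an edge-dominating cycle is
prism-Hamiltonian. -/
theorem prism_hamiltonian_of_tough_fiveChordal_edgeDominatingCycle
    [Fintype V] [DecidableEq V] (ε : ℝ) (hε : 0 < ε) (G : SimpleGraph V)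
    (htough : IsTough (1 + ε) G) (hchordal : FiveChordal G)
    (hdom : ∃ (u : V) (c : G.Walk u u), c.IsCycle ∧ IsEdgeDominating G c) :
    PrismHamiltonian G := by
  classical
  obtain ⟨u, p, hp, hd⟩ := hdom
  obtain ⟨c, h⟩ := hp.exists_isCycleParam
  set C := p.support.toFinset with hC
  have hI : ∀ x ∉ C, ∀ y ∉ C, ¬ G.Adj x y := fun x hx y hy =>
    hd x y (by simpa [hC] using hx) (by simpa [hC] using hy)
  have hNC : ∀ x ∉ C, G.neighborFinset x ⊆ C := fun x hx y hy => by
    by_contra hyC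
    exact hI x hx y hyC (by simpa using hy)
  have hC3 : 3 ≤ #C := by
    have := hp.three_le_length
    have hs := hp.support_nodup
    have : #p.support.tail.toFinset = p.length := by
      rw [List.toFinset_card_of_nodup hs, List.length_tail, Walk.length_support]
      omega
    have : #p.support.tail.toFinset ≤ #C :=
      card_le_card fun x hx => by
        rw [hC]
        simp only [List.mem_toFinset] at hx ⊢
        exact List.mem_of_mem_tail hx
    omega
  obtain ⟨f, hf⟩ := exists_isPairForest_of_hall G Cᶜ (fun x => G.neighborFinset x)
    (fun x _ y hy => by simpa using hy) (fun T hT hne => by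
      refine htough.card_succ_le hε hC3 hne ?_ fun x hx => hNC x (by simpa using hT hx)
      rw [Finset.disjoint_right]
      exact fun x hx => by simpa using hT hx)
  rw [coe_compl] at hf
  rcases Int.even_or_odd (p.length : ℤ) with he | hodd
  · obtain ⟨D, hD⟩ := hf.exists_isDetour hI ∅ ∅ (by simp) (by simp)
    exact h.prismHamiltonian_of_even hD he
  · by_contra hnot
    exact htough.not_isObstruction hε h hf ⟨hchordal, hnot, hodd, hI⟩
end

section
/- Let ε > 0 and let G be a finite (1+ε)-tough graph. If G contains an edge-dominating cycle C with an even number of vertices, then the prism over G is Hamiltonian. -/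
open SimpleGraph Finset

variable {V : Type*}

namespace SimpleGraph

/-- Joining two paths with disjoint supports by an edge gives a path. -/
lemma Walk.IsPath.append_cons {W : Type*} {H : SimpleGraph W} {a b c d : W}
    {p : H.Walk a b} {q : H.Walk c d} (hp : p.IsPath) (hq : q.IsPath) (h : H.Adj b c)
    (hd : p.support.Disjoint q.support) : (p.append (.cons h q)).IsPath := by
  rw [Walk.isPath_def, Walk.support_append, Walk.support_cons, List.tail_cons]
  exact hp.support_nodup.append hq.support_nodup hd

/-- A Hamiltonian path with adjacent ends, in a graph on more than two vertices, closes up to a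
Hamiltonian cycle. -/
lemma Walk.IsHamiltonian.isHamiltonianCycle_cons {W : Type*} [Fintype W] [DecidableEq W]
    {H : SimpleGraph W} {a b : W} {p : H.Walk a b} (hp : p.IsHamiltonian) (h : H.Adj b a)
    (hW : 2 < Fintype.card W) : (Walk.cons h p).IsHamiltonianCycle := by
  rw [Walk.isHamiltonianCycle_iff_isCycle_and_support_count_tail_eq_one, Walk.cons_isCycle_iff]
  refine ⟨⟨hp.isPath, fun he ↦ ?_⟩, by simpa [Walk.IsHamiltonian] using hp⟩
  have h₁ := hp.isPath.length_eq_one_of_mem_edges (Sym2.eq_swap ▸ he)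
  have h₂ := hp.length_eq
  omega

/-- Let `r` be a map such that the prism over the fibre of `r` at `a` is traversed by a path from
`(a, i)` to `(a, i + 1)`, for every vertex `a` of a path `p`. Then these paths can be concatenated
along `p`, the layer changing at each vertex of `p`. -/
lemma exists_prism_path_of_fibre_paths {G : SimpleGraph V} (r : V → V) {a b : V} (p : G.Walk a b)
    (hp : p.IsPath)
    (hr : ∀ x ∈ p.support, ∀ i : Fin 2,
      ∃ q : (G □ (⊤ : SimpleGraph (Fin 2))).Walk (x, i) (x, i + 1),
        q.IsPath ∧ ∀ z, z ∈ q.support ↔ r z.1 = x)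
    (i j : Fin 2) (hij : i = j ↔ Even (p.length + 1)) :
    ∃ q : (G □ (⊤ : SimpleGraph (Fin 2))).Walk (a, i) (b, j),
      q.IsPath ∧ ∀ z, z ∈ q.support ↔ r z.1 ∈ p.support := by
  induction p generalizing i with
  | nil =>
    obtain rfl : j = i + 1 := by
      simp at hij
      omega
    simpa using hr _ (by simp) i
  | @cons a x b h p ih =>
    rw [Walk.cons_isPath_iff] at hp
    obtain ⟨q₁, hq₁, hs₁⟩ := hr a (by simp) i
    obtain ⟨q₂, hq₂, hs₂⟩ := ih hp.1 (fun y hy ↦ hr y (by simp [hy])) (i + 1) (by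
      rw [Walk.length_cons, Nat.even_add_one] at hij
      by_cases he : Even (p.length + 1) <;> simp only [he, iff_true, iff_false] at hij ⊢ <;>
        simp at hij <;> omega)
    have hadj : (G □ (⊤ : SimpleGraph (Fin 2))).Adj (a, i + 1) (x, i + 1) := by simpa using h
    refine ⟨q₁.append (.cons hadj q₂), hq₁.append_cons hq₂ hadj fun z h₁ h₂ ↦ ?_, fun z ↦ ?_⟩
    · rw [hs₁] at h₁
      rw [hs₂, h₁] at h₂
      exact hp.2 h₂
    · simp [Walk.support_append, hs₁, hs₂]

/-- If the fibre of `r` at `x` consists of `x` and at most one further vertex, which is adjacent to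
`x`, then the prism over this fibre is traversed by a path between the two copies of `x`. -/
lemma exists_prism_path_over_fibre {G : SimpleGraph V} (r : V → V) (x : V)
    (hx : r x = x) (hadj : ∀ v, v ≠ x → r v = x → G.Adj v x)
    (hinj : ∀ v w, v ≠ x → w ≠ x → r v = x → r w = x → v = w) (i : Fin 2) :
    ∃ q : (G □ (⊤ : SimpleGraph (Fin 2))).Walk (x, i) (x, i + 1),
      q.IsPath ∧ ∀ z, z ∈ q.support ↔ r z.1 = x := by
  have hi : i ≠ i + 1 := by omega
  have hfin (k : Fin 2) : k = i ∨ k = i + 1 := by omega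
  have hvert (y : V) : (G □ (⊤ : SimpleGraph (Fin 2))).Adj (y, i) (y, i + 1) := by
    simp
  generalize i + 1 = i' at hi hfin hvert ⊢
  by_cases hv : ∃ v, v ≠ x ∧ r v = x
  · obtain ⟨v, hvx, hv⟩ := hv
    have h₁ : (G □ (⊤ : SimpleGraph (Fin 2))).Adj (x, i) (v, i) := by
      simpa using (hadj v hvx hv).symm
    have h₂ : (G □ (⊤ : SimpleGraph (Fin 2))).Adj (v, i') (x, i') := by
      simpa using hadj v hvx hv
    refine ⟨.cons h₁ (.cons (hvert v) (.cons h₂ .nil)), ?_, ?_⟩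
    · simp [Walk.isPath_def, hvx, hvx.symm, hi]
    · rintro ⟨y, k⟩
      have := hfin k
      have := hinj y v
      simp only [Walk.support_cons, Walk.support_nil, List.mem_cons, Prod.mk.injEq,
        List.not_mem_nil, or_false]
      grind
  · refine ⟨.cons (hvert x) .nil, by simp [Walk.isPath_def, hi], ?_⟩
    rintro ⟨y, k⟩
    have := hfin k
    simp only [Walk.support_cons, Walk.support_nil, List.mem_cons, Prod.mk.injEq,
      List.not_mem_nil, or_false]
    grind

/-- A vertex reachable from an isolated vertex is that vertex. -/
lemma Reachable.eq_of_forall_not_adj {W : Type*} {H : SimpleGraph W} {a b : W}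
    (h : H.Reachable a b) (ha : ∀ x, ¬ H.Adj a x) : a = b := by
  obtain ⟨p⟩ := h
  cases p with
  | nil => rfl
  | cons h _ => exact (ha _ h).elim

end SimpleGraph

/-- In a `1`-tough graph, every independent set `{v | P v}` other than the whole vertex set can be
matched into its complement. -/
lemma IsTough.exists_injective_adj [Fintype V] {β : ℝ} (hβ : 1 ≤ β) {G : SimpleGraph V}
    (hG : IsTough β G) {P : V → Prop} (hP : ∀ x y, P x → P y → ¬ G.Adj x y) {u : V} (hu : ¬ P u) :
    ∃ f : {v // P v} → V, Function.Injective f ∧ ∀ v : {v // P v}, G.Adj v (f v) := by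
  classical
  refine (Fintype.all_card_le_filter_rel_iff_exists_injective
    fun (v : {v // P v}) (w : V) ↦ G.Adj v w).mp fun A ↦ ?_
  set N : Finset V := {w | ∃ a ∈ A, G.Adj a w} with hN
  have hmem (a : {v // P v}) : (a : V) ∈ ((N : Set V)ᶜ) := by
    simpa [hN] using fun x hx _ ↦ hP x a hx a.2
  have hiso (a : {v // P v}) (ha : a ∈ A) (x) :
      ¬ (G.induce ((N : Set V)ᶜ)).Adj ⟨a, hmem a⟩ x := fun hax ↦
    x.2 <| by simpa [hN] using ⟨a.1, ⟨a.2, ha⟩, hax⟩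
  set K := Nat.card (G.induce ((N : Set V)ᶜ)).ConnectedComponent with hK
  have hAK : #A ≤ K := by
    rw [hK, ← Fintype.card_coe, ← Nat.card_eq_fintype_card]
    refine Nat.card_le_card_of_injective
      (fun a : A ↦ (G.induce ((N : Set V)ᶜ)).connectedComponentMk ⟨a.1, hmem a⟩) fun a b hab ↦ ?_
    have := (ConnectedComponent.exact hab).eq_of_forall_not_adj (hiso a a.2)
    exact Subtype.ext (Subtype.ext (by simpa only [Subtype.mk.injEq] using this))
  by_cases hK2 : 2 ≤ K
  · have h₁ := hG N hK2
    have h₂ : (K : ℝ) ≤ #N := (le_mul_of_one_le_left (Nat.cast_nonneg K) hβ).trans h₁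
    exact hAK.trans (by exact_mod_cast h₂)
  · by_contra! hlt
    obtain ⟨a, ha⟩ : A.Nonempty := card_pos.mp (by omega)
    have hN0 : N = ∅ := card_eq_zero.mp (by omega)
    have hu' : u ∈ ((N : Set V)ᶜ) := by simp [hN0]
    refine hK2 (Finite.one_lt_card_iff_nontrivial.mpr ⟨⟨
      (G.induce ((N : Set V)ᶜ)).connectedComponentMk ⟨a, hmem a⟩,
      (G.induce ((N : Set V)ᶜ)).connectedComponentMk ⟨u, hu'⟩, fun h ↦ ?_⟩⟩)
    have := (ConnectedComponent.exact h).eq_of_forall_not_adj (hiso a ha)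
    simp only [Subtype.mk.injEq] at this
    exact hu (this ▸ a.2)

/-- If a `(1+ε)`-tough graph contains an edge-dominating cycle with an even number
of vertices, then its prism is Hamiltonian. -/
theorem prism_hamiltonian_of_tough_even_edgeDominatingCycle
    [Fintype V] [DecidableEq V] (ε : ℝ) (hε : 0 < ε) (G : SimpleGraph V)
    (htough : IsTough (1 + ε) G)
    (u : V) (c : G.Walk u u) (hc : c.IsCycle) (hdom : IsEdgeDominating G c)
    (heven : Even c.length) :
    PrismHamiltonian G := by
  classical
  obtain ⟨f, hf, hfadj⟩ := htough.exists_injective_adj (by linarith) (P := fun v ↦ v ∉ c.support)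
    hdom (u := u) (by simp)
  have hfc (v) : f v ∈ c.support := by
    by_contra h
    exact hdom v (f v) v.2 h (hfadj v)
  set r : V → V := fun v ↦ if h : v ∈ c.support then v else f ⟨v, h⟩ with hr
  have hmem (v : V) : v ∈ c.tail.support ↔ v ∈ c.support := by
    rw [← Walk.cons_support_tail hc.not_nil, List.mem_cons]
    exact ⟨.inr, by rintro (rfl | h); exacts [c.tail.end_mem_support, h]⟩
  have hrc (v : V) : r v ∈ c.tail.support := by
    rw [hmem]
    by_cases h : v ∈ c.support <;> simp [hr, h, hfc]
  have hlen := Walk.length_tail_add_one hc.not_nil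
  obtain ⟨q, hq, hqs⟩ := exists_prism_path_of_fibre_paths r c.tail hc.isPath_tail
    (fun x hx ↦ exists_prism_path_over_fibre r x (by simp [hr, (hmem x).mp hx])
      (by grind) fun v w hv hw hvx hwx ↦ by
        have hv' : v ∉ c.support := by grind
        have hw' : w ∉ c.support := by grind
        simp only [hr, hv', hw', dite_false] at hvx hwx
        exact congrArg Subtype.val (hf (hvx.trans hwx.symm)))
    0 0 (by rw [hlen]; simpa using heven)
  have hadj := c.adj_snd hc.not_nil
  have hcard : 1 < Fintype.card V := Fintype.one_lt_card_iff.mpr ⟨_, _, hadj.ne⟩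
  refine fun _ ↦ ⟨_, _, (hq.isHamiltonian_of_mem fun z ↦
    (hqs z).mpr (hrc z.1)).isHamiltonianCycle_cons (by simpa using hadj) ?_⟩
  simp
  omega
end

section
/- Let ε > 0 and let G be a finite (1+ε)-tough graph. Suppose G contains an edge-dominating cycle C = v₁v₂⋯v_{2p+1}v₁ of odd length, and there exists an index q with 1 ≤ q ≤ p such that the three vertices v₁, v_{2q}, v_{2q+1} induce a triangle in G (i.e., they are pairwise adjacent). Then the prism over G is Hamiltonian. -/
open SimpleGraph Finset

variable {V : Type*}

namespace SimpleGraph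

section Walks

variable {W : Type*} {H : SimpleGraph W}

/-- Two vertex-disjoint paths joined by an edge form a path. -/
theorem Walk.IsPath.append_cons_s2 {a b c d : W} {P : H.Walk a b} {Q : H.Walk c d}
    (hP : P.IsPath) (hQ : Q.IsPath) (h : H.Adj b c) (hd : P.support.Disjoint Q.support) :
    (P.append (Walk.cons h Q)).IsPath := by
  rw [Walk.isPath_def, Walk.support_append, Walk.support_cons, List.tail_cons]
  exact List.nodup_append'.2 ⟨hP.support_nodup, hQ.support_nodup, hd⟩

theorem Walk.mem_support_append_cons {a b c d : W} (P : H.Walk a b) (Q : H.Walk c d)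
    (h : H.Adj b c) (w : W) :
    w ∈ (P.append (Walk.cons h Q)).support ↔ w ∈ P.support ∨ w ∈ Q.support := by
  rw [Walk.support_append, Walk.support_cons, List.tail_cons, List.mem_append]

/-- A nontrivial path missing exactly one vertex `z` adjacent to both of its ends
closes up to a Hamiltonian cycle. -/
theorem Walk.IsPath.isHamiltonian_of_missing_vertex [Fintype W] [DecidableEq W] {s t z : W}
    {P : H.Walk s t} (hP : P.IsPath) (hst : s ≠ t) (hz : z ∉ P.support)
    (hzs : H.Adj z s) (htz : H.Adj t z) (hall : ∀ w, w ≠ z → w ∈ P.support) :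
    H.IsHamiltonian := by
  intro _
  refine ⟨z, Walk.cons hzs (P.concat htz),
    Walk.isHamiltonianCycle_iff_isCycle_and_support_count_tail_eq_one.2 ⟨?_, ?_⟩⟩
  · rw [Walk.cons_isCycle_iff]
    refine ⟨hP.concat hz htz, ?_⟩
    rw [Walk.edges_concat, List.concat_eq_append, List.mem_append, List.mem_singleton]
    rintro (h | h)
    · exact hz (P.fst_mem_support_of_mem_edges h)
    · rw [Sym2.eq_iff] at h
      rcases h with h | h
      · exact htz.ne h.1.symm
      · exact hst h.2
  · intro w
    rw [Walk.support_cons, List.tail_cons]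
    refine (hP.concat hz htz).isHamiltonian_of_mem (fun w => ?_) w
    rw [Walk.support_concat, List.mem_append, List.mem_singleton]
    by_cases h : w = z
    · exact Or.inr h
    · exact Or.inl (hall w h)

end Walks

section Prism

variable {G : SimpleGraph V}

/-- A path in the prism over `G` running between the two copies of `v` through exactly the fibre
of `f` over `v`, provided that this fibre consists of `v` and at most one neighbour of `v`. -/
theorem exists_prism_path_fiber {f : V → V} {v : V} (hv : f v = v)
    (hadj : ∀ x, f x = v → x ≠ v → G.Adj v x)
    (huniq : ∀ x y, f x = v → f y = v → x ≠ v → y ≠ v → x = y) (a : Fin 2) :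
    ∃ P : (G □ (⊤ : SimpleGraph (Fin 2))).Walk (v, a) (v, a + 1), P.IsPath ∧
      ∀ z, z ∈ P.support ↔ f z.1 = v := by
  have ha : a ≠ a + 1 := by revert a; decide
  have hcases : ∀ b : Fin 2, b = a ∨ b = a + 1 := by revert a; decide
  by_cases hx : ∃ x, f x = v ∧ x ≠ v
  · obtain ⟨x, hfx, hxv⟩ := hx
    have h₁ : (G □ (⊤ : SimpleGraph (Fin 2))).Adj (v, a) (x, a) := by
      simpa using hadj x hfx hxv
    have h₂ : (G □ (⊤ : SimpleGraph (Fin 2))).Adj (x, a) (x, a + 1) := by simp [ha]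
    have h₃ : (G □ (⊤ : SimpleGraph (Fin 2))).Adj (x, a + 1) (v, a + 1) := by
      simpa using (hadj x hfx hxv).symm
    refine ⟨.cons h₁ (.cons h₂ (.cons h₃ .nil)), ?_, ?_⟩
    · simp [Walk.isPath_def, ha, hxv, hxv.symm]
    · rintro ⟨y, b⟩
      simp only [Walk.support_cons, Walk.support_nil, List.mem_cons, List.not_mem_nil, or_false,
        Prod.mk.injEq]
      constructor
      · rintro (h | h | h | h) <;> simp [h.1, hfx, hv]
      · intro h
        by_cases hyv : y = v
        · rcases hcases b with hb | hb <;> simp [hb, hyv]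
        · rcases hcases b with hb | hb <;> simp [hb, huniq y x h hfx hyv hxv]
  · push Not at hx
    have h₁ : (G □ (⊤ : SimpleGraph (Fin 2))).Adj (v, a) (v, a + 1) := by simp [ha]
    refine ⟨.cons h₁ .nil, ?_, ?_⟩
    · simp [Walk.isPath_def, ha]
    · rintro ⟨y, b⟩
      simp only [Walk.support_cons, Walk.support_nil, List.mem_cons, List.not_mem_nil, or_false,
        Prod.mk.injEq]
      constructor
      · rintro (h | h) <;> simp [h.1, hv]
      · intro h
        rcases hcases b with hb | hb <;> simp [hb, hx y h]

theorem _root_.Fin.ofNat_two_succ (n : ℕ) : Fin.ofNat 2 (n + 1) = Fin.ofNat 2 n + 1 :=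
  Fin.ext (Nat.add_mod n 1 2)

/-- Concatenation of the fibre paths along a sequence of consecutively adjacent vertices
`g i, …, g j`. -/
theorem exists_prism_path_Icc {f : V → V} {g : ℕ → V} {i j : ℕ} (hij : i ≤ j)
    (hinj : Set.InjOn g (Set.Icc i j)) (hg : ∀ k, i ≤ k → k < j → G.Adj (g k) (g (k + 1)))
    (hfib : ∀ k, i ≤ k → k ≤ j → ∀ a : Fin 2,
      ∃ P : (G □ (⊤ : SimpleGraph (Fin 2))).Walk (g k, a) (g k, a + 1), P.IsPath ∧
        ∀ z, z ∈ P.support ↔ f z.1 = g k) :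
    ∃ P : (G □ (⊤ : SimpleGraph (Fin 2))).Walk (g i, Fin.ofNat 2 i + 1) (g j, Fin.ofNat 2 j),
      P.IsPath ∧ ∀ z, z ∈ P.support ↔ ∃ k, i ≤ k ∧ k ≤ j ∧ f z.1 = g k := by
  have htwo : ∀ a : Fin 2, a + 1 + 1 = a := by decide
  induction j, hij using Nat.le_induction with
  | base =>
    have h := hfib i le_rfl le_rfl (Fin.ofNat 2 i + 1)
    rw [htwo] at h
    obtain ⟨P, hP, hPs⟩ := h
    refine ⟨P, hP, fun z => (hPs z).trans ⟨fun h => ⟨i, le_rfl, le_rfl, h⟩, ?_⟩⟩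
    rintro ⟨k, h₁, h₂, h⟩
    rwa [h₂.antisymm h₁] at h
  | succ j hij ih =>
    obtain ⟨P, hP, hPs⟩ := ih (hinj.mono (Set.Icc_subset_Icc_right j.le_succ))
      (fun k h₁ h₂ => hg k h₁ (by lia)) (fun k h₁ h₂ => hfib k h₁ (by lia))
    obtain ⟨Q, hQ, hQs⟩ := hfib (j + 1) (by lia) le_rfl (Fin.ofNat 2 j)
    have hadj : (G □ (⊤ : SimpleGraph (Fin 2))).Adj (g j, Fin.ofNat 2 j) (g (j + 1), Fin.ofNat 2 j) := by
      simpa using hg j hij j.lt_succ_self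
    rw [Fin.ofNat_two_succ]
    refine ⟨P.append (.cons hadj Q), hP.append_cons_s2 hQ hadj ?_, fun z => ?_⟩
    · intro z hzP hzQ
      obtain ⟨k, hk₁, hk₂, hk⟩ := (hPs z).1 hzP
      have := hinj ⟨hk₁, by lia⟩ ⟨by lia, le_rfl⟩ (hk.symm.trans ((hQs z).1 hzQ))
      lia
    · rw [Walk.mem_support_append_cons, hPs, hQs]
      constructor
      · rintro (⟨k, h₁, h₂, h⟩ | h)
        · exact ⟨k, h₁, by lia, h⟩
        · exact ⟨j + 1, by lia, le_rfl, h⟩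
      · rintro ⟨k, h₁, h₂, h⟩
        rcases h₂.lt_or_eq with h₂ | rfl
        · exact Or.inl ⟨k, h₁, by lia, h⟩
        · exact Or.inr h

end Prism

end SimpleGraph

/-- In a more than `1`-tough graph, a nonempty independent set `A` has more neighbours than
elements, as soon as at least two vertices are outside `A`. -/
theorem IsTough.card_lt_card_biUnion_neighborFinset [Fintype V] [DecidableEq V] {ε : ℝ}
    (hε : 0 < ε) {G : SimpleGraph V} [DecidableRel G.Adj] (htough : IsTough (1 + ε) G)
    {A : Finset V} (hA : A.Nonempty) (hind : G.IsIndepSet (A : Set V)) (hcompl : 2 ≤ #Aᶜ) :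
    #A < #(A.biUnion fun x => G.neighborFinset x) := by
  set S := A.biUnion fun x => G.neighborFinset x with hS
  have hmem : ∀ x ∈ A, x ∈ ((S : Set V)ᶜ) := by
    intro x hx hxS
    obtain ⟨y, hy, hyx⟩ := Finset.mem_biUnion.1 (Finset.mem_coe.1 hxS)
    rw [mem_neighborFinset] at hyx
    exact hind hy hx hyx.ne hyx
  have hisol : ∀ (x : ((S : Set V)ᶜ : Set V)), x.1 ∈ A →
      ∀ y, (G.induce ((S : Set V)ᶜ)).Reachable x y → x = y := by
    rintro x hx y ⟨w⟩
    cases w with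
    | nil => rfl
    | @cons _ z _ h _ =>
      have hz : z.1 ∈ S := Finset.mem_biUnion.2 ⟨x.1, hx, (mem_neighborFinset G _ _).2 h⟩
      exact absurd (Finset.mem_coe.2 hz) z.2
  let φ : A → (G.induce ((S : Set V)ᶜ)).ConnectedComponent :=
    fun x => (G.induce ((S : Set V)ᶜ)).connectedComponentMk ⟨x.1, hmem x.1 x.2⟩
  have hφ : Function.Injective φ := by
    intro x y hxy
    have := hisol ⟨x.1, hmem x.1 x.2⟩ x.2 _ (ConnectedComponent.exact hxy)
    exact Subtype.ext (congrArg (fun z => z.1) this)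
  have hle : #A ≤ Nat.card (G.induce ((S : Set V)ᶜ)).ConnectedComponent := by
    simpa using Nat.card_le_card_of_injective φ hφ
  by_cases hk : 2 ≤ Nat.card (G.induce ((S : Set V)ᶜ)).ConnectedComponent
  · have h := htough S hk
    have hpos : (0 : ℝ) < Nat.card (G.induce ((S : Set V)ᶜ)).ConnectedComponent := by
      exact_mod_cast (by lia : 0 < Nat.card (G.induce ((S : Set V)ᶜ)).ConnectedComponent)
    have hlt : (Nat.card (G.induce ((S : Set V)ᶜ)).ConnectedComponent : ℝ) < #S := by nlinarith
    exact hle.trans_lt (by exact_mod_cast hlt)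
  · obtain ⟨x, hx⟩ := hA
    have hsub : Subsingleton (G.induce ((S : Set V)ᶜ)).ConnectedComponent :=
      Finite.card_le_one_iff_subsingleton.1 (by lia)
    have hsubset : Aᶜ ⊆ S := by
      intro y hy
      by_contra hyS
      have := hisol ⟨x, hmem x hx⟩ hx ⟨y, hyS⟩ (ConnectedComponent.exact (Subsingleton.elim _ _))
      obtain rfl : x = y := congrArg (fun z => z.1) this
      exact (Finset.mem_compl.1 hy) hx
    have := Finset.card_le_card hsubset
    lia

/-- In a more than `1`-tough graph, every independent set `I` missing at least two vertices can be
matched into the complement of any prescribed vertex. -/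
theorem IsTough.exists_matching_avoiding [Fintype V] [DecidableEq V] {ε : ℝ}
    (hε : 0 < ε) {G : SimpleGraph V} (htough : IsTough (1 + ε) G)
    {I : Set V} (hind : G.IsIndepSet I) {a b : V} (ha : a ∉ I) (hb : b ∉ I) (hab : a ≠ b) (v : V) :
    ∃ m : I → V, Function.Injective m ∧ ∀ x : I, G.Adj x (m x) ∧ m x ≠ v := by
  classical
  obtain ⟨m, hm, hmem⟩ := (Finset.all_card_le_biUnion_card_iff_exists_injective
    (fun x : I => (G.neighborFinset x).erase v)).1 (by
      intro A
      rcases A.eq_empty_or_nonempty with rfl | hA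
      · simp
      set B : Finset V := A.map (Function.Embedding.subtype _) with hB
      have hBI : ∀ x ∈ B, x ∈ I := by
        intro x hx
        obtain ⟨y, -, rfl⟩ := Finset.mem_map.1 hx
        exact y.2
      have hcard := htough.card_lt_card_biUnion_neighborFinset hε (A := B) (by simpa [hB] using hA)
        (hind.mono hBI) (Finset.one_lt_card.2 ⟨a, Finset.mem_compl.2 (fun h => ha (hBI a h)),
          b, Finset.mem_compl.2 (fun h => hb (hBI b h)), hab⟩)
      have heq : (A.biUnion fun x : I => (G.neighborFinset x).erase v) =
          (B.biUnion fun x => G.neighborFinset x).erase v := by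
        rw [Finset.erase_biUnion, hB, Finset.map_eq_image, Finset.image_biUnion]
        rfl
      have := Finset.pred_card_le_card_erase (a := v) (s := B.biUnion fun x => G.neighborFinset x)
      rw [heq]
      rw [hB, Finset.card_map] at hcard
      lia)
  exact ⟨m, hm, fun x => by simpa [and_comm] using hmem x⟩

/-- If a `(1+ε)`-tough graph contains an edge-dominating cycle
`C = v₁v₂⋯v_{2p+1}v₁` of odd length such that for some `1 ≤ q ≤ p` the vertices
`v₁`, `v_{2q}`, `v_{2q+1}` induce a triangle, then its prism is Hamiltonian.
Here `vᵢ = c.getVert (i - 1)`. -/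
theorem prism_hamiltonian_of_tough_odd_edgeDominatingCycle_triangle
    [Fintype V] [DecidableEq V] (ε : ℝ) (hε : 0 < ε) (G : SimpleGraph V)
    (htough : IsTough (1 + ε) G)
    (u : V) (c : G.Walk u u) (hc : c.IsCycle) (hdom : IsEdgeDominating G c)
    (p : ℕ) (hlen : c.length = 2 * p + 1)
    (q : ℕ) (hq1 : 1 ≤ q) (hq2 : q ≤ p)
    (htri₁ : G.Adj (c.getVert 0) (c.getVert (2 * q - 1)))
    (htri₂ : G.Adj (c.getVert (2 * q - 1)) (c.getVert (2 * q)))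
    (htri₃ : G.Adj (c.getVert 0) (c.getVert (2 * q))) :
    PrismHamiltonian G := by
  classical
  set g := c.getVert with hg
  have hg0 : g 0 = u := c.getVert_zero
  have hgmem : ∀ k, g k ∈ c.support := fun k => c.getVert_mem_support k
  have hinj : Set.InjOn g (Set.Icc 0 (2 * p)) := by
    intro i hi j hj hij
    exact hc.getVert_injOn' (by simpa [hlen] using hi.2) (by simpa [hlen] using hj.2) hij
  have hadj : ∀ k, k < 2 * p + 1 → G.Adj (g k) (g (k + 1)) := fun k hk =>
    c.adj_getVert_succ (by lia)
  have hlast : g (2 * p + 1) = g 0 := by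
    rw [hg0, ← hlen]
    exact c.getVert_length
  have hcover : ∀ x ∈ c.support, ∃ k ≤ 2 * p, x = g k := by
    intro x hx
    obtain ⟨k, rfl, hk⟩ := Walk.mem_support_iff_exists_getVert.1 hx
    rcases (hlen ▸ hk).lt_or_eq with h | rfl
    · exact ⟨k, by lia, rfl⟩
    · exact ⟨0, by lia, hlast⟩
  have hne : ∀ k, 1 ≤ k → k ≤ 2 * p → g k ≠ g 0 := by
    intro k h₁ h₂ h
    have := hinj ⟨k.zero_le, h₂⟩ ⟨le_rfl, by lia⟩ h
    lia
  obtain ⟨m, hm, hmadj⟩ := htough.exists_matching_avoiding hε (I := {x | x ∉ c.support})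
    (fun x hx y hy _ => hdom x y hx hy) (a := g 0) (b := g 1) (fun h => h (hgmem 0))
    (fun h => h (hgmem 1)) (hne 1 le_rfl (by lia)).symm (g 0)
  let f : V → V := fun x => if h : x ∈ c.support then x else m ⟨x, h⟩
  have hfin : ∀ x ∈ c.support, f x = x := fun x hx => dif_pos hx
  have hfout : ∀ x (hx : x ∉ c.support), f x = m ⟨x, hx⟩ := fun x hx => dif_neg hx
  have hmsupp : ∀ x, m x ∈ c.support := fun x => by
    by_contra h
    exact hdom x (m x) x.2 h (hmadj x).1
  have hfsupp : ∀ x, f x ∈ c.support := fun x => by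
    by_cases hx : x ∈ c.support
    · rwa [hfin x hx]
    · rw [hfout x hx]
      exact hmsupp _
  have hout : ∀ x k, f x = g k → x ≠ g k → x ∉ c.support := fun x k h hne hx =>
    hne ((hfin x hx).symm.trans h)
  have hf0 : ∀ x, f x = g 0 → x = g 0 := by
    intro x h
    by_contra hne
    have hx := hout x 0 h hne
    exact (hmadj ⟨x, hx⟩).2 ((hfout x hx).symm.trans h)
  have hfib : ∀ k, ∀ a : Fin 2,
      ∃ P : (G □ (⊤ : SimpleGraph (Fin 2))).Walk (g k, a) (g k, a + 1), P.IsPath ∧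
        ∀ z, z ∈ P.support ↔ f z.1 = g k := by
    intro k
    refine exists_prism_path_fiber (hfin _ (hgmem k)) ?_ ?_
    · intro x h hne
      have hx := hout x k h hne
      rw [← h, hfout x hx]
      exact (hmadj ⟨x, hx⟩).1.symm
    · intro x y hx hy hxne hyne
      have h₁ := hout x k hx hxne
      have h₂ := hout y k hy hyne
      have := hm ((hfout x h₁).symm.trans (hx.trans (hy.symm.trans (hfout y h₂))))
      exact congrArg Subtype.val this
  obtain ⟨P, hP, hPs⟩ := exists_prism_path_Icc (f := f) (g := g) (i := 1) (j := 2 * q - 1)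
    (by lia) (hinj.mono (Set.Icc_subset_Icc (by lia) (by lia))) (fun k _ _ => hadj k (by lia))
    (fun k _ _ => hfib k)
  obtain ⟨Q, hQ, hQs⟩ := exists_prism_path_Icc (f := f) (g := g) (i := 2 * q) (j := 2 * p)
    (by lia) (hinj.mono (Set.Icc_subset_Icc (by lia) (by lia))) (fun k _ _ => hadj k (by lia))
    (fun k _ _ => hfib k)
  have heven : ∀ n : ℕ, Fin.ofNat 2 (2 * n) = 0 := fun n => by
    exact Fin.ext (Nat.mul_mod_right 2 n)
  have hodd : Fin.ofNat 2 (2 * q - 1) = 1 := by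
    obtain ⟨r, rfl⟩ := Nat.exists_eq_add_of_le' hq1
    rw [show 2 * (r + 1) - 1 = 2 * r + 1 by lia, Fin.ofNat_two_succ, heven, zero_add]
  have hzero : Fin.ofNat 2 1 + 1 = 0 := by decide
  have hone : Fin.ofNat 2 (2 * q) + 1 = 1 := by rw [heven, zero_add]
  have hnot : ∀ (a : Fin 2) i j, 1 ≤ i → j ≤ 2 * p →
      ¬ ∃ k, i ≤ k ∧ k ≤ j ∧ f ((g 0, a) : V × Fin 2).1 = g k := by
    rintro a i j hi hj ⟨k, h₁, h₂, h⟩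
    exact hne k (by lia) (by lia) (h.symm.trans (hfin _ (hgmem 0)))
  have e₁ : (G □ (⊤ : SimpleGraph (Fin 2))).Adj (g 0, (1 : Fin 2))
      (g (2 * q), Fin.ofNat 2 (2 * q) + 1) := by
    rw [hone]; simpa using htri₃
  have e₂ : (G □ (⊤ : SimpleGraph (Fin 2))).Adj (g (2 * q - 1), Fin.ofNat 2 (2 * q - 1))
      (g 0, (1 : Fin 2)) := by
    rw [hodd]; simpa using htri₁.symm
  have hR : (Walk.cons e₁ Q).IsPath :=
    (Walk.cons_isPath_iff _ _).2 ⟨hQ, fun h => hnot 1 _ _ (by lia) le_rfl ((hQs _).1 h)⟩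
  have hPR : P.support.Disjoint (Walk.cons e₁ Q).support := by
    intro z hzP hzR
    rw [Walk.support_cons, List.mem_cons] at hzR
    rcases hzR with rfl | hzQ
    · exact hnot 1 _ _ le_rfl (by lia) ((hPs _).1 hzP)
    · obtain ⟨k, h₁, h₂, h⟩ := (hPs z).1 hzP
      obtain ⟨l, h₃, h₄, h'⟩ := (hQs z).1 hzQ
      have := hinj ⟨k.zero_le, by lia⟩ ⟨l.zero_le, h₄⟩ (h.symm.trans h')
      lia
  refine (hP.append_cons_s2 hR e₂ hPR).isHamiltonian_of_missing_vertex (z := (g 0, (0 : Fin 2)))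
    ?_ ?_ ?_ ?_ ?_
  · intro h
    have := hinj ⟨Nat.zero_le _, by lia⟩ ⟨Nat.zero_le _, le_rfl⟩ (congrArg Prod.fst h)
    lia
  · rw [Walk.mem_support_append_cons, Walk.support_cons, List.mem_cons, hPs, hQs]
    rintro (h | h | h)
    · exact hnot 0 _ _ le_rfl (by lia) h
    · simp at h
    · exact hnot 0 _ _ (by lia) le_rfl h
  · rw [hzero]; simpa using hadj 0 (by lia)
  · rw [heven]; simpa using hlast ▸ hadj (2 * p) (by lia)
  · rintro ⟨x, a⟩ hxa
    rw [Walk.mem_support_append_cons, Walk.support_cons, List.mem_cons, hPs, hQs]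
    obtain ⟨k, hk, hxk⟩ := hcover (f x) (hfsupp x)
    rcases Nat.eq_zero_or_pos k with rfl | hk0
    · obtain rfl := hf0 x hxk
      have ha : a = 1 := by
        have : ∀ a : Fin 2, a ≠ 0 → a = 1 := by decide
        exact this a (fun h => hxa (by rw [h]))
      exact Or.inr (Or.inl (by rw [ha]))
    · by_cases hkq : k ≤ 2 * q - 1
      · exact Or.inl ⟨k, hk0, hkq, hxk⟩
      · exact Or.inr (Or.inr ⟨k, by lia, hk, hxk⟩)
end

section
/- Let G be a 2-connected finite graph of order n. If δ₃(G) ≥ n + 2, where δ₃(G) is the minimum of d(x₁) + d(x₂) + d(x₃) over all sets {x₁, x₂, x₃} of three pairwise non-adjacent (independent) vertices of G, then every longest cycle in G is edge-dominating. -/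
open SimpleGraph Finset

variable {V : Type*}

/-- `l` is the vertex list of a walk of `G` from `a` to `b`. -/
structure IsListWalk (G : SimpleGraph V) (l : List V) (a b : V) : Prop where
  chain : l.IsChain G.Adj
  head : l.head? = some a
  last : l.getLast? = some b

namespace IsListWalk

variable {G : SimpleGraph V} {l l' : List V} {a b c d : V}

lemma ne_nil (h : IsListWalk G l a b) : l ≠ [] := by
  rintro rfl
  simpa using h.head

lemma length_pos (h : IsListWalk G l a b) : 0 < l.length :=
  List.length_pos_iff.2 h.ne_nil

lemma append (h : IsListWalk G l a b) (h' : IsListWalk G l' c d) (hbc : G.Adj b c) :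
    IsListWalk G (l ++ l') a d where
  chain := h.chain.append h'.chain (by simp [h.last, h'.head, hbc])
  head := by simp [h.head]
  last := by simp [h'.last]

lemma reverse (h : IsListWalk G l a b) : IsListWalk G l.reverse b a where
  chain := List.isChain_reverse.2 (h.chain.imp fun _ _ hxy => hxy.symm)
  head := by simp [h.last]
  last := by simp [h.head]

lemma singleton (a : V) : IsListWalk G [a] a a where
  chain := .singleton a
  head := rfl
  last := rfl

lemma two_le_length (h : IsListWalk G l a b) (hab : a ≠ b) : 2 ≤ l.length := by
  obtain ⟨-, h₁, h₂⟩ := h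
  match l with
  | [] => simp at h₁
  | [x] => simp at h₁ h₂; exact absurd (h₁.symm.trans h₂) hab
  | x :: y :: l => simp

lemma split {p q : List V} {x y : V} (h : IsListWalk G (p ++ x :: y :: q) a b) :
    IsListWalk G (p ++ [x]) a x ∧ IsListWalk G (y :: q) y b ∧ G.Adj x y := by
  obtain ⟨h₀, h₁, h₂⟩ := h
  rw [List.isChain_append_cons_cons] at h₀
  refine ⟨⟨h₀.1, ?_, by simp⟩, ⟨h₀.2.2, rfl, ?_⟩, h₀.2.1⟩
  · cases p <;> simpa using h₁
  · simpa [List.getLast?_append, List.getLast?_cons_cons] using h₂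

lemma exists_walk (h : IsListWalk G l a b) : ∃ p : G.Walk a b, p.support = l := by
  induction l generalizing a with
  | nil => exact absurd rfl h.ne_nil
  | cons x l ih =>
    obtain ⟨h₀, h₁, h₂⟩ := h
    obtain rfl : x = a := by simpa using h₁
    cases l with
    | nil =>
      obtain rfl : x = b := by simpa using h₂
      exact ⟨.nil, rfl⟩
    | cons y l =>
      rw [List.isChain_cons_cons] at h₀
      obtain ⟨p, hp⟩ := ih ⟨h₀.2, rfl, by simpa using h₂⟩
      exact ⟨.cons h₀.1 p, by simp [hp]⟩

lemma exists_isCycle (h : IsListWalk G l a b) (hba : G.Adj b a) (hl : l.Nodup)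
    (h3 : 3 ≤ l.length) : ∃ c : G.Walk b b, c.IsCycle ∧ c.length = l.length := by
  obtain ⟨p, rfl⟩ := h.exists_walk
  have hp : p.IsPath := p.isPath_def.2 hl
  refine ⟨.cons hba p, (Walk.cons_isCycle_iff p hba).2 ⟨hp, fun he => ?_⟩, by simp⟩
  rw [Sym2.eq_swap] at he
  have := hp.length_eq_one_of_mem_edges he
  simp at h3
  omega

end IsListWalk

lemma SimpleGraph.Walk.isListWalk_support {G : SimpleGraph V} {a b : V} (p : G.Walk a b) :
    IsListWalk G p.support a b where
  chain := p.isChain_adj_support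
  head := by cases p <;> simp
  last := by
    rw [List.getLast?_eq_some_getLast p.support_ne_nil, p.getLast_support]

lemma SimpleGraph.Walk.exists_isListWalk_tail {G : SimpleGraph V} {u : V} (c : G.Walk u u)
    (hc : c.IsCycle) :
    ∃ a, IsListWalk G c.support.tail a u ∧ G.Adj u a ∧ c.support.tail.Nodup ∧
      c.support.tail.length = c.length ∧ ∀ x, x ∈ c.support.tail ↔ x ∈ c.support := by
  cases c with
  | nil => exact absurd hc (by simp)
  | @cons _ w _ h p =>
    refine ⟨w, p.isListWalk_support, h, hc.support_nodup, by simp, fun x => ?_⟩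
    have := p.end_mem_support
    simp only [support_cons, List.tail_cons, List.mem_cons]
    grind

/-- A longest cycle of length `m`, cut into a list `I` from `u₁` to `v₂` and a list `J` from `u₂`
to `v₁`, such that `v₁` and `v₂` have neighbours `y₁` and `y₂` in a connected set `H` off the
cycle. -/
structure IsCycleSplit (G : SimpleGraph V) (H : Set V) (m : ℕ) (I J : List V)
    (u₁ u₂ v₁ v₂ y₁ y₂ : V) : Prop where
  walk_left : IsListWalk G I u₁ v₂
  walk_right : IsListWalk G J u₂ v₁
  adj_left : G.Adj v₁ u₁
  adj_right : G.Adj v₂ u₂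
  nodup : (I ++ J).Nodup
  length_eq : I.length + J.length = m
  notMem : ∀ v ∈ I ++ J, v ∉ H
  adj_y₁ : G.Adj v₁ y₁
  adj_y₂ : G.Adj v₂ y₂
  mem_y₁ : y₁ ∈ H
  mem_y₂ : y₂ ∈ H
  linked : ∀ a ∈ H, ∀ b ∈ H, ∃ l, IsListWalk G l a b ∧ l.Nodup ∧ ∀ v ∈ l, v ∈ H
  maximal : ∀ l a b, IsListWalk G l a b → G.Adj b a → l.Nodup → l.length ≤ m

namespace IsCycleSplit

variable {G : SimpleGraph V} {H : Set V} {m : ℕ} {I J : List V} {u₁ u₂ v₁ v₂ y₁ y₂ : V}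

lemma symm (h : IsCycleSplit G H m I J u₁ u₂ v₁ v₂ y₁ y₂) :
    IsCycleSplit G H m J I u₂ u₁ v₂ v₁ y₂ y₁ where
  walk_left := h.walk_right
  walk_right := h.walk_left
  adj_left := h.adj_right
  adj_right := h.adj_left
  nodup := List.nodup_append_comm.1 h.nodup
  length_eq := by have := h.length_eq; omega
  notMem v hv := h.notMem v (by simpa [or_comm] using hv)
  adj_y₁ := h.adj_y₂
  adj_y₂ := h.adj_y₁
  mem_y₁ := h.mem_y₂
  mem_y₂ := h.mem_y₁
  linked := h.linked
  maximal := h.maximal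

lemma exists_detour (h : IsCycleSplit G H m I J u₁ u₂ v₁ v₂ y₁ y₂) {a b : V}
    (ha : a ∈ H) (hb : b ∈ H) :
    ∃ l, IsListWalk G l a b ∧ (I ++ J ++ l).Nodup ∧ ∀ v ∈ l, v ∈ H := by
  obtain ⟨l, hl, hn, hH⟩ := h.linked a ha b hb
  refine ⟨l, hl, List.nodup_append.2 ⟨h.nodup, hn, ?_⟩, hH⟩
  rintro x hx y hy rfl
  exact h.notMem x hx (hH x hy)

lemma not_adj_mem (h : IsCycleSplit G H m I J u₁ u₂ v₁ v₂ y₁ y₂) {t : V} (ht : t ∈ H) :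
    ¬ G.Adj u₁ t := by
  intro hut
  obtain ⟨l, hl, hn, -⟩ := h.exists_detour h.mem_y₁ ht
  have := h.maximal _ _ _ ((h.walk_left.append h.walk_right h.adj_right).append hl h.adj_y₁)
    hut.symm hn
  have := hl.length_pos
  have := h.length_eq
  simp at *
  omega

lemma not_adj (h : IsCycleSplit G H m I J u₁ u₂ v₁ v₂ y₁ y₂) : ¬ G.Adj u₁ u₂ := by
  intro hu
  obtain ⟨l, hl, hn, -⟩ := h.exists_detour h.mem_y₁ h.mem_y₂
  have := h.maximal _ _ _ ((h.walk_left.reverse.append h.walk_right hu).append hl h.adj_y₁)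
    h.adj_y₂.symm (by
      refine (List.Perm.nodup_iff ?_).1 hn
      exact ((List.reverse_perm I).symm.append_right J).append_right l)
  have := hl.length_pos
  have := h.length_eq
  simp at *
  omega

lemma not_adj_of_notMem (h : IsCycleSplit G H m I J u₁ u₂ v₁ v₂ y₁ y₂) {t : V}
    (ht : t ∉ I ++ J) (h₁ : G.Adj u₁ t) : ¬ G.Adj u₂ t := by
  intro h₂
  obtain ⟨l, hl, hn, hH⟩ := h.exists_detour h.mem_y₁ h.mem_y₂
  have htl : t ∉ l := fun htl => h.not_adj_mem (hH t htl) h₁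
  have := h.maximal _ _ _ (((h.walk_left.reverse.append (.singleton t) h₁).append
    h.walk_right h₂.symm).append hl h.adj_y₁) h.adj_y₂.symm (by
      have hn' : (t :: (I ++ J ++ l)).Nodup := List.nodup_cons.2 ⟨by grind, hn⟩
      refine (List.Perm.nodup_iff ?_).1 hn'
      classical
      rw [List.perm_iff_count]
      intro x
      simp [List.count_cons]
      omega)
  have := hl.length_pos
  have := h.length_eq
  simp at *
  omega

lemma not_crossing (h : IsCycleSplit G H m I J u₁ u₂ v₁ v₂ y₁ y₂) {a b : V}
    (hab : [a, b] <:+: I) (hb : G.Adj u₁ b) : ¬ G.Adj u₂ a := by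
  intro ha
  obtain ⟨l, hl, hn, -⟩ := h.exists_detour h.mem_y₁ h.mem_y₂
  obtain ⟨p, q, rfl⟩ := hab
  have hI := h.walk_left
  simp only [List.append_assoc, List.cons_append, List.nil_append] at hI
  obtain ⟨hp, hq, -⟩ := hI.split
  have := h.maximal _ _ _ (((hq.reverse.append hp hb.symm).append
    h.walk_right ha.symm).append hl h.adj_y₁) h.adj_y₂.symm (by
      refine (List.Perm.nodup_iff ?_).1 hn
      classical
      rw [List.perm_iff_count]
      intro x
      simp [List.count_cons]
      omega)
  have := hl.length_pos
  have := h.length_eq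
  simp at *
  omega

lemma not_adj_succ (h : IsCycleSplit G H m I J u₁ u₂ v₁ v₂ y₁ y₂) {a b x : V}
    (hab : [a, b] <:+: I) (hx : x ∈ H) (ha : G.Adj x a) : ¬ G.Adj u₂ b := by
  intro hb
  obtain ⟨l, hl, hn, -⟩ := h.exists_detour hx h.mem_y₂
  obtain ⟨p, q, rfl⟩ := hab
  have hI := h.walk_left
  simp only [List.append_assoc, List.cons_append, List.nil_append] at hI
  obtain ⟨hp, hq, -⟩ := hI.split
  have := h.maximal _ _ _ (((hq.reverse.append h.walk_right hb.symm).append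
    hp h.adj_left).append hl ha.symm) h.adj_y₂.symm (by
      refine (List.Perm.nodup_iff ?_).1 hn
      classical
      rw [List.perm_iff_count]
      intro x
      simp [List.count_cons]
      omega)
  have := hl.length_pos
  have := h.length_eq
  simp at *
  omega

lemma not_adj_succ_succ (h : IsCycleSplit G H m I J u₁ u₂ v₁ v₂ y₁ y₂) {a b c x : V}
    (habc : [a, b, c] <:+: I) (hx : x ∈ H) (hxy : x ≠ y₁) (ha : G.Adj x a) :
    ¬ G.Adj u₁ c := by
  intro hc
  obtain ⟨l, hl, hn, -⟩ := h.exists_detour h.mem_y₁ hx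
  obtain ⟨p, q, rfl⟩ := habc
  have hI := h.walk_left
  simp only [List.append_assoc, List.cons_append, List.nil_append] at hI
  obtain ⟨hp, hq, -⟩ := hI.split
  obtain ⟨-, hq, -⟩ := IsListWalk.split (p := []) hq
  have := h.maximal _ _ _ (((hq.append h.walk_right h.adj_right).append
    hl h.adj_y₁).append hp.reverse ha) hc (by
      have hn' : (b :: ((c :: q) ++ J ++ l ++ (p ++ [a]).reverse)).Nodup := by
        refine (List.Perm.nodup_iff ?_).1 hn
        classical
        rw [List.perm_iff_count]
        intro x
        simp [List.count_cons]
        omega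
      exact hn'.of_cons)
  have := hl.two_le_length hxy.symm
  have := h.length_eq
  simp at *
  omega

end IsCycleSplit

lemma List.countP_add_countP_add_countP_le_length_aux (P Q R : V → Prop) [DecidablePred P]
    [DecidablePred Q] [DecidablePred R] (z a : V) (L : List V)
    (hPQ : ∀ a' b, [a', b] <:+: a :: L → P b → ¬ Q a')
    (hRQ : ∀ a' b, [a', b] <:+: z :: a :: L → R a' → ¬ Q b)
    (hRP : ∀ a' b c, [a', b, c] <:+: z :: a :: L → R a' → ¬ P c) :
    L.countP P + (a :: L).countP Q + (z :: (a :: L).dropLast).countP R ≤ L.length + 1 := by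
  induction L generalizing z a with
  | nil =>
    have := hRQ z a List.infix_rfl
    by_cases R z <;> by_cases Q a <;> simp_all
  | cons b L ih =>
    have ih := ih a b (fun a' b' h => hPQ a' b' (List.infix_cons h))
      (fun a' b' h => hRQ a' b' (List.infix_cons h))
      (fun a' b' c h => hRP a' b' c (List.infix_cons h))
    have h₁ := hPQ a b ⟨[], L, rfl⟩
    have h₂ := hRQ z a ⟨[], b :: L, rfl⟩
    have h₃ := hRP z a b ⟨[], L, rfl⟩
    by_cases R z <;> by_cases Q a <;> by_cases P b <;>
      simp_all [List.countP_cons] <;> omega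

lemma List.countP_add_countP_add_countP_le_length (P Q R : V → Prop) [DecidablePred P]
    [DecidablePred Q] [DecidablePred R] (a : V) (L : List V) (hPa : ¬ P a)
    (hPQ : ∀ a' b, [a', b] <:+: a :: L → P b → ¬ Q a')
    (hRQ : ∀ a' b, [a', b] <:+: a :: L → R a' → ¬ Q b)
    (hRP : ∀ a' b c, [a', b, c] <:+: a :: L → R a' → ¬ P c) :
    (a :: L).countP P + (a :: L).countP Q + (a :: L).dropLast.countP R ≤ (a :: L).length := by
  cases L with
  | nil => by_cases Q a <;> simp_all
  | cons b L =>
    have := List.countP_add_countP_add_countP_le_length_aux P Q R a b L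
      (fun a' b' h => hPQ a' b' (List.infix_cons h)) hRQ hRP
    have h₁ := hPQ a b ⟨[], L, rfl⟩
    by_cases Q a <;> by_cases P b <;> simp_all [List.countP_cons] <;> omega

lemma IsCycleSplit.countP_left_le {G : SimpleGraph V} [DecidableRel G.Adj] {H : Set V} {m : ℕ}
    {I J : List V} {u₁ u₂ v₁ v₂ y₁ y₂ : V} (h : IsCycleSplit G H m I J u₁ u₂ v₁ v₂ y₁ y₂)
    {x : V} (hx : x ∈ H) (R : V → Prop) [DecidablePred R] (hR : ∀ v, R v → G.Adj x v ∧ x ≠ y₁) :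
    I.countP (G.Adj u₁ ·) + I.countP (G.Adj u₂ ·) + I.dropLast.countP (R ·) ≤ I.length := by
  obtain ⟨a, L, rfl⟩ := List.exists_cons_of_ne_nil h.walk_left.ne_nil
  obtain rfl : a = u₁ := by simpa using h.walk_left.head
  exact List.countP_add_countP_add_countP_le_length (G.Adj a) (G.Adj u₂) R a L G.irrefl
    (fun _ _ hab => h.not_crossing hab)
    (fun _ _ hab hr => h.not_adj_succ hab hx (hR _ hr).1)
    (fun _ _ _ habc hr => h.not_adj_succ_succ habc hx (hR _ hr).2 (hR _ hr).1)

lemma List.countP_eq_card_filter [Fintype V] [DecidableEq V] (P : V → Prop) [DecidablePred P]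
    {l : List V} (hl : l.Nodup) :
    l.countP (P ·) = (Finset.univ.filter fun v => P v ∧ v ∈ l).card := by
  rw [List.countP_eq_length_filter, ← List.toFinset_card_of_nodup (hl.filter _)]
  congr 1
  ext v
  simp [and_comm]

lemma IsCycleSplit.degree_add_degree_le [Fintype V] [DecidableEq V] {G : SimpleGraph V}
    [DecidableRel G.Adj] {H : Set V} [DecidablePred (· ∈ H)] {m : ℕ}
    {I J : List V} {u₁ u₂ v₁ v₂ y₁ y₂ : V} (h : IsCycleSplit G H m I J u₁ u₂ v₁ v₂ y₁ y₂) :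
    G.degree u₁ + G.degree u₂ + (Finset.univ.filter (· ∈ H)).card + m ≤
      (I ++ J).countP (G.Adj u₁ ·) + (I ++ J).countP (G.Adj u₂ ·) + Fintype.card V := by
  have key : ∀ u, G.degree u = (I ++ J).countP (G.Adj u ·) +
      (Finset.univ.filter fun v => G.Adj u v ∧ v ∉ I ++ J).card := by
    intro u
    rw [List.countP_eq_card_filter (G.Adj u) h.nodup, ← card_neighborFinset_eq_degree,
      neighborFinset_eq_filter, ← Finset.filter_filter, ← Finset.filter_filter,
      Finset.card_filter_add_card_filter_not]
  have hm : m = (I ++ J).toFinset.card := by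
    rw [List.toFinset_card_of_nodup h.nodup, List.length_append, h.length_eq]
  have hd : ((Finset.univ.filter fun v => G.Adj u₁ v ∧ v ∉ I ++ J) ∪
      (Finset.univ.filter fun v => G.Adj u₂ v ∧ v ∉ I ++ J) ∪
      (Finset.univ.filter (· ∈ H)) ∪ (I ++ J).toFinset).card ≤ Fintype.card V :=
    Finset.card_le_univ _
  rw [Finset.card_union_of_disjoint, Finset.card_union_of_disjoint,
    Finset.card_union_of_disjoint] at hd
  · rw [key u₁, key u₂, hm]
    omega
  · rw [Finset.disjoint_left]
    intro t h₁ h₂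
    simp only [Finset.mem_filter, Finset.mem_univ, true_and] at h₁ h₂
    exact h.not_adj_of_notMem h₁.2 h₁.1 h₂.1
  · rw [Finset.disjoint_left]
    intro t h₁ h₂
    simp only [Finset.mem_filter, Finset.mem_univ, true_and, Finset.mem_union] at h₁ h₂
    rcases h₁ with h₁ | h₁
    · exact h.not_adj_mem h₂ h₁.1
    · exact h.symm.not_adj_mem h₂ h₁.1
  · rw [Finset.disjoint_left]
    intro t h₁ h₂
    have := h.notMem t
    simp only [Finset.mem_filter, Finset.mem_univ, true_and, Finset.mem_union,
      List.mem_toFinset] at h₁ h₂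
    tauto

lemma IsCycleSplit.exists_degree_sum_le [Fintype V] [DecidableEq V] {G : SimpleGraph V}
    [DecidableRel G.Adj] {H : Set V} {m : ℕ}
    {I J : List V} {u₁ u₂ v₁ v₂ y₁ y₂ : V} (h : IsCycleSplit G H m I J u₁ u₂ v₁ v₂ y₁ y₂)
    {x : V} (hx : x ∈ H) (hxH : ∀ t, G.Adj x t → t ∈ H ∨ t ∈ I ++ J)
    (hcount : (I ++ J).countP (G.Adj x ·) ≤ 2 ∨ x ≠ y₁ ∧ x ≠ y₂) :
    G.degree x + G.degree u₁ + G.degree u₂ ≤ Fintype.card V + 1 := by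
  classical
  have hdx : G.degree x + 1 ≤ (I ++ J).countP (G.Adj x ·) + (Finset.univ.filter (· ∈ H)).card := by
    rw [List.countP_eq_card_filter (G.Adj x) h.nodup, ← card_neighborFinset_eq_degree]
    have hsub : insert x (G.neighborFinset x) ⊆
        (Finset.univ.filter fun v => G.Adj x v ∧ v ∈ I ++ J) ∪ Finset.univ.filter (· ∈ H) := by
      intro t ht
      have := hxH t
      simp only [Finset.mem_insert, mem_neighborFinset, Finset.mem_union, Finset.mem_filter,
        Finset.mem_univ, true_and] at ht ⊢
      rcases ht with rfl | ht
      · exact .inr hx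
      · tauto
    rw [← Finset.card_insert_of_notMem (G.notMem_neighborFinset_self x)]
    exact (Finset.card_le_card hsub).trans (Finset.card_union_le _ _)
  have hd := h.degree_add_degree_le
  have hle : (I ++ J).countP (G.Adj u₁ ·) + (I ++ J).countP (G.Adj u₂ ·) +
      (I ++ J).countP (G.Adj x ·) ≤ m + 2 := by
    have hdrop : ∀ l : List V, l.countP (G.Adj x ·) ≤ l.dropLast.countP (G.Adj x ·) + 1 := by
      intro l
      rcases List.eq_nil_or_concat l with rfl | ⟨l, a, rfl⟩
      · simp
      · by_cases G.Adj x a <;> simp [List.countP_append, *]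
    have hI := hdrop I
    have hJ := hdrop J
    have hm := h.length_eq
    rcases hcount with hc | ⟨hc₁, hc₂⟩
    · have h₁ := h.countP_left_le hx (fun _ => False) (by simp)
      have h₂ := h.symm.countP_left_le hx (fun _ => False) (by simp)
      simp only [List.countP_append] at hc ⊢
      omega
    · have h₁ := h.countP_left_le hx (G.Adj x) fun _ hv => ⟨hv, hc₁⟩
      have h₂ := h.symm.countP_left_le hx (G.Adj x) fun _ hv => ⟨hv, hc₂⟩
      simp only [List.countP_append]
      omega
  omega

lemma exists_isCycleSplit {G : SimpleGraph V} {H : Set V} {C : List V} {a b v₁ v₂ y₁ y₂ : V}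
    (hC : IsListWalk G C a b) (hba : G.Adj b a) (hnd : C.Nodup) (hCH : ∀ v ∈ C, v ∉ H)
    (hv₁ : v₁ ∈ C) (hv₂ : v₂ ∈ C) (hv : v₁ ≠ v₂) (hvy₁ : G.Adj v₁ y₁) (hvy₂ : G.Adj v₂ y₂)
    (hy₁ : y₁ ∈ H) (hy₂ : y₂ ∈ H)
    (hlink : ∀ a ∈ H, ∀ b ∈ H, ∃ l, IsListWalk G l a b ∧ l.Nodup ∧ ∀ v ∈ l, v ∈ H)
    (hmax : ∀ l a b, IsListWalk G l a b → G.Adj b a → l.Nodup → l.length ≤ C.length) :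
    ∃ I J u₁ u₂, IsCycleSplit G H C.length I J u₁ u₂ v₁ v₂ y₁ y₂ ∧ (I ++ J).Perm C := by
  obtain ⟨A, hperm, a', hA, hva'⟩ : ∃ A, (A ++ [v₁]).Perm C ∧
      ∃ a', IsListWalk G (A ++ [v₁]) a' v₁ ∧ G.Adj v₁ a' := by
    obtain ⟨s, t, rfl⟩ := List.append_of_mem hv₁
    cases t with
    | nil =>
      obtain rfl : v₁ = b := by simpa using hC.last
      exact ⟨s, .rfl, a, hC, hba⟩
    | cons w t =>
      obtain ⟨h₁, h₂, h₃⟩ := hC.split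
      refine ⟨w :: t ++ s, ?_, w, by simpa using h₂.append h₁ hba, h₃⟩
      classical
      rw [List.perm_iff_count]
      intro x
      simp [List.count_cons]
      omega
  have hv₂A : v₂ ∈ A := by
    have := hperm.mem_iff.2 hv₂
    simpa [hv.symm] using this
  obtain ⟨s, t, rfl⟩ := List.append_of_mem hv₂A
  obtain ⟨w, t', ht⟩ : ∃ w t', t ++ [v₁] = w :: t' :=
    List.exists_cons_of_ne_nil (by simp)
  have hsplit : s ++ v₂ :: t ++ [v₁] = s ++ v₂ :: w :: t' := by simp [ht]
  rw [hsplit] at hA hperm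
  obtain ⟨h₁, h₂, h₃⟩ := hA.split
  have hp : (s ++ [v₂] ++ w :: t').Perm C := by simpa using hperm
  refine ⟨s ++ [v₂], w :: t', a', w, ⟨h₁, h₂, hva', h₃, hp.nodup_iff.2 hnd, ?_, ?_, hvy₁, hvy₂,
    hy₁, hy₂, hlink, hmax⟩, hp⟩
  · rw [← List.length_append, hp.length_eq]
  · exact fun v hv => hCH v (hp.mem_iff.1 hv)

lemma exists_component_off [Fintype V] (G : SimpleGraph V) (C : List V) {x : V} (hx : x ∉ C) :
    ∃ H : Set V, x ∈ H ∧ (∀ v ∈ C, v ∉ H) ∧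
      (∀ a ∈ H, ∀ t, G.Adj a t → t ∈ H ∨ t ∈ C) ∧
      ∀ a ∈ H, ∀ b ∈ H, ∃ l, IsListWalk G l a b ∧ l.Nodup ∧ ∀ v ∈ l, v ∈ H := by
  classical
  let G' : SimpleGraph V :=
    { Adj := fun a b => G.Adj a b ∧ a ∉ C ∧ b ∉ C
      symm := ⟨fun _ _ h => ⟨h.1.symm, h.2.2, h.2.1⟩⟩
      loopless := ⟨fun _ h => G.irrefl h.1⟩ }
  have hoff : ∀ v, G'.Reachable x v → v ∉ C := by
    rintro v ⟨p⟩
    induction p with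
    | nil => exact hx
    | cons h _ ih => exact ih h.2.2
  refine ⟨{v | G'.Reachable x v}, .refl x, fun v hv h => hoff v h hv, ?_, ?_⟩
  · intro a ha t hat
    by_cases ht : t ∈ C
    · exact .inr ht
    · have hat' : G'.Adj a t := ⟨hat, hoff a ha, ht⟩
      exact .inl (Reachable.trans ha hat'.reachable)
  · intro a ha b hb
    obtain ⟨p, hp⟩ := (Reachable.trans (Reachable.symm ha) hb).exists_isPath
    refine ⟨p.support, ⟨?_, p.isListWalk_support.head, p.isListWalk_support.last⟩, hp.support_nodup,
      fun v hv => Reachable.trans ha (p.takeUntil v hv).reachable⟩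
    exact p.isChain_adj_support.imp fun _ _ h => h.1

lemma KConnected.exists_adj_notMem [Fintype V] {G : SimpleGraph V} {k : ℕ} (hG : KConnected k G)
    {S : Finset V} (hS : S.card < k) {H : Set V} {x w : V} (hx : x ∈ H) (hw : w ∉ H)
    (hxS : x ∉ S) (hwS : w ∉ S) : ∃ a ∈ H, ∃ b ∉ H, b ∉ S ∧ G.Adj a b := by
  obtain ⟨p⟩ := (hG.2 S hS).preconnected ⟨x, by simpa using hxS⟩ ⟨w, by simpa using hwS⟩
  obtain ⟨d, -, h₁, h₂⟩ := p.exists_boundary_dart {v | v.1 ∈ H} hx hw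
  exact ⟨d.fst, h₁, d.snd, h₂, fun h => d.snd.2 h, d.adj⟩

/-- If `G` is a 2-connected graph of order `n` with `δ₃(G) ≥ n + 2`, then every
longest cycle in `G` is edge-dominating. -/
theorem longest_cycle_edgeDominating_of_sigma3
    [Fintype V] [DecidableEq V] (G : SimpleGraph V) [DecidableRel G.Adj]
    (hconn : KConnected 2 G)
    (hdeg : ∀ x₁ x₂ x₃ : V, x₁ ≠ x₂ → x₁ ≠ x₃ → x₂ ≠ x₃ →
      ¬ G.Adj x₁ x₂ → ¬ G.Adj x₁ x₃ → ¬ G.Adj x₂ x₃ →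
      Fintype.card V + 2 ≤ G.degree x₁ + G.degree x₂ + G.degree x₃)
    (u : V) (c : G.Walk u u) (hc : c.IsCycle)
    (hlongest : ∀ (w : V) (c' : G.Walk w w), c'.IsCycle → c'.length ≤ c.length) :
    IsEdgeDominating G c := by
  classical
  obtain ⟨a, hC, hba, hnd, hlen, hmem⟩ := c.exists_isListWalk_tail hc
  generalize c.support.tail = C at hC hnd hlen hmem
  have h3 : 3 ≤ C.length := hlen ▸ hc.three_le_length
  have hmax : ∀ l a b, IsListWalk G l a b → G.Adj b a → l.Nodup → l.length ≤ C.length := by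
    intro l a b hl hba hnd
    by_contra! hlt
    obtain ⟨c', hc', hc'l⟩ := hl.exists_isCycle hba hnd (by omega)
    have := hlongest b c' hc'
    omega
  intro x y hx hy hxy
  rw [← hmem] at hx hy
  obtain ⟨H, hxH, hCH, hclosed, hlink⟩ := exists_component_off G C hx
  have hyH : y ∈ H := (hclosed x hxH y hxy).resolve_right hy
  have main : ∀ z ∈ H, ∀ v₁ ∈ C, ∀ v₂ ∈ C, ∀ y₁ ∈ H, ∀ y₂ ∈ H, v₁ ≠ v₂ → G.Adj v₁ y₁ →
      G.Adj v₂ y₂ → ¬ (C.countP (G.Adj z ·) ≤ 2 ∨ z ≠ y₁ ∧ z ≠ y₂) := by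
    intro z hz v₁ hv₁ v₂ hv₂ y₁ hy₁ y₂ hy₂ hv h₁ h₂ hcount
    obtain ⟨I, J, u₁, u₂, h, hp⟩ :=
      exists_isCycleSplit hC hba hnd hCH hv₁ hv₂ hv h₁ h₂ hy₁ hy₂ hlink hmax
    have hle := h.exists_degree_sum_le hz
      (fun t ht => (hclosed z hz t ht).imp_right hp.mem_iff.2) (by rwa [hp.countP_eq])
    have hu₁ : u₁ ∈ I := List.mem_of_mem_head? h.walk_left.head
    have hu₂ : u₂ ∈ J := List.mem_of_mem_head? h.walk_right.head
    have hge := hdeg z u₁ u₂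
      (fun e => h.notMem u₁ (by simp [hu₁]) (e ▸ hz))
      (fun e => h.notMem u₂ (by simp [hu₂]) (e ▸ hz))
      (fun e => (List.nodup_append.1 h.nodup).2.2 u₁ hu₁ u₂ hu₂ e)
      (fun e => h.not_adj_mem hz e.symm) (fun e => h.symm.not_adj_mem hz e.symm) h.not_adj
    omega
  by_cases hy2 : C.countP (G.Adj y ·) ≤ 2
  · have attach : ∀ S : Finset V, S.card < 2 → (∀ v ∈ S, v ∈ C) →
        ∃ v ∈ C, v ∉ S ∧ ∃ z ∈ H, G.Adj v z := by
      intro S hS hSC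
      obtain ⟨w, hw, hwS⟩ : ∃ w ∈ C.toFinset, w ∉ S :=
        Finset.exists_mem_notMem_of_card_lt_card
          (by rw [List.toFinset_card_of_nodup hnd]; omega)
      obtain ⟨z, hz, v, hv, hvS, hzv⟩ := hconn.exists_adj_notMem hS hxH
        (hCH w (by simpa using hw)) (fun h => hx (hSC x h)) hwS
      exact ⟨v, (hclosed z hz v hzv).resolve_left hv, hvS, z, hz, hzv.symm⟩
    obtain ⟨v₁, hv₁, -, y₁, hy₁, h₁⟩ := attach ∅ (by simp) (by simp)
    obtain ⟨v₂, hv₂, hne, y₂, hy₂, h₂⟩ := attach {v₁} (by simp) (by simpa using hv₁)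
    exact main y hyH v₁ hv₁ v₂ hv₂ y₁ hy₁ y₂ hy₂ (fun e => hne (by simp [e])) h₁ h₂ (.inl hy2)
  · rw [List.countP_eq_card_filter (G.Adj y) hnd] at hy2
    obtain ⟨v₁, hv₁, v₂, hv₂, hne⟩ := Finset.one_lt_card.1 (lt_trans one_lt_two (not_le.1 hy2))
    simp only [Finset.mem_filter, Finset.mem_univ, true_and] at hv₁ hv₂
    exact main x hxH v₁ hv₁.2 v₂ hv₂.2 y hyH y hyH hne hv₁.1.symm hv₂.1.symm
      (.inr ⟨hxy.ne, hxy.ne⟩)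
end
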